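/- There exists a universal constant C > 0 such that every log-concave probability measure μ on ℝⁿ that is 1-tilt-stable is (C · n^{1/6} · K̃ₙ^{1/3})-strongly tilt-stable, where K̃ₙ = sup_ν ‖ |X| − E|X| ‖_{ψ₂}, the supremum running over all 1-tilt-stable log-concave probability measures ν on ℝⁿ (with X distributed according to ν). -/

import Mathlib

open MeasureTheory Real
open scoped ENNReal NNReal RealInnerProductSpace

noncomputable section

abbrev Euc (n : ℕ) := EuclideanSpace ℝ (Fin n)

/-- Entropy of a nonnegative function with respect to a measure. -/
def ent {Ω : Type*} [MeasurableSpace Ω] (μ : Measure Ω) (g : Ω → ℝ) : ℝ :=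
  (∫ x, g x * Real.log (g x) ∂μ) - (∫ x, g x ∂μ) * Real.log (∫ x, g x ∂μ)

/-- μ satisfies the log-Sobolev inequality with constant ρ. -/
def SatisfiesLSI {n : ℕ} (μ : Measure (Euc n)) (ρ : ℝ) : Prop :=
  ∀ f : Euc n → ℝ, LocallyLipschitz f →
    Integrable (fun x => f x ^ 2) μ →
    Integrable (fun x => f x ^ 2 * Real.log (f x ^ 2)) μ →
    Integrable (fun x => ‖fderiv ℝ f x‖ ^ 2) μ →
    ent μ (fun x => f x ^ 2) ≤ 2 * ρ ^ 2 * ∫ x, ‖fderiv ℝ f x‖ ^ 2 ∂μ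

/-- A measure is log-concave if it has a log-concave density wrt the Lebesgue measure. -/
def IsLogConcave {V : Type*} [MeasureSpace V] [AddCommGroup V] [Module ℝ V] (μ : Measure V) : Prop :=
  ∃ d : V → ℝ, Measurable d ∧ (∀ x, 0 ≤ d x) ∧
    (∀ x y : V, ∀ a b : ℝ, 0 ≤ a → 0 ≤ b → a + b = 1 →
      d x ^ a * d y ^ b ≤ d (a • x + b • y)) ∧
    μ = volume.withDensity fun x => ENNReal.ofReal (d x)

/-- The ψ₂ (sub-gaussian) norm of `g` under `μ` is at most `t`. -/
def HasPsi2NormLE {Ω : Type*} [MeasurableSpace Ω] (μ : Measure Ω) (g : Ω → ℝ) (t : ℝ) : Prop :=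
  0 < t ∧ ∫ x, Real.exp (g x ^ 2 / t ^ 2) ∂μ ≤ 2

/-- The ψ₁ (sub-exponential) norm of `g` under `μ` is at most `K`. -/
def HasPsi1NormLE {Ω : Type*} [MeasurableSpace Ω] (μ : Measure Ω) (g : Ω → ℝ) (K : ℝ) : Prop :=
  0 < K ∧ ∫ x, Real.exp (|g x| / K) ∂μ ≤ 2

/-- The ψ₂ norm. -/
def psi2 {Ω : Type*} [MeasurableSpace Ω] (μ : Measure Ω) (g : Ω → ℝ) : ℝ :=
  sInf {t : ℝ | HasPsi2NormLE μ g t}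

/-- Barycenter. -/
def bary {n : ℕ} (μ : Measure (Euc n)) : Euc n := ∫ x, x ∂μ

/-- Exponential tilt. -/
def tilt {n : ℕ} (μ : Measure (Euc n)) (h : Euc n) : Measure (Euc n) :=
  (ENNReal.ofReal (∫ x, Real.exp ⟪h, x⟫ ∂μ))⁻¹ •
    μ.withDensity fun x => ENNReal.ofReal (Real.exp ⟪h, x⟫)

/-- Gaussian-tilted measure μ_{t,h}. -/
def gtilt {n : ℕ} (μ : Measure (Euc n)) (t : ℝ) (h : Euc n) : Measure (Euc n) :=
  (ENNReal.ofReal (∫ x, Real.exp (-t * ‖x‖ ^ 2 + ⟪h, x⟫) ∂μ))⁻¹ •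
    μ.withDensity fun x => ENNReal.ofReal (Real.exp (-t * ‖x‖ ^ 2 + ⟪h, x⟫))

/-- All exponential tilts of μ are well defined. -/
def TiltsWellDefined {n : ℕ} (μ : Measure (Euc n)) : Prop :=
  ∀ h : Euc n, Integrable (fun x => Real.exp ⟪h, x⟫) μ

/-- μ is β-tilt-stable: Cov(τ_h μ) ≼ β² Iₙ for all h. -/
def TiltStable {n : ℕ} (μ : Measure (Euc n)) (β : ℝ) : Prop :=
  ∀ h θ : Euc n, ‖θ‖ = 1 →
    ∫ x, ⟪x - bary (tilt μ h), θ⟫ ^ 2 ∂(tilt μ h) ≤ β ^ 2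

/-- μ is β-strongly tilt-stable. -/
def StronglyTiltStable {n : ℕ} (μ : Measure (Euc n)) (β : ℝ) : Prop :=
  ∀ t : ℝ, 0 < t → ∀ h θ : Euc n, ‖θ‖ = 1 →
    ∫ x, ⟪x - bary (gtilt μ t h), θ⟫ ^ 2 ∂(gtilt μ t h) ≤ β ^ 2

/-- Log-Sobolev constant. -/
def logSobolevConstant {n : ℕ} (μ : Measure (Euc n)) : ℝ :=
  sInf {ρ : ℝ | 0 < ρ ∧ SatisfiesLSI μ ρ}

/-- `K̃ₙ`: the supremum of `‖ |X| - E|X| ‖_{ψ₂}` over 1-tilt-stable log-concave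
probability measures on `ℝⁿ`. -/
def Ktilde (n : ℕ) : ℝ :=
  sSup {r : ℝ | ∃ μ : Measure (Euc n), IsProbabilityMeasure μ ∧ IsLogConcave μ ∧
    TiltsWellDefined μ ∧ TiltStable μ 1 ∧ r = psi2 μ (fun x => ‖x‖ - ∫ y, ‖y‖ ∂μ)}

section

open ProbabilityTheory

open scoped Pointwise

/-- The Prékopa–Leindler inequality holds on `V`. -/
def PrekopaLeindler (V : Type*) [MeasureSpace V] [AddCommGroup V] [Module ℝ V] : Prop :=
  ∀ a b : ℝ, 0 < a → 0 < b → a + b = 1 → ∀ u v w : V → ℝ≥0∞,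
    Measurable u → Measurable v → Measurable w →
    (∀ x y, u x ^ a * v y ^ b ≤ w (a • x + b • y)) →
    (∫⁻ x, u x) ^ a * (∫⁻ x, v x) ^ b ≤ ∫⁻ x, w x

theorem ennreal_weighted_am_gm {a b : ℝ} (ha : 0 < a) (hb : 0 < b) (hab : a + b = 1)
    (x y : ℝ≥0∞) : x ^ a * y ^ b ≤ ENNReal.ofReal a * x + ENNReal.ofReal b * y := by
  have hpq : Real.HolderConjugate a⁻¹ b⁻¹ := by
    rw [Real.holderConjugate_iff]
    constructor
    · rw [one_lt_inv₀ ha]; linarith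
    · simpa using hab
  have h := ENNReal.young_inequality (x ^ a) (y ^ b) hpq
  rw [← ENNReal.rpow_mul, ← ENNReal.rpow_mul, mul_inv_cancel₀ ha.ne', mul_inv_cancel₀ hb.ne',
    ENNReal.rpow_one, ENNReal.rpow_one, ENNReal.ofReal_inv_of_pos ha,
    ENNReal.ofReal_inv_of_pos hb, div_eq_mul_inv, div_eq_mul_inv, inv_inv, inv_inv] at h
  rw [mul_comm (ENNReal.ofReal a), mul_comm (ENNReal.ofReal b)]
  exact h

theorem compact_brunn_minkowski_real {a b : ℝ} (ha : 0 < a) (hb : 0 < b)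
    {A B C : Set ℝ} (hA : IsCompact A) (hB : IsCompact B) (hAn : A.Nonempty) (hBn : B.Nonempty)
    (hC : ∀ x ∈ A, ∀ y ∈ B, a * x + b * y ∈ C) :
    ENNReal.ofReal a * volume A + ENNReal.ofReal b * volume B ≤ volume C := by
  obtain ⟨α, hα, hα'⟩ := hA.exists_isMaxOn hAn continuous_id.continuousOn
  obtain ⟨β, hβ, hβ'⟩ := hB.exists_isMinOn hBn continuous_id.continuousOn
  set A' : Set ℝ := (fun x => b * β + x) '' (a • A) with hA'
  set B' : Set ℝ := (fun x => a * α + x) '' (b • B) with hB'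
  have vA : volume A' = ENNReal.ofReal a * volume A := by
    rw [hA', Set.image_add_left, measure_preimage_add, Measure.addHaar_smul]
    simp [abs_of_pos ha]
  have vB : volume B' = ENNReal.ofReal b * volume B := by
    rw [hB', Set.image_add_left, measure_preimage_add, Measure.addHaar_smul]
    simp [abs_of_pos hb]
  have mB : MeasurableSet B' :=
    ((hB.smul b).image (by fun_prop)).isClosed.measurableSet
  have hd : AEDisjoint volume A' B' := by
    have : A' ∩ B' ⊆ {a * α + b * β} := by
      rintro z ⟨⟨_, ⟨x, hx, rfl⟩, rfl⟩, ⟨_, ⟨y, hy, rfl⟩, h2⟩⟩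
      have h3 : x ≤ α := hα' hx
      have h4 : β ≤ y := hβ' hy
      simp only [smul_eq_mul, Set.mem_singleton_iff] at *
      nlinarith [mul_le_mul_of_nonneg_left h3 ha.le, mul_le_mul_of_nonneg_left h4 hb.le]
    exact measure_mono_null this (by simp)
  rw [← vA, ← vB, ← measure_union₀ mB.nullMeasurableSet hd]
  apply measure_mono
  rintro z (⟨_, ⟨x, hx, rfl⟩, rfl⟩ | ⟨_, ⟨y, hy, rfl⟩, rfl⟩)
  · have := hC x hx β hβ
    simpa [add_comm] using this
  · exact hC α hα y hy

theorem brunn_minkowski_real {a b : ℝ} (ha : 0 < a) (hb : 0 < b)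
    {A B C : Set ℝ} (hA : MeasurableSet A) (hB : MeasurableSet B) (hAn : A.Nonempty)
    (hBn : B.Nonempty) (hC : ∀ x ∈ A, ∀ y ∈ B, a * x + b * y ∈ C) :
    ENNReal.ofReal a * volume A + ENNReal.ofReal b * volume B ≤ volume C := by
  obtain ⟨x0, hx0⟩ := hAn
  obtain ⟨y0, hy0⟩ := hBn
  rw [hA.measure_eq_iSup_isCompact, hB.measure_eq_iSup_isCompact]
  simp only [ENNReal.mul_iSup, ENNReal.iSup_add, ENNReal.add_iSup]
  have key : ∀ K ⊆ A, IsCompact K → ∀ L ⊆ B, IsCompact L →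
      ENNReal.ofReal a * volume K + ENNReal.ofReal b * volume L ≤ volume C := by
    intro K hK hKc L hL hLc
    have := compact_brunn_minkowski_real (C := C) ha hb (hKc.union (isCompact_singleton (x := x0)))
      (hLc.union (isCompact_singleton (x := y0))) ⟨x0, by simp⟩ ⟨y0, by simp⟩ (by
        intro x hx y hy
        refine hC x ?_ y ?_
        · rcases hx with h | rfl
          exacts [hK h, hx0]
        · rcases hy with h | rfl
          exacts [hL h, hy0])
    refine le_trans ?_ this
    gcongr <;> exact Set.subset_union_left
  have : ENNReal.ofReal a * (⨆ K, ⨆ (_ : K ⊆ A), ⨆ (_ : IsCompact K), volume K) +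
      ENNReal.ofReal b * (⨆ K, ⨆ (_ : K ⊆ B), ⨆ (_ : IsCompact K), volume K) ≤ volume C := by
    have e : ∀ (S : Set ℝ), (⨆ K, ⨆ (_ : K ⊆ S), ⨆ (_ : IsCompact K), volume K) =
        ⨆ K : {K : Set ℝ // K ⊆ S ∧ IsCompact K}, volume K.1 := by
      intro S
      simp [iSup_subtype, iSup_and]
    rw [e, e, ENNReal.mul_iSup, ENNReal.mul_iSup]
    have : ∀ S : Set ℝ, Nonempty {K : Set ℝ // K ⊆ S ∧ IsCompact K} :=
      fun S => ⟨⟨∅, by simp, isCompact_empty⟩⟩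
    refine ENNReal.iSup_add_iSup_le ?_
    intro K L
    exact key K.1 K.2.1 K.2.2 L.1 L.2.1 L.2.2
  simpa only [ENNReal.mul_iSup, ENNReal.iSup_add, ENNReal.add_iSup] using this

theorem lintegral_le_one_layercake {u : ℝ → ℝ≥0∞} (hu : Measurable u) (h1 : ∀ x, u x ≤ 1) :
    ∫⁻ x, u x = ∫⁻ t in Set.Ioo (0 : ℝ) 1, volume {x | ENNReal.ofReal t < u x} := by
  have e : ∀ x, ENNReal.ofReal (u x).toReal = u x := fun x =>
    ENNReal.ofReal_toReal (ne_top_of_le_ne_top ENNReal.one_ne_top (h1 x))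
  have := lintegral_eq_lintegral_meas_lt (volume : Measure ℝ) (f := fun x => (u x).toReal)
    (Filter.Eventually.of_forall fun x => ENNReal.toReal_nonneg) hu.ennreal_toReal.aemeasurable
  simp only [e] at this
  rw [this, ← Set.Ioo_union_Ici_eq_Ioi (zero_lt_one' ℝ),
    lintegral_union measurableSet_Ici (by
      rw [Set.disjoint_left]; intro x hx; simpa using hx.2)]
  have z : ∫⁻ t in Set.Ici (1 : ℝ), volume {x | t < (u x).toReal} = 0 := by
    rw [setLIntegral_eq_zero_iff measurableSet_Ici]
    · refine Filter.Eventually.of_forall fun t ht => ?_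
      have : {x | t < (u x).toReal} = ∅ := by
        ext x
        simp only [Set.mem_ofPred_eq, Set.mem_empty_iff_false, iff_false, not_lt]
        have : (u x).toReal ≤ 1 := by
          simpa using ENNReal.toReal_mono ENNReal.one_ne_top (h1 x)
        exact this.trans ht
      simp [this]
    · exact Antitone.measurable fun s t h => measure_mono fun x hx => lt_of_le_of_lt h hx
  rw [z, add_zero]
  refine setLIntegral_congr_fun measurableSet_Ioo fun t ht => ?_
  congr 1
  ext x
  simp only [Set.mem_ofPred_eq]
  rw [ENNReal.ofReal_lt_iff_lt_toReal ht.1.le (ne_top_of_le_ne_top ENNReal.one_ne_top (h1 x))]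

theorem prekopaLeindler_real_normalized {a b : ℝ} (ha : 0 < a) (hb : 0 < b) (hab : a + b = 1)
    {u v w : ℝ → ℝ≥0∞} (hu : Measurable u) (hv : Measurable v) (hw : Measurable w)
    (hu1 : ⨆ x, u x = 1) (hv1 : ⨆ x, v x = 1)
    (h : ∀ x y, u x ^ a * v y ^ b ≤ w (a • x + b • y)) :
    (∫⁻ x, u x) ^ a * (∫⁻ x, v x) ^ b ≤ ∫⁻ x, w x := by
  refine (ennreal_weighted_am_gm ha hb hab _ _).trans ?_
  have hu1' : ∀ x, u x ≤ 1 := fun x => hu1 ▸ le_iSup u x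
  have hv1' : ∀ x, v x ≤ 1 := fun x => hv1 ▸ le_iSup v x
  have hm : ∀ f : ℝ → ℝ≥0∞, Measurable fun t : ℝ => volume {x | ENNReal.ofReal t < f x} :=
    fun f => Antitone.measurable fun s t h => measure_mono fun x hx =>
      lt_of_le_of_lt (ENNReal.ofReal_le_ofReal h) hx
  calc _ ≤ ∫⁻ x, min (w x) 1 := by
        rw [lintegral_le_one_layercake hu hu1', lintegral_le_one_layercake hv hv1',
          lintegral_le_one_layercake (hw.min measurable_const) (fun x => min_le_right _ _),
          ← lintegral_const_mul _ (hm u), ← lintegral_const_mul _ (hm v),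
          ← lintegral_add_left ((hm u).const_mul _)]
        refine setLIntegral_mono' measurableSet_Ioo fun t ht => ?_
        have ht1 : ENNReal.ofReal t < 1 := by simpa using ht.2
        refine brunn_minkowski_real ha hb (measurableSet_lt measurable_const hu)
          (measurableSet_lt measurable_const hv) ?_ ?_ ?_
        · rw [← hu1] at ht1
          exact lt_iSup_iff.1 ht1
        · rw [← hv1] at ht1
          exact lt_iSup_iff.1 ht1
        · intro x hx y hy
          refine lt_min (lt_of_lt_of_le ?_ (h x y)) ht1
          have : ENNReal.ofReal t = ENNReal.ofReal t ^ a * ENNReal.ofReal t ^ b := by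
            rw [← ENNReal.rpow_add _ _ (by simpa using ht.1) ENNReal.ofReal_ne_top, hab,
              ENNReal.rpow_one]
          rw [this]
          exact ENNReal.mul_lt_mul (ENNReal.rpow_lt_rpow hx ha) (ENNReal.rpow_lt_rpow hy hb)
    _ ≤ _ := lintegral_mono fun x => min_le_left _ _

theorem prekopaLeindler_real_bounded {a b : ℝ} (ha : 0 < a) (hb : 0 < b) (hab : a + b = 1)
    {u v w : ℝ → ℝ≥0∞} (hu : Measurable u) (hv : Measurable v) (hw : Measurable w)
    (hu1 : ⨆ x, u x ≠ ∞) (hv1 : ⨆ x, v x ≠ ∞)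
    (h : ∀ x y, u x ^ a * v y ^ b ≤ w (a • x + b • y)) :
    (∫⁻ x, u x) ^ a * (∫⁻ x, v x) ^ b ≤ ∫⁻ x, w x := by
  by_cases hu0 : ⨆ x, u x = 0
  · have : ∀ x, u x = 0 := by simpa using hu0
    simp [this, ha]
  by_cases hv0 : ⨆ x, v x = 0
  · have : ∀ x, v x = 0 := by simpa using hv0
    simp [this, hb]
  set α := ⨆ x, u x with hα
  set β := ⨆ x, v x with hβ
  set c := α ^ a * β ^ b
  have hc0 : c ≠ 0 := by
    refine mul_ne_zero ?_ ?_
    · exact (ENNReal.rpow_pos (pos_iff_ne_zero.2 hu0) hu1).ne'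
    · exact (ENNReal.rpow_pos (pos_iff_ne_zero.2 hv0) hv1).ne'
  have hct : c ≠ ∞ := ENNReal.mul_ne_top (ENNReal.rpow_ne_top_of_nonneg ha.le hu1)
    (ENNReal.rpow_ne_top_of_nonneg hb.le hv1)
  have key := prekopaLeindler_real_normalized ha hb hab (u := fun x => α⁻¹ * u x)
    (v := fun x => β⁻¹ * v x) (w := fun x => c⁻¹ * w x) (hu.const_mul _) (hv.const_mul _)
    (hw.const_mul _) (by rw [← ENNReal.mul_iSup, ← hα, ENNReal.inv_mul_cancel hu0 hu1])
    (by rw [← ENNReal.mul_iSup, ← hβ, ENNReal.inv_mul_cancel hv0 hv1]) ?_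
  · rw [lintegral_const_mul _ hu, lintegral_const_mul _ hv, lintegral_const_mul _ hw,
      ENNReal.mul_rpow_of_nonneg _ _ ha.le, ENNReal.mul_rpow_of_nonneg _ _ hb.le,
      mul_mul_mul_comm, ENNReal.inv_rpow, ENNReal.inv_rpow,
      ← ENNReal.mul_inv (Or.inr (ENNReal.rpow_ne_top_of_nonneg hb.le hv1))
        (Or.inl (ENNReal.rpow_ne_top_of_nonneg ha.le hu1))] at key
    exact (ENNReal.mul_le_mul_iff_right (ENNReal.inv_ne_zero.2 hct) (ENNReal.inv_ne_top.2 hc0)).1 key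
  · intro x y
    rw [ENNReal.mul_rpow_of_nonneg _ _ ha.le, ENNReal.mul_rpow_of_nonneg _ _ hb.le,
      mul_mul_mul_comm, ENNReal.inv_rpow, ENNReal.inv_rpow,
      ← ENNReal.mul_inv (Or.inr (ENNReal.rpow_ne_top_of_nonneg hb.le hv1))
        (Or.inl (ENNReal.rpow_ne_top_of_nonneg ha.le hu1))]
    gcongr
    exact h x y

theorem prekopaLeindler_real : PrekopaLeindler ℝ := by
  intro a b ha hb hab u v w hu hv hw h
  have hs : ∀ f : ℝ → ℝ≥0∞, Measurable f →
      Filter.Tendsto (fun N : ℕ => ∫⁻ x, min (f x) N) Filter.atTop (nhds (∫⁻ x, f x)) := by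
    intro f hf
    refine lintegral_tendsto_of_tendsto_of_monotone
      (fun N => (hf.min measurable_const).aemeasurable)
      (Filter.Eventually.of_forall fun x m n hmn => ?_) (Filter.Eventually.of_forall fun x => ?_)
    · exact min_le_min_left _ (by exact_mod_cast hmn)
    · have : Filter.Tendsto (fun N : ℕ => min (f x) (N : ℝ≥0∞)) Filter.atTop (nhds (min (f x) ∞)) :=
        tendsto_const_nhds.min ENNReal.tendsto_nat_nhds_top
      simpa using this
  have hmono : ∀ f : ℝ → ℝ≥0∞, ∀ x, ∀ N : ℕ, min (f x) N ≤ f x := fun f x N => min_le_left _ _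
  have hb' : ∀ f : ℝ → ℝ≥0∞, ∀ N : ℕ, ⨆ x, min (f x) (N : ℝ≥0∞) ≠ ∞ := fun f N =>
    ne_top_of_le_ne_top (ENNReal.natCast_ne_top N) (iSup_le fun x => min_le_right _ _)
  have key : ∀ N M : ℕ, (∫⁻ x, min (u x) N) ^ a * (∫⁻ x, min (v x) M) ^ b ≤ ∫⁻ x, w x := by
    intro N M
    refine prekopaLeindler_real_bounded ha hb hab (hu.min measurable_const)
      (hv.min measurable_const) hw (hb' u N) (hb' v M) fun x y => le_trans ?_ (h x y)
    gcongr <;> exact min_le_left _ _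
  have hsup : ∀ f : ℝ → ℝ≥0∞, Measurable f → ∀ s : ℝ, 0 < s →
      (∫⁻ x, f x) ^ s = ⨆ N : ℕ, (∫⁻ x, min (f x) N) ^ s := by
    intro f hf s hs0
    refine tendsto_nhds_unique ((ENNReal.continuous_rpow_const.tendsto _).comp (hs f hf))
      (tendsto_atTop_iSup fun m n hmn => ?_)
    refine ENNReal.rpow_le_rpow (lintegral_mono fun x => min_le_min_left _ ?_) hs0.le
    exact_mod_cast hmn
  rw [hsup u hu a ha, hsup v hv b hb]
  simp only [ENNReal.iSup_mul, ENNReal.mul_iSup]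
  exact iSup_le fun N => iSup_le fun M => key _ _

theorem PrekopaLeindler.prod {V W : Type*} [MeasureSpace V] [AddCommGroup V] [Module ℝ V]
    [MeasureSpace W] [AddCommGroup W] [Module ℝ W] [SFinite (volume : Measure V)]
    [SFinite (volume : Measure W)] (hV : PrekopaLeindler V) (hW : PrekopaLeindler W) :
    PrekopaLeindler (V × W) := by
  intro a b ha hb hab u v w hu hv hw h
  rw [Measure.volume_eq_prod, lintegral_prod _ hu.aemeasurable, lintegral_prod _ hv.aemeasurable,
    lintegral_prod _ hw.aemeasurable]
  refine hV a b ha hb hab _ _ _ hu.lintegral_prod_right' hv.lintegral_prod_right'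
    hw.lintegral_prod_right' fun x y => ?_
  refine hW a b ha hb hab _ _ _ (by fun_prop) (by fun_prop) (by fun_prop) fun x' y' => ?_
  exact h (x, x') (y, y')

theorem PrekopaLeindler.of_measurePreserving {V W : Type*} [MeasureSpace V] [AddCommGroup V]
    [Module ℝ V] [MeasureSpace W] [AddCommGroup W] [Module ℝ W] (hV : PrekopaLeindler V)
    (e : V ≃ᵐ W) (he : MeasurePreserving e) (hadd : ∀ x y, e (x + y) = e x + e y)
    (hsmul : ∀ (c : ℝ) x, e (c • x) = c • e x) : PrekopaLeindler W := by
  intro a b ha hb hab u v w hu hv hw h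
  rw [← he.lintegral_comp hu, ← he.lintegral_comp hv, ← he.lintegral_comp hw]
  refine hV a b ha hb hab _ _ _ (hu.comp e.measurable) (hv.comp e.measurable)
    (hw.comp e.measurable) fun x y => ?_
  simp only [hadd, hsmul]
  exact h _ _

theorem prekopaLeindler_pi (n : ℕ) : PrekopaLeindler (Fin n → ℝ) := by
  induction n with
  | zero =>
    intro a b ha hb hab u v w hu hv hw h
    have : (volume : Measure (Fin 0 → ℝ)) = Measure.dirac default := by
      rw [volume_pi, Measure.pi_of_empty _ default]
    simp only [this, lintegral_dirac]
    convert h default default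
  | succ n ih =>
    refine (prekopaLeindler_real.prod ih).of_measurePreserving
      (MeasurableEquiv.piFinSuccAbove (fun _ => ℝ) 0).symm
      (volume_preserving_piFinSuccAbove (fun _ => ℝ) 0).symm ?_ ?_
    · intro x y
      ext i
      refine Fin.cases ?_ (fun j => ?_) i <;> simp [MeasurableEquiv.piFinSuccAbove]
    · intro c x
      ext i
      refine Fin.cases ?_ (fun j => ?_) i <;> simp [MeasurableEquiv.piFinSuccAbove]

theorem prekopaLeindler_euc (n : ℕ) : PrekopaLeindler (Euc n) :=
  (prekopaLeindler_pi n).of_measurePreserving (MeasurableEquiv.toLp 2 (Fin n → ℝ))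
    (EuclideanSpace.volume_preserving_symm_measurableEquiv_toLp (Fin n)).symm
    (fun _ _ => rfl) (fun _ _ => rfl)

theorem IsLogConcave.lintegral_exp_mul_le {n : ℕ} {μ : Measure (Euc n)} (hμ : IsLogConcave μ)
    {a b : ℝ} (ha : 0 < a) (hb : 0 < b) (hab : a + b = 1) {φ ψ χ : Euc n → ℝ}
    (hφ : Measurable φ) (hψ : Measurable ψ) (hχ : Measurable χ)
    (h : ∀ x y, a * φ x + b * ψ y ≤ χ (a • x + b • y)) :
    (∫⁻ x, ENNReal.ofReal (exp (φ x)) ∂μ) ^ a * (∫⁻ x, ENNReal.ofReal (exp (ψ x)) ∂μ) ^ b ≤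
      ∫⁻ x, ENNReal.ofReal (exp (χ x)) ∂μ := by
  obtain ⟨d, hd, hd0, hdc, rfl⟩ := hμ
  have hd' : Measurable fun x => ENNReal.ofReal (d x) := hd.ennreal_ofReal
  rw [lintegral_withDensity_eq_lintegral_mul _ hd' hφ.exp.ennreal_ofReal,
    lintegral_withDensity_eq_lintegral_mul _ hd' hψ.exp.ennreal_ofReal,
    lintegral_withDensity_eq_lintegral_mul _ hd' hχ.exp.ennreal_ofReal]
  refine prekopaLeindler_euc n a b ha hb hab _ _ _ (hd'.mul hφ.exp.ennreal_ofReal)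
    (hd'.mul hψ.exp.ennreal_ofReal) (hd'.mul hχ.exp.ennreal_ofReal) fun x y => ?_
  simp only [Pi.mul_apply]
  rw [← ENNReal.ofReal_mul (hd0 _), ← ENNReal.ofReal_mul (hd0 _), ← ENNReal.ofReal_mul (hd0 _),
    ENNReal.ofReal_rpow_of_nonneg (mul_nonneg (hd0 _) (exp_pos _).le) ha.le,
    ENNReal.ofReal_rpow_of_nonneg (mul_nonneg (hd0 _) (exp_pos _).le) hb.le,
    ← ENNReal.ofReal_mul (rpow_nonneg (mul_nonneg (hd0 _) (exp_pos _).le) _)]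
  refine ENNReal.ofReal_le_ofReal ?_
  rw [mul_rpow (hd0 _) (exp_pos _).le, mul_rpow (hd0 _) (exp_pos _).le, ← exp_mul, ← exp_mul,
    mul_mul_mul_comm, ← exp_add]
  refine mul_le_mul (hdc x y a b ha.le hb.le hab) (exp_le_exp.2 ?_) (exp_pos _).le (hd0 _)
  linarith [h x y]

theorem IsLogConcave.integral_exp_mul_le {n : ℕ} {μ : Measure (Euc n)} (hμ : IsLogConcave μ)
    {φ ψ χ : Euc n → ℝ} (hφ : Measurable φ) (hψ : Measurable ψ) (hχ : Measurable χ)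
    (iφ : Integrable (fun x => exp (φ x)) μ) (iψ : Integrable (fun x => exp (ψ x)) μ)
    (iχ : Integrable (fun x => exp (χ x)) μ)
    (h : ∀ x y, (φ x + ψ y) / 2 ≤ χ ((1 / 2 : ℝ) • x + (1 / 2 : ℝ) • y)) :
    (∫ x, exp (φ x) ∂μ) * (∫ x, exp (ψ x) ∂μ) ≤ (∫ x, exp (χ x) ∂μ) ^ 2 := by
  have key := hμ.lintegral_exp_mul_le (a := 1 / 2) (b := 1 / 2) (by norm_num) (by norm_num)
    (by norm_num) hφ hψ hχ (fun x y => by linarith [h x y])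
  have e : ∀ f : Euc n → ℝ, Integrable (fun x => exp (f x)) μ →
      ∫⁻ x, ENNReal.ofReal (exp (f x)) ∂μ = ENNReal.ofReal (∫ x, exp (f x) ∂μ) := fun f hf =>
    (ofReal_integral_eq_lintegral_ofReal hf (Filter.Eventually.of_forall fun x => (exp_pos _).le)).symm
  have p : ∀ f : Euc n → ℝ, 0 ≤ ∫ x, exp (f x) ∂μ := fun f => integral_nonneg fun x => (exp_pos _).le
  rw [e _ iφ, e _ iψ, e _ iχ, ENNReal.ofReal_rpow_of_nonneg (p _) (by norm_num),
    ENNReal.ofReal_rpow_of_nonneg (p _) (by norm_num), ← ENNReal.ofReal_mul (rpow_nonneg (p _) _),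
    ENNReal.ofReal_le_ofReal_iff (p _), ← mul_rpow (p _) (p _), ← sqrt_eq_rpow] at key
  exact (sqrt_le_left (p _)).1 key

theorem smul_withDensity_eq_tilted {Ω : Type*} [MeasurableSpace Ω] {μ : Measure Ω} [NeZero μ]
    {f : Ω → ℝ} (hf : Measurable f) (hi : Integrable (fun x => exp (f x)) μ) :
    (ENNReal.ofReal (∫ x, exp (f x) ∂μ))⁻¹ • μ.withDensity (fun x => ENNReal.ofReal (exp (f x))) =
      μ.tilted f := by
  have hZ : 0 < ∫ x, exp (f x) ∂μ := integral_exp_pos hi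
  rw [Measure.tilted, ← withDensity_smul _ hf.exp.ennreal_ofReal]
  congr 1
  ext x
  simp only [Pi.smul_apply, smul_eq_mul]
  rw [ENNReal.ofReal_div_of_pos hZ, div_eq_mul_inv, mul_comm]

theorem tilt_eq_tilted {n : ℕ} {μ : Measure (Euc n)} [NeZero μ] (hμ : TiltsWellDefined μ)
    (h : Euc n) : tilt μ h = μ.tilted (fun x => ⟪h, x⟫) :=
  smul_withDensity_eq_tilted (by fun_prop) (hμ h)

theorem neg_mul_norm_sq_add_inner_le {n : ℕ} {t : ℝ} (ht : 0 < t) (h x : Euc n) :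
    -t * ‖x‖ ^ 2 + ⟪h, x⟫ ≤ ‖h‖ ^ 2 / (4 * t) := by
  have h1 := real_inner_le_norm h x
  rw [le_div_iff₀ (by positivity)]
  nlinarith [sq_nonneg (‖h‖ - 2 * t * ‖x‖)]

theorem integrable_exp_neg_mul_norm_sq_add_inner {n : ℕ} {μ : Measure (Euc n)} [IsFiniteMeasure μ]
    {t : ℝ} (ht : 0 < t) (h : Euc n) :
    Integrable (fun x => exp (-t * ‖x‖ ^ 2 + ⟪h, x⟫)) μ := by
  refine Integrable.of_bound (C := exp (‖h‖ ^ 2 / (4 * t))) (by fun_prop)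
    (Filter.Eventually.of_forall fun x => ?_)
  rw [norm_of_nonneg (exp_pos _).le]
  exact exp_le_exp.2 (neg_mul_norm_sq_add_inner_le ht h x)

theorem gtilt_eq_tilted {n : ℕ} {μ : Measure (Euc n)} [NeZero μ] [IsFiniteMeasure μ] {t : ℝ}
    (ht : 0 < t) (h : Euc n) : gtilt μ t h = μ.tilted (fun x => -t * ‖x‖ ^ 2 + ⟪h, x⟫) :=
  smul_withDensity_eq_tilted (by fun_prop) (integrable_exp_neg_mul_norm_sq_add_inner ht h)

theorem integral_sub_bary_sq {n : ℕ} {ν : Measure (Euc n)} [IsFiniteMeasure ν]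
    (hν : Integrable (fun x => x) ν) (θ : Euc n) :
    ∫ x, ⟪x - bary ν, θ⟫ ^ 2 ∂ν = Var[fun x => ⟪x, θ⟫; ν] := by
  rw [variance_eq_integral (by fun_prop)]
  have : ∫ x, ⟪x, θ⟫ ∂ν = ⟪bary ν, θ⟫ := by
    rw [bary]
    simp_rw [real_inner_comm θ]
    exact integral_inner hν θ
  rw [this]
  simp [inner_sub_left]

theorem two_add_sq_le_exp_add_exp_neg (u : ℝ) : 2 + u ^ 2 ≤ exp u + exp (-u) := by
  have h1 : exp u + exp (-u) = 2 + 4 * sinh (u / 2) ^ 2 := by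
    rw [sinh_eq, div_pow, sub_sq, ← exp_nat_mul, ← exp_nat_mul, mul_assoc, ← exp_add]
    have e1 : ((2 : ℕ) : ℝ) * (u / 2) = u := by push_cast; ring
    have e2 : ((2 : ℕ) : ℝ) * -(u / 2) = -u := by push_cast; ring
    rw [e1, e2]
    simp
    ring
  have h2 : (u / 2) ^ 2 ≤ sinh (u / 2) ^ 2 := by
    rw [sq_le_sq, abs_sinh]
    exact self_le_sinh_iff.2 (abs_nonneg _)
  nlinarith

theorem memLp_two_of_integrable_exp {Ω : Type*} [MeasurableSpace Ω] {ν : Measure Ω} {Z : Ω → ℝ}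
    (hZ : Measurable Z) {s : ℝ} (hs : s ≠ 0) (h1 : Integrable (fun x => exp (s * Z x)) ν)
    (h2 : Integrable (fun x => exp (-s * Z x)) ν) : MemLp Z 2 ν := by
  rw [memLp_two_iff_integrable_sq hZ.aestronglyMeasurable]
  refine ((h1.add h2).const_mul (s ^ 2)⁻¹).mono' (by fun_prop) (Filter.Eventually.of_forall fun x => ?_)
  rw [norm_of_nonneg (sq_nonneg _), ← div_eq_inv_mul, le_div_iff₀ (by positivity)]
  have := two_add_sq_le_exp_add_exp_neg (s * Z x)
  simp only [Pi.add_apply, neg_mul]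
  nlinarith

theorem sq_mul_variance_le {Ω : Type*} [MeasurableSpace Ω] {ν : Measure Ω} [IsProbabilityMeasure ν]
    {Z : Ω → ℝ} (hZ : Measurable Z) {s c : ℝ} (hs : s ≠ 0)
    (h1 : Integrable (fun x => exp (s * Z x)) ν) (h2 : Integrable (fun x => exp (-s * Z x)) ν)
    (hc : (∫ x, exp (s * Z x) ∂ν) * (∫ x, exp (-s * Z x) ∂ν) ≤ c) :
    s ^ 2 * Var[Z; ν] ≤ c - 1 := by
  have hL := memLp_two_of_integrable_exp hZ hs h1 h2
  have hi : Integrable Z ν := hL.integrable (by norm_num)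
  set m := ∫ x, Z x ∂ν with hm
  set A := ∫ x, exp (s * (Z x - m)) ∂ν with hA
  set B := ∫ x, exp (-s * (Z x - m)) ∂ν with hB
  have split : ∀ r x, exp (r * (Z x - m)) = exp (r * Z x) * exp (-(r * m)) := fun r x => by
    rw [← exp_add]; ring_nf
  have iA : Integrable (fun x => exp (s * (Z x - m))) ν := by
    simp_rw [split]; exact h1.mul_const _
  have iB : Integrable (fun x => exp (-s * (Z x - m))) ν := by
    simp_rw [split]; exact h2.mul_const _
  have ic : Integrable (fun x => Z x - m) ν := hi.sub (integrable_const _)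
  have zc : ∫ x, (Z x - m) ∂ν = 0 := by
    rw [integral_sub hi (integrable_const _)]; simp [hm]
  have ge1 : ∀ r, Integrable (fun x => exp (r * (Z x - m))) ν →
      1 ≤ ∫ x, exp (r * (Z x - m)) ∂ν := by
    intro r hr
    have := integral_mono ((ic.const_mul r).add (integrable_const 1)) hr
      (fun x => add_one_le_exp (r * (Z x - m)))
    simp only [Pi.add_apply] at this
    rw [integral_add (ic.const_mul r) (integrable_const 1), integral_const_mul, zc] at this
    simpa using this
  have isq : Integrable (fun x => (Z x - m) ^ 2) ν :=
    (memLp_two_iff_integrable_sq (by fun_prop)).1 (hL.sub (memLp_const m))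
  have hsum : 2 + s ^ 2 * Var[Z; ν] ≤ A + B := by
    rw [variance_eq_integral hZ.aemeasurable, ← integral_const_mul, hA, hB, ← integral_add iA iB]
    have : (2 : ℝ) = ∫ _, (2 : ℝ) ∂ν := by simp
    rw [this, ← integral_add (integrable_const _) (isq.const_mul _)]
    refine integral_mono ((integrable_const _).add (isq.const_mul _)) (iA.add iB) fun x => ?_
    have := two_add_sq_le_exp_add_exp_neg (s * (Z x - m))
    simp only [neg_mul]
    rw [← mul_pow]
    exact this
  have hprod : A * B = (∫ x, exp (s * Z x) ∂ν) * (∫ x, exp (-s * Z x) ∂ν) := by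
    rw [hA, hB]
    simp_rw [split]
    rw [integral_mul_const, integral_mul_const, mul_mul_mul_comm, ← exp_add]
    simp
  nlinarith [ge1 s iA, ge1 (-s) iB]

theorem IsLogConcave.variance_gtilt_le {n : ℕ} {μ : Measure (Euc n)} [IsProbabilityMeasure μ]
    (hμ : IsLogConcave μ) {t : ℝ} (ht : 0 < t) (h θ : Euc n) (hθ : ‖θ‖ = 1) :
    Var[fun x => ⟪x, θ⟫; gtilt μ t h] ≤ 1 / t := by
  rw [gtilt_eq_tilted ht h]
  set φ : Euc n → ℝ := fun x => -t * ‖x‖ ^ 2 + ⟪h, x⟫ with hφ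
  have iφ := integrable_exp_neg_mul_norm_sq_add_inner (μ := μ) ht h
  set ν := μ.tilted φ with hν
  have : IsProbabilityMeasure ν := isProbabilityMeasure_tilted iφ
  have isum : ∀ s : ℝ, Integrable (fun x => exp (φ x + s * ⟪x, θ⟫)) μ := by
    intro s
    convert integrable_exp_neg_mul_norm_sq_add_inner (μ := μ) ht (h + s • θ) using 3 with x
    rw [hφ, inner_add_left, real_inner_smul_left, real_inner_comm x θ]
    ring
  have iexp : ∀ s : ℝ, Integrable (fun x => exp (s * ⟪x, θ⟫)) ν := by
    intro s
    rw [hν, integrable_tilted_iff iφ]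
    refine (isum s).congr (Filter.Eventually.of_forall fun x => ?_)
    simp only [smul_eq_mul]
    rw [exp_add]
  set s := √(2 * t) with hs
  have hs2 : s ^ 2 = 2 * t := sq_sqrt (by positivity)
  have hs0 : 0 < s := by positivity
  have prod_le : (∫ x, exp (s * ⟪x, θ⟫) ∂ν) * (∫ x, exp (-s * ⟪x, θ⟫) ∂ν) ≤ exp 1 := by
    rw [hν, integral_exp_tilted, integral_exp_tilted]
    have hZ : 0 < ∫ x, exp (φ x) ∂μ := integral_exp_pos iφ
    rw [div_mul_div_comm, div_le_iff₀ (by positivity)]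
    have i3 : Integrable (fun x => exp (1 / 2 + φ x)) μ := by
      simp_rw [exp_add]
      exact iφ.const_mul _
    have := hμ.integral_exp_mul_le (φ := fun x => φ x + s * ⟪x, θ⟫)
      (ψ := fun x => φ x + -s * ⟪x, θ⟫) (χ := fun x => 1 / 2 + φ x) (by fun_prop) (by fun_prop)
      (by fun_prop) (isum s) (isum (-s)) i3 ?_
    · simp_rw [exp_add (1 / 2 : ℝ)] at this
      rw [integral_const_mul, mul_pow, ← exp_nat_mul] at this
      norm_num at this
      simpa [sq] using this
    · intro x y
      simp only [hφ]
      have e1 : ‖(1 / 2 : ℝ) • x + (1 / 2 : ℝ) • y‖ ^ 2 =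
          (‖x‖ ^ 2 + ‖y‖ ^ 2) / 2 - ‖x - y‖ ^ 2 / 4 := by
        rw [← smul_add, norm_smul, mul_pow, norm_add_sq_real, norm_sub_sq_real]
        norm_num
        ring
      have e2 : ⟪h, (1 / 2 : ℝ) • x + (1 / 2 : ℝ) • y⟫ = (⟪h, x⟫ + ⟪h, y⟫) / 2 := by
        rw [inner_add_right, inner_smul_right, inner_smul_right]; ring
      rw [e1, e2]
      have e3 : ⟪x, θ⟫ - ⟪y, θ⟫ ≤ ‖x - y‖ := by
        rw [← inner_sub_left]
        simpa [hθ] using real_inner_le_norm (x - y) θ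
      have e4 : s * (⟪x, θ⟫ - ⟪y, θ⟫) ≤ s * ‖x - y‖ := by gcongr
      nlinarith [sq_nonneg (1 - s / 2 * ‖x - y‖)]
  have := sq_mul_variance_le (by fun_prop) hs0.ne' (iexp s) (iexp (-s)) prod_le
  rw [hs2] at this
  rw [le_div_iff₀ ht]
  have := Real.exp_one_lt_d9
  linarith

/-- Log-concave probability measures all of whose tilts have covariance at most the identity. -/
structure IsTiltStableLogConcave {n : ℕ} (μ : Measure (Euc n)) : Prop where
  prob : IsProbabilityMeasure μ
  logConcave : IsLogConcave μ
  tilts : TiltsWellDefined μ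
  stable : TiltStable μ 1

theorem exp_mul_norm_le {n : ℕ} (r : ℝ) (x : Euc n) :
    exp (r * ‖x‖) ≤ 1 + ∑ i, (exp (|r| * n * x i) + exp (-(|r| * n) * x i)) := by
  have hs : ∀ i, 0 ≤ exp (|r| * n * x i) + exp (-(|r| * n) * x i) := fun i => by positivity
  rcases Nat.eq_zero_or_pos n with rfl | hn
  · have : x = 0 := Subsingleton.elim _ _
    simp [this]
  have : Nonempty (Fin n) := ⟨⟨0, hn⟩⟩
  obtain ⟨i, hi⟩ := Finite.exists_max fun i => |x i|
  have hnorm : ‖x‖ ≤ n * |x i| := by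
    refine abs_le_of_sq_le_sq' ?_ (by positivity) |>.2
    rw [EuclideanSpace.real_norm_sq_eq]
    calc ∑ j, x j ^ 2 ≤ ∑ _j : Fin n, |x i| ^ 2 :=
          Finset.sum_le_sum fun j _ => by
            rw [← sq_abs (x j)]; exact pow_le_pow_left₀ (abs_nonneg _) (hi j) 2
      _ = n * |x i| ^ 2 := by simp
      _ ≤ (n * |x i|) ^ 2 := by
          rw [mul_pow]
          gcongr
          have : (1 : ℝ) ≤ n := by exact_mod_cast hn
          nlinarith
  have h1 : exp (r * ‖x‖) ≤ exp (|r| * n * x i) + exp (-(|r| * n) * x i) := by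
    have h2 : r * ‖x‖ ≤ |r| * n * |x i| := by
      rw [mul_assoc]
      exact mul_le_mul (le_abs_self r) hnorm (norm_nonneg _) (abs_nonneg _)
    rcases abs_cases (x i) with ⟨h3, -⟩ | ⟨h3, -⟩ <;> rw [h3] at h2
    · have := exp_le_exp.2 h2
      have := exp_pos (-(|r| * n) * x i)
      linarith
    · have := exp_le_exp.2 h2
      have := exp_pos (|r| * n * x i)
      have e : -(|r| * n) * x i = |r| * n * -x i := by ring
      rw [e]
      linarith
  have := Finset.single_le_sum (fun j _ => hs j) (Finset.mem_univ i)
  linarith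

namespace TiltsWellDefined

variable {n : ℕ} {μ : Measure (Euc n)}

theorem integrable_exp_norm (hμ : TiltsWellDefined μ) (r : ℝ) (h : Euc n) :
    Integrable (fun x => exp (r * ‖x‖) * exp ⟪h, x⟫) μ := by
  have hi : ∀ (c : ℝ) (i : Fin n), Integrable (fun x : Euc n => exp (c * x i) * exp ⟪h, x⟫) μ := by
    intro c i
    refine (hμ (h + c • EuclideanSpace.single i (1 : ℝ))).congr
      (Filter.Eventually.of_forall fun x => ?_)
    simp only
    rw [← exp_add, inner_add_left, real_inner_smul_left, EuclideanSpace.inner_single_left]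
    simp [add_comm]
  have : Integrable (fun x : Euc n => (1 + ∑ i, (exp (|r| * n * x i) + exp (-(|r| * n) * x i))) *
      exp ⟪h, x⟫) μ := by
    simp_rw [add_mul, Finset.sum_mul, one_mul, add_mul]
    exact (hμ h).add (integrable_finsetSum _ fun i _ => (hi _ i).add (hi _ i))
  refine this.mono' (by fun_prop) (Filter.Eventually.of_forall fun x => ?_)
  rw [norm_of_nonneg (by positivity)]
  gcongr
  exact exp_mul_norm_le r x

theorem integrable_of_le (hμ : TiltsWellDefined μ) {E : Type*} [NormedAddCommGroup E]
    {f : Euc n → E} (hf : AEStronglyMeasurable f μ) (C r : ℝ) (h : Euc n)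
    (hle : ∀ x, ‖f x‖ ≤ C * (exp (r * ‖x‖) * exp ⟪h, x⟫)) : Integrable f μ :=
  ((hμ.integrable_exp_norm r h).const_mul C).mono' hf (Filter.Eventually.of_forall hle)

theorem integrable_norm_pow (hμ : TiltsWellDefined μ) (k : ℕ) :
    Integrable (fun x => ‖x‖ ^ k) μ := by
  refine hμ.integrable_of_le (by fun_prop) (k.factorial) 1 0 fun x => ?_
  rw [norm_of_nonneg (by positivity)]
  have := pow_div_factorial_le_exp ‖x‖ (norm_nonneg _) k
  rw [div_le_iff₀ (by positivity)] at this
  simpa [mul_comm] using this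

theorem integrable_id (hμ : TiltsWellDefined μ) : Integrable (fun x => x) μ := by
  have := hμ.integrable_norm_pow 1
  simp only [pow_one] at this
  exact (integrable_norm_iff (by fun_prop)).1 this

theorem isProbabilityMeasure_tilt [NeZero μ] (hμ : TiltsWellDefined μ) (h : Euc n) :
    IsProbabilityMeasure (tilt μ h) := by
  rw [tilt_eq_tilted hμ]
  exact isProbabilityMeasure_tilted (hμ h)

theorem tilt [NeZero μ] (hμ : TiltsWellDefined μ) (g : Euc n) : TiltsWellDefined (tilt μ g) := by
  intro h
  rw [tilt_eq_tilted hμ, integrable_tilted_iff (hμ g)]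
  refine (hμ (g + h)).congr (Filter.Eventually.of_forall fun x => ?_)
  simp [inner_add_left, exp_add]

theorem tilt_tilt [NeZero μ] (hμ : TiltsWellDefined μ) (g h : Euc n) :
    _root_.tilt (_root_.tilt μ g) h = _root_.tilt μ (g + h) := by
  have := hμ.isProbabilityMeasure_tilt g
  rw [tilt_eq_tilted (hμ.tilt g), tilt_eq_tilted hμ, tilt_eq_tilted hμ, tilted_tilted (hμ g)]
  congr 1
  ext x
  simp [inner_add_left]

theorem tilt_zero [IsProbabilityMeasure μ] (hμ : TiltsWellDefined μ) : _root_.tilt μ 0 = μ := by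
  rw [tilt_eq_tilted hμ]
  simp only [inner_zero_left]
  exact tilted_zero μ

theorem tiltStable_iff [NeZero μ] (hμ : TiltsWellDefined μ) (β : ℝ) :
    TiltStable μ β ↔ ∀ h θ : Euc n, ‖θ‖ = 1 → Var[fun x => ⟪x, θ⟫; _root_.tilt μ h] ≤ β ^ 2 := by
  refine forall_congr' fun h => forall_congr' fun θ => imp_congr_right fun _ => ?_
  have := hμ.isProbabilityMeasure_tilt h
  rw [integral_sub_bary_sq (hμ.tilt h).integrable_id]

end TiltsWellDefined

theorem tilted_add_const {Ω : Type*} [MeasurableSpace Ω] (μ : Measure Ω) (f : Ω → ℝ) (c : ℝ) :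
    μ.tilted (fun x => f x + c) = μ.tilted f := by
  simp only [Measure.tilted, exp_add]
  congr 1
  ext x
  rw [integral_mul_const, mul_div_mul_right _ _ (exp_pos c).ne']

theorem map_tilted {Ω Ω' : Type*} [MeasurableSpace Ω] [MeasurableSpace Ω'] (μ : Measure Ω)
    (e : Ω ≃ᵐ Ω') {f : Ω' → ℝ} :
    (μ.map e).tilted f = (μ.tilted (fun x => f (e x))).map e := by
  ext s hs
  rw [tilted_apply' _ _ hs, Measure.map_apply e.measurable hs,
    tilted_apply' _ _ (e.measurable hs), e.restrict_map, lintegral_map_equiv,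
    integral_map_equiv]

theorem IsLogConcave.tilt {n : ℕ} {μ : Measure (Euc n)} [NeZero μ] (hμ : IsLogConcave μ)
    (ht : TiltsWellDefined μ) (h : Euc n) : IsLogConcave (tilt μ h) := by
  obtain ⟨d, hd, hd0, hdc, hdμ⟩ := hμ
  have hZ : 0 < ∫ x, exp ⟪h, x⟫ ∂μ := integral_exp_pos (ht h)
  set c := (∫ x, exp ⟪h, x⟫ ∂μ)⁻¹ with hc
  have hc0 : 0 ≤ c := by positivity
  have he : ∀ x, 0 ≤ exp (⟪h, x⟫) := fun x => (exp_pos _).le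
  refine ⟨fun x => c * (d x * exp ⟪h, x⟫), by fun_prop,
    fun x => mul_nonneg hc0 (mul_nonneg (hd0 x) (he x)), fun x y a b ha hb hab => ?_, ?_⟩
  · rw [mul_rpow hc0 (mul_nonneg (hd0 _) (he _)), mul_rpow hc0 (mul_nonneg (hd0 _) (he _)),
      mul_rpow (hd0 _) (he _), mul_rpow (hd0 _) (he _), mul_mul_mul_comm,
      ← rpow_add_of_nonneg hc0 ha hb, hab, rpow_one, mul_mul_mul_comm (d x ^ a), ← exp_mul,
      ← exp_mul, ← exp_add]
    refine mul_le_mul_of_nonneg_left (mul_le_mul (hdc x y a b ha hb hab) (exp_le_exp.2 ?_)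
      (exp_pos _).le (hd0 _)) hc0
    · rw [inner_add_right, inner_smul_right, inner_smul_right]
      linarith
  · rw [_root_.tilt]
    conv_lhs => rw [hdμ]
    rw [← withDensity_mul _ hd.ennreal_ofReal (by fun_prop), ← hdμ,
      ← withDensity_smul _ (by fun_prop)]
    congr 1
    ext x
    simp only [Pi.smul_apply, Pi.mul_apply, smul_eq_mul]
    rw [← ENNReal.ofReal_mul (hd0 _), ENNReal.ofReal_mul hc0, hc, ENNReal.ofReal_inv_of_pos hZ]

theorem IsTiltStableLogConcave.tilt {n : ℕ} {μ : Measure (Euc n)} (hμ : IsTiltStableLogConcave μ)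
    (g : Euc n) : IsTiltStableLogConcave (tilt μ g) := by
  have := hμ.prob
  have := hμ.tilts.isProbabilityMeasure_tilt g
  refine ⟨this, hμ.logConcave.tilt hμ.tilts g, hμ.tilts.tilt g, ?_⟩
  rw [(hμ.tilts.tilt g).tiltStable_iff]
  intro h θ hθ
  rw [hμ.tilts.tilt_tilt]
  exact (hμ.tilts.tiltStable_iff 1).1 hμ.stable _ _ hθ

theorem IsLogConcave.map_sub {n : ℕ} {μ : Measure (Euc n)} (hμ : IsLogConcave μ)
    (a : Euc n) : IsLogConcave (μ.map (fun x => x - a)) := by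
  obtain ⟨d, hd, hd0, hdc, rfl⟩ := hμ
  refine ⟨fun x => d (x + a), by fun_prop, fun x => hd0 _, fun x y s t hs ht hst => ?_, ?_⟩
  · have := hdc (x + a) (y + a) s t hs ht hst
    have e : s • (x + a) + t • (y + a) = s • x + t • y + a := by
      rw [smul_add, smul_add, add_add_add_comm, ← add_smul, hst, one_smul]
    rwa [e] at this
  · ext s hs
    have hm : MeasurePreserving (fun x : Euc n => x - a) := measurePreserving_sub_right volume a
    rw [Measure.map_apply (by fun_prop) hs, withDensity_apply _ hs,
      withDensity_apply _ (hm.measurable hs),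
      ← hm.setLIntegral_comp_preimage hs (by fun_prop)]
    simp

theorem IsTiltStableLogConcave.map_sub {n : ℕ} {μ : Measure (Euc n)}
    (hμ : IsTiltStableLogConcave μ) (a : Euc n) :
    IsTiltStableLogConcave (μ.map (fun x => x - a)) := by
  have := hμ.prob
  have hp : IsProbabilityMeasure (μ.map (fun x => x - a)) :=
    Measure.isProbabilityMeasure_map (by fun_prop)
  have ht : TiltsWellDefined (μ.map (fun x => x - a)) := by
    intro h
    rw [integrable_map_measure (by fun_prop) (by fun_prop)]
    refine ((hμ.tilts h).mul_const (exp (-⟪h, a⟫))).congr (Filter.Eventually.of_forall fun x => ?_)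
    simp only [Function.comp]
    rw [inner_sub_right, sub_eq_add_neg, exp_add]
  refine ⟨hp, hμ.logConcave.map_sub a, ht, ?_⟩
  rw [ht.tiltStable_iff]
  intro h θ hθ
  rw [tilt_eq_tilted ht]
  have e : (μ.map (fun x => x - a)).tilted (fun x => ⟪h, x⟫) =
      (μ.tilted fun x => ⟪h, x - a⟫).map (fun x => x - a) :=
    map_tilted μ (MeasurableEquiv.subRight a)
  rw [e]
  simp_rw [inner_sub_right, sub_eq_add_neg]
  rw [tilted_add_const, ← tilt_eq_tilted hμ.tilts]
  have := hμ.tilts.isProbabilityMeasure_tilt h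
  rw [variance_map (by fun_prop) (by fun_prop)]
  have := (hμ.tilts.tiltStable_iff 1).1 hμ.stable h θ hθ
  convert this using 1
  have : (fun x => ⟪x, θ⟫) ∘ (fun x => x + -a) = fun x : Euc n => ⟪x, θ⟫ - ⟪a, θ⟫ := by
    ext x; simp [inner_add_left, sub_eq_add_neg]
  rw [this, variance_sub_const (by fun_prop)]

theorem lintegral_exp_sq_div_four_gaussianReal :
    ∫⁻ g, ENNReal.ofReal (exp (g ^ 2 / 4)) ∂(gaussianReal 0 1) = ENNReal.ofReal (√2) := by
  rw [gaussianReal_of_var_ne_zero _ one_ne_zero,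
    lintegral_withDensity_eq_lintegral_mul _ (measurable_gaussianPDF _ _) (by fun_prop)]
  simp only [Pi.mul_apply, gaussianPDF]
  simp_rw [← ENNReal.ofReal_mul (gaussianPDFReal_nonneg _ _ _)]
  have e : ∀ g : ℝ, gaussianPDFReal 0 1 g * exp (g ^ 2 / 4) =
      (√(2 * π))⁻¹ * exp (-(1 / 4) * g ^ 2) := by
    intro g
    rw [gaussianPDFReal, mul_assoc, ← exp_add]
    simp only [NNReal.coe_one, mul_one, sub_zero]
    ring_nf
  simp_rw [e]
  rw [← ofReal_integral_eq_lintegral_ofReal, integral_const_mul, integral_gaussian]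
  · congr 1
    rw [show π / (1 / 4) = 2 * (2 * π) by ring, sqrt_mul (by norm_num) (2 * π)]
    have : √(2 * π) ≠ 0 := by positivity
    field_simp
  · exact (integrable_exp_neg_mul_sq (by norm_num)).const_mul _
  · exact Filter.Eventually.of_forall fun x => by positivity

theorem lintegral_exp_sq_div_four_le {Ω : Type*} [MeasurableSpace Ω] {ν : Measure Ω}
    [SFinite ν] {Y : Ω → ℝ} (hY : Measurable Y)
    (hi : ∀ s : ℝ, ∫⁻ x, ENNReal.ofReal (exp (s * Y x)) ∂ν ≤ ENNReal.ofReal (exp (s ^ 2 / 2))) :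
    ∫⁻ x, ENNReal.ofReal (exp (Y x ^ 2 / 4)) ∂ν ≤ ENNReal.ofReal (√2) := by
  have e : ∀ y : ℝ, ENNReal.ofReal (exp (y ^ 2 / 4)) =
      ∫⁻ g, ENNReal.ofReal (exp (y / √2 * g)) ∂(gaussianReal 0 1) := by
    intro y
    have h1 := mgf_id_gaussianReal (μ := 0) (v := 1)
    have h2 := congrFun h1 (y / √2)
    simp only [mgf, id] at h2
    rw [← ofReal_integral_eq_lintegral_ofReal, h2]
    · congr 2
      rw [div_pow, sq_sqrt (by norm_num)]
      simp
      ring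
    · exact integrable_exp_mul_gaussianReal _
    · exact Filter.Eventually.of_forall fun x => (exp_pos _).le
  simp_rw [e]
  rw [lintegral_lintegral_swap (by fun_prop), ← lintegral_exp_sq_div_four_gaussianReal]
  refine lintegral_mono fun g => ?_
  have := hi (g / √2)
  rw [div_pow, sq_sqrt (by norm_num), div_div] at this
  norm_num at this
  refine le_trans (le_of_eq ?_) this
  refine lintegral_congr fun x => ?_
  congr 2
  ring

namespace IsTiltStableLogConcave

variable {n : ℕ} {μ : Measure (Euc n)}

theorem variance_inner_le (hμ : IsTiltStableLogConcave μ) (h u : Euc n) :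
    Var[fun x => ⟪x, u⟫; _root_.tilt μ h] ≤ ‖u‖ ^ 2 := by
  have := hμ.prob
  by_cases hu : u = 0
  · simp only [hu, inner_zero_right]
    rw [variance_eq_integral (by fun_prop)]
    simp
  have hu' : 0 < ‖u‖ := norm_pos_iff.2 hu
  have h1 := (hμ.tilts.tiltStable_iff 1).1 hμ.stable h (‖u‖⁻¹ • u) (by
    rw [norm_smul, norm_inv, norm_norm, inv_mul_cancel₀ hu'.ne'])
  simp_rw [real_inner_smul_right] at h1
  rw [variance_const_mul, inv_pow, one_pow, inv_mul_le_iff₀ (by positivity), mul_one] at h1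
  exact h1

theorem integrable_inner_exp (hμ : IsTiltStableLogConcave μ) (u c : Euc n) :
    Integrable (fun x => exp ⟪u, x - c⟫) μ := by
  refine ((hμ.tilts u).mul_const (exp (-⟪u, c⟫))).congr (Filter.Eventually.of_forall fun x => ?_)
  simp only
  rw [inner_sub_right, sub_eq_add_neg, exp_add]

theorem integral_exp_inner_sub_bary_le (hμ : IsTiltStableLogConcave μ) (u : Euc n) :
    ∫ x, exp ⟪u, x - bary μ⟫ ∂μ ≤ exp (‖u‖ ^ 2 / 2) := by
  have := hμ.prob
  set X : Euc n → ℝ := fun x => ⟪u, x - bary μ⟫ with hX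
  have hset : integrableExpSet X μ = Set.univ := by
    ext s
    simp only [integrableExpSet, Set.mem_ofPred_eq, Set.mem_univ, iff_true]
    refine (hμ.integrable_inner_exp (s • u) (bary μ)).congr (Filter.Eventually.of_forall fun x => ?_)
    simp [hX, real_inner_smul_left]
  have hX0 : ∫ x, X x ∂μ = 0 := by
    simp only [hX, inner_sub_right]
    rw [integral_sub ((hμ.tilts.integrable_id).const_inner u) (integrable_const _),
      integral_inner hμ.tilts.integrable_id]
    simp [bary]
  obtain ⟨v, -, hv⟩ := exists_cgf_eq_iteratedDeriv_two_cgf_mul (X := X) (μ := μ) one_pos hX0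
    (by simp [hset])
  rw [← variance_tilted_mul (by simp [hset])] at hv
  have hv' : cgf X μ 1 ≤ ‖u‖ ^ 2 / 2 := by
    rw [hv, one_pow, mul_one]
    have h1 := hμ.variance_inner_le (v • u) u
    rw [tilt_eq_tilted hμ.tilts] at h1
    have h2 : μ.tilted (fun x => v * X x) = μ.tilted (fun x => ⟪v • u, x⟫) := by
      rw [← tilted_add_const μ (fun x => ⟪v • u, x⟫) (-(v * ⟪u, bary μ⟫))]
      congr 1
      ext x
      simp only [hX, inner_sub_right, real_inner_smul_left]
      ring
    rw [h2]
    have h3 : X = fun x => ⟪x, u⟫ - ⟪u, bary μ⟫ := by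
      ext x; simp [hX, inner_sub_right, real_inner_comm u x]
    have := hμ.tilts.isProbabilityMeasure_tilt (v • u)
    rw [tilt_eq_tilted hμ.tilts] at this
    rw [h3, variance_sub_const (by fun_prop)]
    linarith
  rw [cgf] at hv'
  have hpos : 0 < mgf X μ 1 := mgf_pos (by
    have := Set.mem_univ (1 : ℝ)
    rw [← hset] at this
    exact this)
  rw [log_le_iff_le_exp hpos] at hv'
  simpa [mgf] using hv'

theorem lintegral_exp_inner_sub_bary_le (hμ : IsTiltStableLogConcave μ) (u : Euc n) :
    ∫⁻ x, ENNReal.ofReal (exp ⟪u, x - bary μ⟫) ∂μ ≤ ENNReal.ofReal (exp (‖u‖ ^ 2 / 2)) := by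
  rw [← ofReal_integral_eq_lintegral_ofReal (hμ.integrable_inner_exp u _)
    (Filter.Eventually.of_forall fun x => (exp_pos _).le)]
  exact ENNReal.ofReal_le_ofReal (hμ.integral_exp_inner_sub_bary_le u)

theorem lintegral_exp_inner_sq_le (hμ : IsTiltStableLogConcave μ) {θ : Euc n} (hθ : ‖θ‖ = 1) :
    ∫⁻ x, ENNReal.ofReal (exp (⟪x - bary μ, θ⟫ ^ 2 / 4)) ∂μ ≤ ENNReal.ofReal (√2) := by
  have := hμ.prob
  refine lintegral_exp_sq_div_four_le (Y := fun x => ⟪x - bary μ, θ⟫) (by fun_prop) fun s => ?_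
  have := hμ.lintegral_exp_inner_sub_bary_le (s • θ)
  simp only [real_inner_smul_left, norm_smul, hθ, norm_eq_abs, sq_abs,
    mul_one] at this
  simpa only [real_inner_comm] using this

theorem lintegral_exp_norm_sq_le (hμ : IsTiltStableLogConcave μ) (hn : 0 < n) :
    ∫⁻ x, ENNReal.ofReal (exp (‖x - bary μ‖ ^ 2 / (4 * n))) ∂μ ≤ ENNReal.ofReal (√2) := by
  have hn' : (0 : ℝ) < n := by exact_mod_cast hn
  have hle : ∀ y : Euc n, exp (‖y‖ ^ 2 / (4 * n)) ≤ ∑ i, (n : ℝ)⁻¹ * exp ((y i) ^ 2 / 4) := by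
    intro y
    have := convexOn_exp.map_sum_le (t := Finset.univ) (w := fun _ : Fin n => (n : ℝ)⁻¹)
      (p := fun i => (y i) ^ 2 / 4) (fun _ _ => by positivity) (by simp [hn'.ne'])
      (fun _ _ => Set.mem_univ _)
    simp only [smul_eq_mul] at this
    refine le_trans (le_of_eq ?_) this
    rw [← Finset.mul_sum, ← Finset.sum_div, EuclideanSpace.real_norm_sq_eq]
    congr 1
    field_simp
  calc _ ≤ ∫⁻ x, ∑ i, ENNReal.ofReal ((n : ℝ)⁻¹) *
          ENNReal.ofReal (exp (((x - bary μ) i) ^ 2 / 4)) ∂μ := by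
        refine lintegral_mono fun x => ?_
        refine (ENNReal.ofReal_le_ofReal (hle (x - bary μ))).trans (le_of_eq ?_)
        rw [ENNReal.ofReal_sum_of_nonneg fun i _ => by positivity]
        refine Finset.sum_congr rfl fun i _ => ?_
        rw [ENNReal.ofReal_mul (by positivity)]
    _ = ∑ i : Fin n, ENNReal.ofReal ((n : ℝ)⁻¹) *
          ∫⁻ x, ENNReal.ofReal (exp (((x - bary μ) i) ^ 2 / 4)) ∂μ := by
        rw [lintegral_finsetSum _ (fun i _ => by fun_prop)]
        refine Finset.sum_congr rfl fun i _ => ?_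
        rw [lintegral_const_mul _ (by fun_prop)]
    _ ≤ ∑ i : Fin n, ENNReal.ofReal ((n : ℝ)⁻¹) * ENNReal.ofReal (√2) := by
        refine Finset.sum_le_sum fun i _ => ?_
        gcongr
        have := hμ.lintegral_exp_inner_sq_le (θ := EuclideanSpace.single i (1 : ℝ)) (by simp)
        simpa [EuclideanSpace.inner_single_right] using this
    _ = ENNReal.ofReal (√2) := by
        rw [Finset.sum_const, Finset.card_univ, Fintype.card_fin, nsmul_eq_mul, ← mul_assoc,
          ← ENNReal.ofReal_natCast, ← ENNReal.ofReal_mul hn'.le, mul_inv_cancel₀ hn'.ne']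
        simp

theorem integrable_norm_sub_sq (hμ : IsTiltStableLogConcave μ) (c : Euc n) :
    Integrable (fun x => ‖x - c‖ ^ 2) μ := by
  have := hμ.prob
  refine (((hμ.tilts.integrable_norm_pow 2).const_mul 2).add
    (integrable_const (2 * ‖c‖ ^ 2))).mono' (by fun_prop) (Filter.Eventually.of_forall fun x => ?_)
  rw [norm_of_nonneg (by positivity)]
  have := norm_sub_le x c
  simp only [Pi.add_apply]
  nlinarith [norm_nonneg (x - c), sq_nonneg (‖x‖ - ‖c‖), norm_nonneg x, norm_nonneg c]

theorem integral_norm_sub_bary_sq_le (hμ : IsTiltStableLogConcave μ) :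
    ∫ x, ‖x - bary μ‖ ^ 2 ∂μ ≤ n := by
  have := hμ.prob
  have hi : ∀ i, Integrable (fun x : Euc n => ((x - bary μ) i) ^ 2) μ := fun i => by
    refine (hμ.integrable_norm_sub_sq (bary μ)).mono' (by fun_prop)
      (Filter.Eventually.of_forall fun x => ?_)
    rw [norm_of_nonneg (by positivity), ← sq_abs]
    gcongr
    exact PiLp.norm_apply_le (x - bary μ) i
  simp_rw [EuclideanSpace.real_norm_sq_eq]
  rw [integral_finsetSum _ fun i _ => hi i]
  calc _ ≤ ∑ _i : Fin n, (1 : ℝ) := by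
        refine Finset.sum_le_sum fun i _ => ?_
        have := hμ.stable 0 (EuclideanSpace.single i (1 : ℝ)) (by simp)
        rw [hμ.tilts.tilt_zero] at this
        simpa [EuclideanSpace.inner_single_right] using this
    _ = n := by simp

end IsTiltStableLogConcave

namespace TiltsWellDefined

variable {n : ℕ} {μ : Measure (Euc n)}

theorem continuous_laplace (hμ : TiltsWellDefined μ) :
    Continuous fun g : Euc n => ∫ x, exp ⟪g, x⟫ ∂μ := by
  refine continuous_iff_continuousAt.2 fun g => ?_
  refine continuousAt_of_dominated (bound := fun x => exp ((‖g‖ + 1) * ‖x‖))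
    (Filter.Eventually.of_forall fun _ => by fun_prop) ?_ ?_
    (Filter.Eventually.of_forall fun x => by fun_prop)
  · filter_upwards [Metric.ball_mem_nhds g one_pos] with g' hg'
    refine Filter.Eventually.of_forall fun x => ?_
    rw [norm_of_nonneg (exp_pos _).le]
    refine exp_le_exp.2 ((real_inner_le_norm g' x).trans ?_)
    gcongr
    have := norm_sub_norm_le g' g
    rw [Metric.mem_ball, dist_eq_norm] at hg'
    linarith
  · simpa using hμ.integrable_exp_norm (‖g‖ + 1) 0

theorem laplace_add [NeZero μ] (hμ : TiltsWellDefined μ) (g h : Euc n) :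
    ∫ x, exp ⟪g + h, x⟫ ∂μ = (∫ x, exp ⟪g, x⟫ ∂μ) * ∫ x, exp ⟪h, x⟫ ∂(_root_.tilt μ g) := by
  rw [tilt_eq_tilted hμ, integral_exp_tilted, mul_div_cancel₀ _ (integral_exp_pos (hμ g)).ne']
  simp [inner_add_left]

theorem le_laplace [IsProbabilityMeasure μ] (hμ : TiltsWellDefined μ) (g : Euc n) :
    exp ⟪g, bary μ⟫ ≤ ∫ x, exp ⟪g, x⟫ ∂μ := by
  have h1 := convexOn_exp.map_integral_le (f := fun x : Euc n => ⟪g, x⟫) (μ := μ)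
    continuous_exp.continuousOn isClosed_univ (by simp) (hμ.integrable_id.const_inner g) (hμ g)
  rwa [integral_inner hμ.integrable_id] at h1

theorem hasDerivAt_log_laplace [IsProbabilityMeasure μ] (hμ : TiltsWellDefined μ) (g u : Euc n) :
    HasDerivAt (fun s : ℝ => log (∫ x, exp ⟪g + s • u, x⟫ ∂μ)) ⟪u, bary (_root_.tilt μ g)⟫ 0 := by
  have := hμ.isProbabilityMeasure_tilt g
  have e : (fun s : ℝ => log (∫ x, exp ⟪g + s • u, x⟫ ∂μ)) = fun s =>
      log (∫ x, exp ⟪g, x⟫ ∂μ) + cgf (fun x => ⟪u, x⟫) (_root_.tilt μ g) s := by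
    ext s
    rw [hμ.laplace_add, log_mul (integral_exp_pos (hμ g)).ne'
      (integral_exp_pos ((hμ.tilt g) _)).ne', cgf, mgf]
    simp [real_inner_smul_left]
  rw [e]
  have hset : integrableExpSet (fun x => ⟪u, x⟫) (_root_.tilt μ g) = Set.univ := by
    ext s
    simp only [integrableExpSet, Set.mem_ofPred_eq, Set.mem_univ, iff_true]
    refine ((hμ.tilt g) (s • u)).congr (Filter.Eventually.of_forall fun x => ?_)
    simp [real_inner_smul_left]
  have h1 := (analyticAt_cgf (X := fun x => ⟪u, x⟫) (μ := _root_.tilt μ g) (v := 0)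
    (by simp [hset])).differentiableAt.hasDerivAt
  rw [deriv_cgf_zero (by simp [hset]), integral_inner (hμ.tilt g).integrable_id] at h1
  simp only [probReal_univ, div_one] at h1
  exact h1.const_add _

theorem exists_bary_tilt_eq [IsProbabilityMeasure μ] (hμ : TiltsWellDefined μ) {t : ℝ} (ht : 0 < t)
    (h : Euc n) : ∃ g : Euc n, (2 * t) • bary (_root_.tilt μ g) = h - g := by
  set Φ : Euc n → ℝ := fun g => log (∫ x, exp ⟪g, x⟫ ∂μ) + ‖g - h‖ ^ 2 / (4 * t) with hΦ
  have hcont : Continuous Φ := by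
    refine (hμ.continuous_laplace.log fun g => (integral_exp_pos (hμ g)).ne').add (by fun_prop)
  have hlow : ∀ g, ⟪g, bary μ⟫ + ‖g - h‖ ^ 2 / (4 * t) ≤ Φ g := by
    intro g
    have := (le_log_iff_exp_le (integral_exp_pos (hμ g))).2 (hμ.le_laplace g)
    simp only [hΦ]
    linarith
  have hcoer : Filter.Tendsto Φ (Filter.cocompact (Euc n)) Filter.atTop := by
    have h1 : Filter.Tendsto (fun g : Euc n => ‖g - h‖ * (‖g - h‖ / (4 * t) - ‖bary μ‖) -
        ‖h‖ * ‖bary μ‖) (Filter.cocompact (Euc n)) Filter.atTop := by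
      have h2 : Filter.Tendsto (fun g : Euc n => ‖g - h‖) (Filter.cocompact (Euc n))
          Filter.atTop := by
        refine Filter.tendsto_atTop_mono (fun g => norm_sub_norm_le g h) ?_
        exact Filter.tendsto_atTop_add_const_right _ _ (tendsto_norm_cocompact_atTop)
      have h3 : Filter.Tendsto (fun r : ℝ => r * (r / (4 * t) - ‖bary μ‖) - ‖h‖ * ‖bary μ‖)
          Filter.atTop Filter.atTop := by
        refine Filter.tendsto_atTop_add_const_right _ _ ?_
        refine Filter.tendsto_id.atTop_mul_atTop₀ ?_
        exact Filter.tendsto_atTop_add_const_right _ _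
          (Filter.tendsto_id.atTop_div_const (by positivity))
      exact h3.comp h2
    refine Filter.tendsto_atTop_mono (fun g => ?_) h1
    refine le_trans ?_ (hlow g)
    have e1 : ⟪g, bary μ⟫ = ⟪g - h, bary μ⟫ + ⟪h, bary μ⟫ := by rw [inner_sub_left]; ring
    have e2 := neg_le_of_abs_le (abs_real_inner_le_norm (g - h) (bary μ))
    have e3 := neg_le_of_abs_le (abs_real_inner_le_norm h (bary μ))
    rw [e1]
    have : ‖g - h‖ * (‖g - h‖ / (4 * t) - ‖bary μ‖) =
      ‖g - h‖ ^ 2 / (4 * t) - ‖g - h‖ * ‖bary μ‖ := by ring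
    linarith
  obtain ⟨g, hg⟩ := hcont.exists_forall_le hcoer
  refine ⟨g, ?_⟩
  have key : ∀ u : Euc n, ⟪u, (2 * t) • bary (_root_.tilt μ g) - (h - g)⟫ = 0 := by
    intro u
    have d1 := hμ.hasDerivAt_log_laplace g u
    have d2 : HasDerivAt (fun s : ℝ => ‖g + s • u - h‖ ^ 2 / (4 * t)) (⟪g - h, u⟫ / (2 * t)) 0 := by
      have : HasDerivAt (fun s : ℝ => g + s • u - h) u 0 := by
        simpa using (((hasDerivAt_id (0 : ℝ)).smul_const u).const_add g).sub_const h
      refine ((this.norm_sq).div_const (4 * t)).congr_deriv ?_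
      rw [zero_smul, add_zero]
      field_simp
      ring
    have d := d1.add d2
    have hmin : IsLocalMin (fun s : ℝ => log (∫ x, exp ⟪g + s • u, x⟫ ∂μ) +
        ‖g + s • u - h‖ ^ 2 / (4 * t)) 0 :=
      Filter.Eventually.of_forall fun s => by simpa [hΦ] using hg (g + s • u)
    have z := hmin.hasDerivAt_eq_zero d
    have e : ⟪u, (2 * t) • bary (_root_.tilt μ g) - (h - g)⟫ =
        2 * t * (⟪u, bary (_root_.tilt μ g)⟫ + ⟪g - h, u⟫ / (2 * t)) := by
      rw [inner_sub_right, inner_smul_right, ← neg_sub g h, inner_neg_right, real_inner_comm u (g - h)]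
      field_simp
      ring
    rw [e, z, mul_zero]
  have := key ((2 * t) • bary (_root_.tilt μ g) - (h - g))
  rw [inner_self_eq_zero] at this
  exact sub_eq_zero.1 this

theorem gtilt_eq_tilted_tilt [IsProbabilityMeasure μ] (hμ : TiltsWellDefined μ) {t : ℝ} (ht : 0 < t)
    (h a : Euc n) :
    gtilt μ t h = (_root_.tilt μ (h - (2 * t) • a)).tilted (fun x => -t * ‖x - a‖ ^ 2) := by
  rw [gtilt_eq_tilted ht, tilt_eq_tilted hμ, tilted_tilted (hμ _),
    ← tilted_add_const μ (fun x => -t * ‖x‖ ^ 2 + ⟪h, x⟫) (-t * ‖a‖ ^ 2)]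
  congr 1
  ext x
  simp only [Pi.add_apply]
  rw [norm_sub_sq_real, inner_sub_left, real_inner_smul_left, real_inner_comm a x]
  ring

end TiltsWellDefined

theorem psi2_le {Ω : Type*} [MeasurableSpace Ω] {μ : Measure Ω} {g : Ω → ℝ} {t : ℝ}
    (h : HasPsi2NormLE μ g t) : psi2 μ g ≤ t :=
  csInf_le ⟨0, fun _ hs => hs.1.le⟩ h

namespace IsTiltStableLogConcave

variable {n : ℕ} {μ : Measure (Euc n)}

theorem integral_norm_sub_bary_le (hμ : IsTiltStableLogConcave μ) :
    ∫ x, ‖x - bary μ‖ ∂μ ≤ √n := by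
  have := hμ.prob
  have h0 : 0 ≤ ∫ x, ‖x - bary μ‖ ∂μ := integral_nonneg fun x => norm_nonneg _
  have hL : MemLp (fun x => ‖x - bary μ‖) 2 μ :=
    (memLp_two_iff_integrable_sq (by fun_prop)).2 (hμ.integrable_norm_sub_sq _)
  have h := variance_eq_sub hL
  have hv := variance_nonneg (fun x => ‖x - bary μ‖) μ
  have := hμ.integral_norm_sub_bary_sq_le
  refine le_sqrt_of_sq_le ?_
  simp only [Pi.pow_apply] at h
  linarith

theorem hasPsi2NormLE (hμ : IsTiltStableLogConcave μ) (hn : 0 < n) :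
    HasPsi2NormLE μ (fun x => ‖x‖ - ∫ y, ‖y‖ ∂μ) (√(8 * n)) := by
  have := hμ.prob
  have hn' : (0 : ℝ) < n := by exact_mod_cast hn
  refine ⟨by positivity, ?_⟩
  rw [sq_sqrt (by positivity)]
  set b := bary μ
  set m := ∫ y, ‖y‖ ∂μ with hm
  have h_int : Integrable (fun x : Euc n => ‖x‖) μ := hμ.tilts.integrable_id.norm
  have hmb : |m - ‖b‖| ≤ √n := by
    refine le_trans ?_ hμ.integral_norm_sub_bary_le
    have e : m - ‖b‖ = ∫ x, (‖x‖ - ‖b‖) ∂μ := by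
      rw [integral_sub h_int (integrable_const _)]; simp [hm]
    rw [e]
    refine (abs_integral_le_integral_abs).trans (integral_mono (h_int.sub (integrable_const _)).abs
      (hμ.tilts.integrable_id.sub (integrable_const _)).norm fun x => ?_)
    exact abs_norm_sub_norm_le x b
  have hG : ∀ x : Euc n, (‖x‖ - m) ^ 2 ≤ 2 * ‖x - b‖ ^ 2 + 2 * n := by
    intro x
    have h1 : (‖x‖ - ‖b‖) ^ 2 ≤ ‖x - b‖ ^ 2 := by
      rw [sq_le_sq, abs_of_nonneg (norm_nonneg (x - b))]
      exact abs_norm_sub_norm_le x b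
    have h2 : (m - ‖b‖) ^ 2 ≤ n := by
      rw [← sq_sqrt hn'.le, sq_le_sq, abs_of_nonneg (sqrt_nonneg _)]
      exact hmb
    nlinarith [sq_nonneg ((‖x‖ - ‖b‖) + (m - ‖b‖))]
  have hle : ∫⁻ x, ENNReal.ofReal (exp ((‖x‖ - m) ^ 2 / (8 * n))) ∂μ ≤ ENNReal.ofReal 2 := by
    calc _ ≤ ∫⁻ x, ENNReal.ofReal (exp (1 / 4)) *
          ENNReal.ofReal (exp (‖x - b‖ ^ 2 / (4 * n))) ∂μ := by
          refine lintegral_mono fun x => ?_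
          rw [← ENNReal.ofReal_mul (exp_pos _).le, ← exp_add]
          refine ENNReal.ofReal_le_ofReal (exp_le_exp.2 ?_)
          have e : 1 / 4 + ‖x - b‖ ^ 2 / (4 * n) = (2 * ‖x - b‖ ^ 2 + 2 * n) / (8 * n) := by
            field_simp
            ring
          rw [e]
          gcongr
          exact hG x
      _ = ENNReal.ofReal (exp (1 / 4)) * ∫⁻ x, ENNReal.ofReal (exp (‖x - b‖ ^ 2 / (4 * n))) ∂μ :=
          lintegral_const_mul _ (by fun_prop)
      _ ≤ ENNReal.ofReal (exp (1 / 4)) * ENNReal.ofReal (√2) := by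
          gcongr
          exact hμ.lintegral_exp_norm_sq_le hn
      _ ≤ ENNReal.ofReal 2 := by
          rw [← ENNReal.ofReal_mul (exp_pos _).le]
          refine ENNReal.ofReal_le_ofReal ?_
          refine abs_le_of_sq_le_sq' ?_ (by norm_num) |>.2
          rw [mul_pow, sq_sqrt (by norm_num), ← exp_nat_mul]
          have h1 : exp ((2 : ℕ) * (1 / 4)) ^ 2 ≤ 2 ^ 2 := by
            rw [← exp_nat_mul]
            norm_num
            have := exp_one_lt_d9
            linarith
          have := abs_le_of_sq_le_sq' h1 (by norm_num) |>.2
          linarith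
  rw [integral_eq_lintegral_of_nonneg_ae (Filter.Eventually.of_forall fun x => (exp_pos _).le)
    (by fun_prop)]
  exact ENNReal.toReal_le_of_le_ofReal (by norm_num) hle

theorem psi2_le_Ktilde (hμ : IsTiltStableLogConcave μ) (hn : 0 < n) :
    psi2 μ (fun x => ‖x‖ - ∫ y, ‖y‖ ∂μ) ≤ Ktilde n := by
  refine le_csSup ⟨√(8 * n), ?_⟩ ⟨μ, hμ.prob, hμ.logConcave, hμ.tilts, hμ.stable, rfl⟩
  rintro r ⟨ν, h1, h2, h3, h4, rfl⟩
  exact psi2_le ((⟨h1, h2, h3, h4⟩ : IsTiltStableLogConcave ν).hasPsi2NormLE hn)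

end IsTiltStableLogConcave

theorem Ktilde_le {n : ℕ} (hn : 0 < n) : Ktilde n ≤ √(8 * n) := by
  refine Real.sSup_le ?_ (sqrt_nonneg _)
  rintro r ⟨ν, h1, h2, h3, h4, rfl⟩
  exact psi2_le ((⟨h1, h2, h3, h4⟩ : IsTiltStableLogConcave ν).hasPsi2NormLE hn)

/-- All Gaussian moments of `μ` are finite. -/
def LightTailed {n : ℕ} (μ : Measure (Euc n)) : Prop :=
  ∀ s : ℝ, Integrable (fun x => exp (s * ‖x‖ ^ 2)) μ

namespace LightTailed

variable {n : ℕ} {μ : Measure (Euc n)}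

theorem tilts (hμ : LightTailed μ) : TiltsWellDefined μ := by
  intro h
  refine ((hμ 1).const_mul (exp (‖h‖ ^ 2))).mono' (by fun_prop)
    (Filter.Eventually.of_forall fun x => ?_)
  rw [norm_of_nonneg (exp_pos _).le, ← exp_add]
  refine exp_le_exp.2 ?_
  nlinarith [real_inner_le_norm h x, sq_nonneg (‖h‖ - ‖x‖), sq_nonneg (‖h‖ + ‖x‖)]

theorem tilt [NeZero μ] (hμ : LightTailed μ) (h : Euc n) : LightTailed (tilt μ h) := by
  intro s
  rw [tilt_eq_tilted hμ.tilts, integrable_tilted_iff (hμ.tilts h)]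
  refine ((hμ (s + 1)).const_mul (exp (‖h‖ ^ 2))).mono' (by fun_prop)
    (Filter.Eventually.of_forall fun x => ?_)
  rw [smul_eq_mul, norm_of_nonneg (by positivity), ← exp_add, ← exp_add]
  refine exp_le_exp.2 ?_
  nlinarith [real_inner_le_norm h x, sq_nonneg (‖h‖ - ‖x‖), sq_nonneg (‖h‖ + ‖x‖)]

theorem map_sub (hμ : LightTailed μ) (a : Euc n) : LightTailed (μ.map fun x => x - a) := by
  intro s
  rw [integrable_map_measure (by fun_prop) (by fun_prop)]
  refine ((hμ (2 * |s|)).const_mul (exp (2 * |s| * ‖a‖ ^ 2))).mono' (by fun_prop)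
    (Filter.Eventually.of_forall fun x => ?_)
  simp only [Function.comp]
  rw [norm_of_nonneg (exp_pos _).le, ← exp_add]
  refine exp_le_exp.2 ?_
  have h1 := norm_sub_le x a
  have h2 : ‖x - a‖ ^ 2 ≤ 2 * ‖x‖ ^ 2 + 2 * ‖a‖ ^ 2 := by
    nlinarith [norm_nonneg (x - a), sq_nonneg (‖x‖ - ‖a‖), norm_nonneg x, norm_nonneg a]
  nlinarith [le_abs_self s, abs_nonneg s, sq_nonneg ‖x - a‖]

theorem integrable_exp_sq_sub_div (hμ : LightTailed μ) (m t : ℝ) :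
    Integrable (fun x => exp ((‖x‖ - m) ^ 2 / t ^ 2)) μ := by
  refine ((hμ (2 / t ^ 2)).const_mul (exp (2 * m ^ 2 / t ^ 2))).mono' (by fun_prop)
    (Filter.Eventually.of_forall fun x => ?_)
  rw [norm_of_nonneg (exp_pos _).le, ← exp_add]
  refine exp_le_exp.2 ?_
  rw [div_mul_eq_mul_div, ← add_div]
  gcongr
  nlinarith [sq_nonneg (‖x‖ + m)]

theorem integral_exp_sq_le (hμ : LightTailed μ) (h : IsTiltStableLogConcave μ) (hn : 0 < n)
    {K : ℝ} (hK : Ktilde n < K) :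
    ∫ x, exp ((‖x‖ - ∫ y, ‖y‖ ∂μ) ^ 2 / K ^ 2) ∂μ ≤ 2 := by
  obtain ⟨t, ⟨ht, ht2⟩, htK⟩ := exists_lt_of_csInf_lt (s := {t | HasPsi2NormLE μ
    (fun x => ‖x‖ - ∫ y, ‖y‖ ∂μ) t}) ⟨_, h.hasPsi2NormLE hn⟩ ((h.psi2_le_Ktilde hn).trans_lt hK)
  refine le_trans (integral_mono (hμ.integrable_exp_sq_sub_div _ _)
    (hμ.integrable_exp_sq_sub_div _ _) fun x => ?_) ht2
  simp only
  gcongr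

theorem le_psi2 [IsProbabilityMeasure μ] (hμ : LightTailed μ) (h : IsTiltStableLogConcave μ)
    (hn : 0 < n) :
    √(Var[fun x => ‖x‖; μ]) ≤ psi2 μ (fun x => ‖x‖ - ∫ y, ‖y‖ ∂μ) := by
  refine le_csInf ⟨_, h.hasPsi2NormLE hn⟩ ?_
  rintro t ⟨ht, ht2⟩
  refine sqrt_le_iff.2 ⟨ht.le, ?_⟩
  rw [variance_eq_integral (by fun_prop)]
  have hi : Integrable (fun x : Euc n => (‖x‖ - ∫ y, ‖y‖ ∂μ) ^ 2) μ := by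
    refine (hμ.integrable_exp_sq_sub_div (∫ y, ‖y‖ ∂μ) 1).mono' (by fun_prop)
      (Filter.Eventually.of_forall fun x => ?_)
    rw [norm_of_nonneg (by positivity), one_pow, div_one]
    have := add_one_le_exp ((‖x‖ - ∫ y, ‖y‖ ∂μ) ^ 2)
    linarith
  have h1 := integral_mono ((hi.div_const (t ^ 2)).add (integrable_const 1))
    (hμ.integrable_exp_sq_sub_div _ t) (fun x => add_one_le_exp _)
  simp only [Pi.add_apply] at h1
  rw [integral_add (hi.div_const _) (integrable_const _), integral_div] at h1
  simp only [integral_const, probReal_univ, smul_eq_mul, mul_one] at h1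
  have h2 : (∫ x, (‖x‖ - ∫ y, ‖y‖ ∂μ) ^ 2 ∂μ) / t ^ 2 ≤ 1 := by linarith
  rwa [div_le_one (by positivity)] at h2

end LightTailed

theorem isLogConcave_withDensity_indicator {n : ℕ} {s : Set (Euc n)} (hs : Convex ℝ s)
    (hm : MeasurableSet s) {c : ℝ} (hc : 0 < c) :
    IsLogConcave ((volume : Measure (Euc n)).withDensity
      fun x => ENNReal.ofReal (s.indicator (fun _ => c) x)) := by
  have h0 : ∀ x, 0 ≤ s.indicator (fun _ => c) x :=
    fun x => Set.indicator_nonneg (fun _ _ => hc.le) x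
  refine ⟨s.indicator fun _ => c, measurable_const.indicator hm, h0,
    fun x y a b ha hb hab => ?_, rfl⟩
  rcases ha.eq_or_lt with rfl | ha'
  · obtain rfl : b = 1 := by linarith
    simp
  rcases hb.eq_or_lt with rfl | hb'
  · obtain rfl : a = 1 := by linarith
    simp
  by_cases hx : x ∈ s
  · by_cases hy : y ∈ s
    · rw [Set.indicator_of_mem hx, Set.indicator_of_mem hy,
        Set.indicator_of_mem (hs hx hy ha hb hab), ← rpow_add hc, hab, rpow_one]
    · rw [Set.indicator_of_notMem hy, zero_rpow hb'.ne', mul_zero]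
      exact h0 _
  · rw [Set.indicator_of_notMem hx, zero_rpow ha'.ne', zero_mul]
    exact h0 _

theorem lightTailed_of_norm_le_one {n : ℕ} {μ : Measure (Euc n)} [IsProbabilityMeasure μ]
    (h : ∀ᵐ x ∂μ, ‖x‖ ≤ 1) : LightTailed μ := by
  intro s
  refine (integrable_const (exp |s|)).mono' (by fun_prop) ?_
  filter_upwards [h] with x hx
  rw [norm_of_nonneg (exp_pos _).le]
  refine exp_le_exp.2 ((le_abs_self _).trans ?_)
  rw [abs_mul, abs_of_nonneg (sq_nonneg ‖x‖)]
  exact mul_le_of_le_one_right (abs_nonneg _) (pow_le_one₀ (norm_nonneg _) hx)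

theorem isTiltStableLogConcave_of_norm_le_one {n : ℕ} {μ : Measure (Euc n)}
    [hp : IsProbabilityMeasure μ] (hμ : IsLogConcave μ) (h : ∀ᵐ x ∂μ, ‖x‖ ≤ 1) :
    IsTiltStableLogConcave μ := by
  have ht := (lightTailed_of_norm_le_one h).tilts
  refine ⟨hp, hμ, ht, (ht.tiltStable_iff 1).2 fun g θ hθ => ?_⟩
  have := ht.isProbabilityMeasure_tilt g
  have hb : ∀ᵐ x ∂tilt μ g, ⟪x, θ⟫ ∈ Set.Icc (-1 : ℝ) 1 := by
    rw [tilt_eq_tilted ht]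
    filter_upwards [(tilted_absolutelyContinuous μ fun x => ⟪g, x⟫) h] with x hx
    rw [Set.mem_Icc, ← abs_le]
    calc |⟪x, θ⟫| ≤ ‖x‖ * ‖θ‖ := abs_real_inner_le_norm x θ
      _ ≤ 1 := by rwa [hθ, mul_one]
  refine (variance_le_sq_of_bounded hb (by fun_prop)).trans (by norm_num)

theorem exists_norm_le_one_and_le_integral_norm_sub_sq {n : ℕ} (hn : 0 < n) :
    ∃ μ : Measure (Euc n), IsProbabilityMeasure μ ∧ IsLogConcave μ ∧ (∀ᵐ x ∂μ, ‖x‖ ≤ 1) ∧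
      ∀ b, 1 / 8 ≤ ∫ x, ‖x - b‖ ^ 2 ∂μ := by
  set B := Metric.closedBall (0 : Euc n) 1 with hB
  have hBm : MeasurableSet B := Metric.isClosed_closedBall.measurableSet
  have hv0 : 0 < volume.real B := by
    rw [measureReal_def, ENNReal.toReal_pos_iff]
    exact ⟨Metric.measure_closedBall_pos _ _ one_pos, measure_closedBall_lt_top⟩
  have hvB : volume B = ENNReal.ofReal (volume.real B) := by
    rw [ofReal_measureReal measure_closedBall_lt_top.ne]
  set c := (volume.real B)⁻¹ with hc
  have hc0 : 0 < c := inv_pos.2 hv0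
  set μ := (volume : Measure (Euc n)).withDensity
    fun x => ENNReal.ofReal (B.indicator (fun _ => c) x) with hμ
  have hle : ∀ s, MeasurableSet s → μ s ≤ ENNReal.ofReal c * volume s := by
    intro s hs
    rw [hμ, withDensity_apply _ hs, ← setLIntegral_const]
    refine lintegral_mono fun x => ENNReal.ofReal_le_ofReal ?_
    exact Set.indicator_le_self' (fun _ _ => hc0.le) x
  have hind : (fun x => ENNReal.ofReal (B.indicator (fun _ => c) x)) =
      B.indicator fun _ => ENNReal.ofReal c := by
    ext x
    by_cases hx : x ∈ B <;> simp [hx]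
  have hp : IsProbabilityMeasure μ := by
    refine ⟨?_⟩
    rw [hμ, withDensity_apply _ MeasurableSet.univ, Measure.restrict_univ, hind,
      lintegral_indicator hBm, setLIntegral_const, hvB, ← ENNReal.ofReal_mul hc0.le,
      inv_mul_cancel₀ hv0.ne', ENNReal.ofReal_one]
  have hsupp : ∀ᵐ x ∂μ, ‖x‖ ≤ 1 := by
    have : μ Bᶜ = 0 := by
      rw [hμ, withDensity_apply _ hBm.compl, hind, setLIntegral_eq_zero hBm.compl]
      intro x hx
      exact Set.indicator_of_notMem hx _
    filter_upwards [compl_mem_ae_iff.2 this] with x hx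
    simpa [hB] using hx
  refine ⟨μ, hp, isLogConcave_withDensity_indicator (convex_closedBall _ _) hBm hc0, hsupp,
    fun b => ?_⟩
  have hmeas : μ.real (Metric.closedBall b (1 / 2)) ≤ 1 / 2 := by
    refine ENNReal.toReal_le_of_le_ofReal (by norm_num)
      ((hle _ Metric.isClosed_closedBall.measurableSet).trans ?_)
    rw [Measure.addHaar_closedBall' _ _ (by norm_num), finrank_euclideanSpace_fin, hvB,
      ← ENNReal.ofReal_mul (by positivity), ← ENNReal.ofReal_mul hc0.le]
    refine ENNReal.ofReal_le_ofReal ?_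
    have : ((1 : ℝ) / 2) ^ n ≤ (1 / 2) ^ 1 :=
      pow_le_pow_of_le_one (by norm_num) (by norm_num) hn
    calc c * ((1 / 2) ^ n * volume.real B) = (1 / 2) ^ n * (c * volume.real B) := by ring
      _ = (1 / 2) ^ n := by rw [inv_mul_cancel₀ hv0.ne', mul_one]
      _ ≤ 1 / 2 := by simpa using this
  have h_int : Integrable (fun x => ‖x - b‖ ^ 2) μ :=
    (isTiltStableLogConcave_of_norm_le_one
      (isLogConcave_withDensity_indicator (convex_closedBall _ _) hBm hc0)
      hsupp).integrable_norm_sub_sq b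
  have hmk := mul_meas_ge_le_integral_of_nonneg
    (Filter.Eventually.of_forall fun x => sq_nonneg ‖x - b‖) h_int (1 / 4)
  have hsub : (Metric.closedBall b (1 / 2))ᶜ ⊆ {x | 1 / 4 ≤ ‖x - b‖ ^ 2} := by
    intro x hx
    rw [Set.mem_compl_iff, mem_closedBall_iff_norm, not_le] at hx
    rw [Set.mem_ofPred_eq]
    nlinarith
  have h1 := measureReal_mono (μ := μ) hsub
  rw [measureReal_compl Metric.isClosed_closedBall.measurableSet, probReal_univ] at h1
  linarith

theorem abs_norm_add_smul_sub_le {n : ℕ} {x e : Euc n} (hx : ‖x‖ ≤ 1) (he : ‖e‖ = 1) {R : ℝ}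
    (hR : 2 ≤ R) : ‖x + R • e‖ - R - ⟪x, e⟫ ∈ Set.Icc 0 (1 / R) := by
  have hR0 : 0 < R := by linarith
  have hs : ‖x + R • e‖ ^ 2 = ‖x‖ ^ 2 + 2 * R * ⟪x, e⟫ + R ^ 2 := by
    rw [norm_add_sq_real, inner_smul_right, norm_smul, he, norm_of_nonneg hR0.le]
    ring
  have hi : |⟪x, e⟫| ≤ ‖x‖ := by simpa [he] using abs_real_inner_le_norm x e
  have hi2 := abs_le.1 (hi.trans hx)
  have hi3 : ⟪x, e⟫ ^ 2 ≤ ‖x‖ ^ 2 := sq_le_sq' (abs_le.1 hi).1 (abs_le.1 hi).2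
  have hx2 : ‖x‖ ^ 2 ≤ 1 := pow_le_one₀ (norm_nonneg _) hx
  constructor
  · have : R + ⟪x, e⟫ ≤ ‖x + R • e‖ := by
      refine abs_le_of_sq_le_sq' ?_ (norm_nonneg _) |>.2
      nlinarith
    linarith
  · have hq : 0 < 1 / R := by positivity
    have : ‖x + R • e‖ ≤ R + ⟪x, e⟫ + 1 / R := by
      refine abs_le_of_sq_le_sq' ?_ (by linarith) |>.2
      have h1 : 1 / R * R = 1 := by field_simp
      have h2 : 1 / R * 1 ≤ 1 / R * (R / 2) := by gcongr; linarith
      nlinarith [sq_nonneg (1 / R), sq_nonneg ⟪x, e⟫]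
    linarith

theorem sqrt_inv_le_Ktilde {n : ℕ} (hn : 0 < n) : √(1 / (32 * n)) ≤ Ktilde n := by
  obtain ⟨μ, hp, hlc, hsupp, hvar⟩ := exists_norm_le_one_and_le_integral_norm_sub_sq hn
  have hμ := isTiltStableLogConcave_of_norm_le_one hlc hsupp
  have hl := lightTailed_of_norm_le_one hsupp
  have hn1 : (1 : ℝ) ≤ n := by exact_mod_cast hn
  have hn0 : (0 : ℝ) < n := by linarith
  obtain ⟨i, hi⟩ : ∃ i, 1 / (8 * n) ≤ Var[fun x => ⟪x, EuclideanSpace.single i 1⟫; μ] := by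
    by_contra! hcon
    have hsum : ∫ x, ‖x - bary μ‖ ^ 2 ∂μ =
        ∑ i, Var[fun x => ⟪x, EuclideanSpace.single i 1⟫; μ] := by
      simp_rw [← integral_sub_bary_sq hμ.tilts.integrable_id]
      rw [← integral_finsetSum]
      · refine integral_congr_ae (Filter.Eventually.of_forall fun x => ?_)
        simp only
        rw [EuclideanSpace.real_norm_sq_eq]
        simp [EuclideanSpace.inner_single_right]
      · intro i _
        refine (hμ.integrable_norm_sub_sq (bary μ)).mono' (by fun_prop)
          (Filter.Eventually.of_forall fun x => ?_)
        rw [norm_of_nonneg (sq_nonneg _), ← sq_abs]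
        gcongr
        simpa using abs_real_inner_le_norm (x - bary μ) (EuclideanSpace.single i (1 : ℝ))
    have h1 := hvar (bary μ)
    rw [hsum] at h1
    have : Nonempty (Fin n) := ⟨⟨0, hn⟩⟩
    have h2 := Finset.sum_lt_sum_of_nonempty (Finset.univ_nonempty (α := Fin n))
      fun i _ => hcon i
    simp only [Finset.sum_const, Finset.card_univ, Fintype.card_fin, nsmul_eq_mul] at h2
    have h3 : (n : ℝ) * (1 / (8 * n)) = 1 / 8 := by field_simp
    linarith
  set e : Euc n := EuclideanSpace.single i 1 with he
  have hen : ‖e‖ = 1 := by simp [he]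
  set R : ℝ := 4 * n with hR
  set a : Euc n := -(R • e)
  have hκ := (hμ.map_sub a).psi2_le_Ktilde hn
  have := (hμ.map_sub a).prob
  refine le_trans ?_ (((hl.map_sub a).le_psi2 (hμ.map_sub a) hn).trans hκ)
  refine sqrt_le_sqrt ?_
  rw [variance_map (by fun_prop) (by fun_prop)]
  have hW : (fun x : Euc n => ‖x‖) ∘ (fun x => x - a) = fun x => ‖x + R • e‖ := by
    ext x; simp [a]
  rw [hW]
  set W : Euc n → ℝ := fun x => ‖x + R • e‖ with hWdef
  set D : Euc n → ℝ := fun x => ‖x + R • e‖ - R - ⟪x, e⟫ with hD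
  have hDb : ∀ᵐ x ∂μ, D x ∈ Set.Icc 0 (1 / R) := by
    filter_upwards [hsupp] with x hx
    exact abs_norm_add_smul_sub_le hx hen (by rw [hR]; linarith)
  have hDv := variance_le_sq_of_bounded hDb (by fun_prop)
  have hD2 : MemLp D 2 μ := memLp_of_bounded hDb (by fun_prop) 2
  have hW2 : MemLp W 2 μ := by
    rw [memLp_two_iff_integrable_sq (by fun_prop)]
    have := hμ.integrable_norm_sub_sq a
    simpa [a] using this
  have h1 := variance_sub hW2 hD2
  have h2 := variance_add hW2 hD2
  have h3 := variance_nonneg (W + D) μ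
  have h4 : Var[W - D; μ] = Var[fun x => ⟪x, e⟫; μ] := by
    symm
    rw [← variance_add_const (by fun_prop) R]
    congr 1
    ext x
    simp [W, D]
    ring
  have h5 : ((1 / R - 0) / 2) ^ 2 ≤ 1 / (64 * n) := by
    rw [hR, sub_zero, div_div, div_pow, one_pow]
    refine one_div_le_one_div_of_le (by positivity) (by nlinarith)
  have e1 : 1 / (8 * (n : ℝ)) = 4 * (1 / (32 * n)) := by field_simp; norm_num
  have e2 : 1 / (64 * (n : ℝ)) = 1 / 2 * (1 / (32 * n)) := by field_simp; norm_num
  have e3 : 0 < 1 / (32 * (n : ℝ)) := by positivity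
  linarith

/-- The Gibbs variational principle for a tilted measure. -/
theorem integral_tilted_le_log_integral_exp_add {Ω : Type*} [MeasurableSpace Ω] {ρ : Measure Ω}
    [IsProbabilityMeasure ρ] {f F : Ω → ℝ} (hef : Integrable (fun x => exp (f x)) ρ)
    (heF : Integrable (fun x => exp (F x)) ρ) (hf : Integrable f ρ)
    (hf' : Integrable f (ρ.tilted f)) (hF' : Integrable F (ρ.tilted f)) :
    ∫ x, F x ∂(ρ.tilted f) ≤
      log (∫ x, exp (F x) ∂ρ) + (∫ x, f x ∂(ρ.tilted f) - ∫ x, f x ∂ρ) := by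
  have := isProbabilityMeasure_tilted hef
  have hZ := integral_exp_pos hef
  have hE := integral_exp_pos heF
  have hi : Integrable (fun x => exp (F x - f x)) (ρ.tilted f) := by
    rw [integrable_tilted_iff hef]
    refine heF.congr (Filter.Eventually.of_forall fun x => ?_)
    simp only [smul_eq_mul]
    rw [← exp_add, add_sub_cancel]
  have h1 : exp (∫ x, (F x - f x) ∂(ρ.tilted f)) ≤ ∫ x, exp (F x - f x) ∂(ρ.tilted f) :=
    convexOn_exp.map_integral_le continuous_exp.continuousOn isClosed_univ (by simp)
      (hF'.sub hf') hi
  have h2 : exp (∫ x, f x ∂ρ) ≤ ∫ x, exp (f x) ∂ρ :=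
    convexOn_exp.map_integral_le continuous_exp.continuousOn isClosed_univ (by simp) hf hef
  have h3 : ∫ x, exp (F x - f x) ∂(ρ.tilted f) = (∫ x, exp (F x) ∂ρ) / ∫ x, exp (f x) ∂ρ := by
    rw [integral_exp_tilted]
    simp
  rw [h3, integral_sub hF' hf', ← le_log_iff_exp_le (by positivity),
    log_div hE.ne' hZ.ne'] at h1
  rw [← le_log_iff_exp_le hZ] at h2
  linarith

namespace LightTailed

variable {n : ℕ} {μ : Measure (Euc n)}

theorem variance_tilted_le (hl : LightTailed μ) (hμ : IsTiltStableLogConcave μ) (hn : 0 < n)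
    {K t : ℝ} (hK : Ktilde n < K) (hK0 : 0 < K) (ht : 0 < t) {θ : Euc n} (hθ : ‖θ‖ = 1) :
    Var[fun x => ⟪x, θ⟫; μ.tilted (fun x => -t * ‖x - bary μ‖ ^ 2)] ≤
      8 + 8 * t * K ^ 2 + 16 * t ^ 2 * n * K ^ 2 := by
  have := hμ.prob
  set a := bary μ
  set f : Euc n → ℝ := fun x => -t * ‖x - a‖ ^ 2 with hf
  set m := ∫ x, ‖x - a‖ ∂μ with hm
  set G : Euc n → ℝ := fun x => ‖x - a‖ - m with hG
  have hmn : m ≤ √n := hμ.integral_norm_sub_bary_le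
  have hm0 : 0 ≤ m := integral_nonneg fun x => norm_nonneg _
  have hm2 : m ^ 2 ≤ n :=
    (pow_le_pow_left₀ hm0 hmn 2).trans_eq (sq_sqrt (Nat.cast_nonneg n))
  have hf1 : ∀ x, exp (f x) ≤ 1 := fun x => by
    rw [exp_le_one_iff, hf]
    nlinarith [sq_nonneg ‖x - a‖]
  have hef : Integrable (fun x => exp (f x)) μ := by
    refine (integrable_const (1 : ℝ)).mono' (by fun_prop) (Filter.Eventually.of_forall fun x => ?_)
    rw [norm_of_nonneg (exp_pos _).le]
    exact hf1 x
  have hmap : ∀ g : Euc n → ℝ, Integrable g μ → Integrable g (μ.tilted f) := by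
    intro g hg
    rw [integrable_tilted_iff hef]
    refine hg.norm.mono' (by fun_prop) (Filter.Eventually.of_forall fun x => ?_)
    rw [smul_eq_mul, norm_mul, norm_of_nonneg (exp_pos _).le]
    exact mul_le_of_le_one_left (norm_nonneg _) (hf1 x)
  have hprob := isProbabilityMeasure_tilted hef
  have iN2 : Integrable (fun x => ‖x - a‖ ^ 2) μ := hμ.integrable_norm_sub_sq a
  have iN : Integrable (fun x => ‖x - a‖) μ :=
    (hμ.tilts.integrable_id.sub (integrable_const a)).norm
  have iG : Integrable G μ := iN.sub (integrable_const m)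
  have iG2 : Integrable (fun x => G x ^ 2) μ := by
    refine ((iN2.sub (iN.const_mul (2 * m))).add (integrable_const (m ^ 2))).congr
      (Filter.Eventually.of_forall fun x => ?_)
    simp [hG]
    ring
  have iI : Integrable (fun x => ⟪x - a, θ⟫ ^ 2) μ := by
    refine iN2.mono' (by fun_prop) (Filter.Eventually.of_forall fun x => ?_)
    rw [norm_of_nonneg (sq_nonneg _), ← sq_abs]
    gcongr
    simpa [hθ] using abs_real_inner_le_norm (x - a) θ
  have iF : Integrable f μ := iN2.const_mul (-t)
  have ieG : Integrable (fun x => exp (G x ^ 2 / K ^ 2)) μ := by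
    have := (hl.map_sub a).integrable_exp_sq_sub_div m K
    rwa [integrable_map_measure (by fun_prop) (by fun_prop)] at this
  have heG : ∫ x, exp (G x ^ 2 / K ^ 2) ∂μ ≤ 2 := by
    have := (hl.map_sub a).integral_exp_sq_le (hμ.map_sub a) hn hK
    rw [integral_map (by fun_prop) (by fun_prop), integral_map (by fun_prop) (by fun_prop)] at this
    exact this
  have heI' := hμ.lintegral_exp_inner_sq_le hθ
  have ieI : Integrable (fun x => exp (⟪x - a, θ⟫ ^ 2 / 4)) μ := by
    refine ⟨by fun_prop, ?_⟩
    rw [hasFiniteIntegral_iff_ofReal (Filter.Eventually.of_forall fun x => (exp_pos _).le)]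
    exact heI'.trans_lt ENNReal.ofReal_lt_top
  have heI : ∫ x, exp (⟪x - a, θ⟫ ^ 2 / 4) ∂μ ≤ √2 := by
    rw [integral_eq_lintegral_of_nonneg_ae (Filter.Eventually.of_forall fun x => (exp_pos _).le)
      (by fun_prop)]
    exact ENNReal.toReal_le_of_le_ofReal (by positivity) heI'
  set Δ := ∫ x, f x ∂(μ.tilted f) - ∫ x, f x ∂μ with hΔ
  have j1 := integral_tilted_le_log_integral_exp_add hef ieG iF (hmap _ iF)
    ((hmap _ iG2).div_const (K ^ 2))
  have j2 := integral_tilted_le_log_integral_exp_add hef ieI iF (hmap _ iF)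
    ((hmap _ iI).div_const 4)
  have l1 : log (∫ x, exp (G x ^ 2 / K ^ 2) ∂μ) ≤ 1 := by
    refine (log_le_sub_one_of_pos (integral_exp_pos ieG)).trans (by linarith)
  have l2 : log (∫ x, exp (⟪x - a, θ⟫ ^ 2 / 4) ∂μ) ≤ 1 / 2 := by
    refine (log_le_log (integral_exp_pos ieI) heI).trans ?_
    have h2 := log_le_sub_one_of_pos (show (0 : ℝ) < 2 by norm_num)
    rw [log_sqrt (by norm_num)]
    linarith
  have k1 : ∫ x, G x ^ 2 ∂μ ≤ K ^ 2 := by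
    have h1 := integral_mono ((iG2.div_const (K ^ 2)).add (integrable_const 1)) ieG
      (fun x => add_one_le_exp _)
    simp only [Pi.add_apply] at h1
    rw [integral_add (iG2.div_const _) (integrable_const _), integral_div] at h1
    simp only [integral_const, probReal_univ, smul_eq_mul, mul_one] at h1
    have h2 : (∫ x, G x ^ 2 ∂μ) / K ^ 2 ≤ 1 := by linarith
    rwa [div_le_one (by positivity)] at h2
  have k2 : ∫ x, ‖x - a‖ ^ 2 ∂μ ≤ m ^ 2 + K ^ 2 := by
    have e : ∫ x, G x ^ 2 ∂μ = ∫ x, ‖x - a‖ ^ 2 ∂μ - m ^ 2 := by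
      have : ∀ x, G x ^ 2 = ‖x - a‖ ^ 2 - 2 * m * ‖x - a‖ + m ^ 2 := fun x => by
        simp only [hG]; ring
      simp_rw [this]
      rw [integral_add (f := fun x => ‖x - a‖ ^ 2 - 2 * m * ‖x - a‖)
        (iN2.sub (iN.const_mul _)) (integrable_const _),
        integral_sub iN2 (iN.const_mul _), integral_const_mul, ← hm]
      simp
      ring
    linarith
  have k3 : Δ ≤ t * K ^ 2 + 2 * t ^ 2 * m ^ 2 * K ^ 2 +
      (∫ x, G x ^ 2 / K ^ 2 ∂(μ.tilted f)) / 2 := by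
    have e1 : ∫ x, f x ∂μ = -t * ∫ x, ‖x - a‖ ^ 2 ∂μ := integral_const_mul _ _
    have e2 : ∫ x, f x ∂(μ.tilted f) ≤
        ∫ x, (-t * m ^ 2 + 2 * t ^ 2 * m ^ 2 * K ^ 2 + (G x ^ 2 / K ^ 2) / 2) ∂(μ.tilted f) := by
      refine integral_mono (hmap _ iF) ((integrable_const _).add
        (((hmap _ iG2).div_const _).div_const _)) fun x => ?_
      simp only [hf]
      have hx : ‖x - a‖ = m + G x := by simp [hG]
      have hq : 0 ≤ (G x / K + 2 * t * m * K) ^ 2 / 2 := by positivity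
      have hq2 : (G x / K + 2 * t * m * K) ^ 2 / 2 =
          (G x ^ 2 / K ^ 2) / 2 + 2 * t * m * G x + 2 * t ^ 2 * m ^ 2 * K ^ 2 := by
        field_simp
        ring
      rw [hx]
      nlinarith [mul_nonneg ht.le (sq_nonneg (G x))]
    rw [integral_add (integrable_const _) (((hmap _ iG2).div_const _).div_const _),
      integral_div 2] at e2
    simp only [integral_const, probReal_univ, smul_eq_mul, one_mul] at e2
    have := mul_le_mul_of_nonneg_left k2 ht.le
    rw [hΔ, e1]
    linarith
  have k4 : 2 * t ^ 2 * m ^ 2 * K ^ 2 ≤ 2 * t ^ 2 * n * K ^ 2 := by gcongr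
  have k5 : Δ ≤ 1 + 2 * t * K ^ 2 + 4 * t ^ 2 * n * K ^ 2 := by linarith
  have k6 : ∫ x, ⟪x - a, θ⟫ ^ 2 ∂(μ.tilted f) ≤ 4 * (1 / 2 + Δ) := by
    rw [integral_div] at j2
    linarith
  have e3 : Var[fun x => ⟪x, θ⟫; μ.tilted f] = Var[fun x => ⟪x - a, θ⟫; μ.tilted f] := by
    simp_rw [inner_sub_left, sub_eq_add_neg]
    exact (variance_add_const (by fun_prop) _).symm
  rw [e3]
  have e4 := variance_le_expectation_sq (μ := μ.tilted f) (X := fun x => ⟪x - a, θ⟫) (by fun_prop)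
  simp only [Pi.pow_apply] at e4
  linarith

theorem variance_gtilt_le (hl : LightTailed μ) (hμ : IsTiltStableLogConcave μ) (hn : 0 < n)
    {B t : ℝ} (hB : 0 < B) (hB3 : B ^ 3 = n * Ktilde n ^ 2) (ht : 0 < t) (h : Euc n) {θ : Euc n}
    (hθ : ‖θ‖ = 1) : Var[fun x => ⟪x, θ⟫; gtilt μ t h] ≤ 160 * B := by
  have := hμ.prob
  have hn1 : (1 : ℝ) ≤ n := by exact_mod_cast hn
  have hn0 : (0 : ℝ) < n := by linarith
  rcases le_or_gt 1 (t * B) with htB | htB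
  · refine (hμ.logConcave.variance_gtilt_le ht h θ hθ).trans ?_
    rw [div_le_iff₀ ht]
    linarith
  have hKlow := sqrt_inv_le_Ktilde hn
  have hK0 : 0 < Ktilde n := lt_of_lt_of_le (by positivity) hKlow
  set K := Ktilde n
  have hK1 : 1 / (32 * n) ≤ K ^ 2 := (sqrt_le_left hK0.le).1 hKlow
  have hK2 : K ^ 2 ≤ 8 * n := by
    have := pow_le_pow_left₀ hK0.le (Ktilde_le hn) 2
    rwa [sq_sqrt (by positivity)] at this
  have hB4 : 1 ≤ 4 * B := by
    by_contra! hcon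
    have h1 : B ^ 3 < (1 / 4) ^ 3 := by gcongr; linarith
    have h2 : (n : ℝ) * (1 / (32 * n)) ≤ B ^ 3 := by rw [hB3]; gcongr
    have h3 : (n : ℝ) * (1 / (32 * n)) = 1 / 32 := by field_simp
    norm_num at h1
    linarith
  have hBn : B ≤ 2 * n := by
    by_contra! hcon
    have h1 : (2 * (n : ℝ)) ^ 3 < B ^ 3 := by gcongr
    have h2 : B ^ 3 ≤ n * (8 * n) := by rw [hB3]; gcongr
    nlinarith [mul_nonneg (sq_nonneg (n : ℝ)) (sub_nonneg.2 hn1)]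
  obtain ⟨g, hg⟩ := hμ.tilts.exists_bary_tilt_eq ht h
  rw [hμ.tilts.gtilt_eq_tilted_tilt ht h (bary (_root_.tilt μ g)), hg, sub_sub_cancel]
  refine ((hl.tilt g).variance_tilted_le (hμ.tilt g) hn (K := 2 * K) (by linarith) (by linarith)
    ht hθ).trans ?_
  have h1 : t * K ^ 2 ≤ 2 * B := by
    have h2 : t * B ^ 3 ≤ B ^ 2 := by nlinarith [sq_nonneg B]
    have h3 : n * (t * K ^ 2) ≤ n * (2 * B) := by
      calc n * (t * K ^ 2) = t * B ^ 3 := by rw [hB3]; ring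
        _ ≤ B ^ 2 := h2
        _ ≤ n * (2 * B) := by nlinarith
    exact le_of_mul_le_mul_left h3 hn0
  have h4 : t ^ 2 * n * K ^ 2 ≤ B := by
    calc t ^ 2 * n * K ^ 2 = (t * B) ^ 2 * B := by
          rw [mul_pow, mul_assoc, mul_assoc, ← hB3]; ring
      _ ≤ 1 * B := by
          gcongr
          exact pow_le_one₀ (by positivity) htB.le
      _ = B := one_mul B
  nlinarith

end LightTailed

/-- The unnormalized Gaussian kernel of variance `η`. -/
def gaussKernel {n : ℕ} (η : ℝ) (w : Euc n) : ℝ := exp (-‖w‖ ^ 2 / (2 * η))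

section gaussKernel

variable {n : ℕ} {η : ℝ}

theorem gaussKernel_pos (w : Euc n) : 0 < gaussKernel η w := exp_pos _

theorem gaussKernel_le_one (hη : 0 < η) (w : Euc n) : gaussKernel η w ≤ 1 := by
  rw [gaussKernel, exp_le_one_iff, neg_div, neg_nonpos]
  positivity

@[fun_prop]
theorem continuous_gaussKernel : Continuous (gaussKernel η : Euc n → ℝ) := by
  unfold gaussKernel
  fun_prop

theorem gaussKernel_one_add_smul_sub (hη : 0 < η) (t : ℝ) (x z : Euc n) :
    gaussKernel η ((1 + t) • x - z) =
      gaussKernel η (x - z) * exp (-t * (⟪x, x - z⟫ / η) - t ^ 2 * (‖x‖ ^ 2 / η) / 2) := by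
  have e : (1 + t) • x - z = (x - z) + t • x := by rw [add_smul, one_smul]; abel
  rw [gaussKernel, gaussKernel, ← exp_add, e, norm_add_sq_real, inner_smul_right, norm_smul,
    mul_pow, norm_eq_abs, sq_abs, real_inner_comm]
  congr 1
  field_simp
  ring

theorem exp_inner_add_mul_gaussKernel (hη : 0 < η) (g z w : Euc n) :
    exp ⟪g, z + w⟫ * gaussKernel η w =
      exp (η * ‖g‖ ^ 2 / 2) * exp ⟪g, z⟫ * gaussKernel η (w - η • g) := by
  rw [gaussKernel, gaussKernel, ← exp_add, ← exp_add, ← exp_add, norm_sub_sq_real,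
    inner_smul_right, norm_smul, mul_pow, norm_eq_abs, sq_abs, inner_add_right,
    real_inner_comm g w]
  congr 1
  field_simp
  ring

theorem integrable_exp_neg_mul_norm_sq {b : ℝ} (hb : 0 < b) :
    Integrable (fun w : Euc n => exp (-b * ‖w‖ ^ 2)) := by
  by_contra h
  have h1 := GaussianFourier.integral_rexp_neg_mul_sq_norm (V := Euc n) hb
  rw [integral_undef h] at h1
  have : 0 < (π / b) ^ (Module.finrank ℝ (Euc n) / 2 : ℝ) := by positivity
  linarith

theorem gaussKernel_eq : (gaussKernel η : Euc n → ℝ) = fun w => exp (-(1 / (2 * η)) * ‖w‖ ^ 2) := by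
  ext w
  rw [gaussKernel]
  congr 1
  ring

theorem integrable_gaussKernel (hη : 0 < η) : Integrable (gaussKernel η : Euc n → ℝ) := by
  rw [gaussKernel_eq]
  exact integrable_exp_neg_mul_norm_sq (by positivity)

end gaussKernel

/-- The (unnormalized) density of the convolution of `μ` with a Gaussian of variance `η`. -/
def smooth {n : ℕ} (η : ℝ) (μ : Measure (Euc n)) (x : Euc n) : ℝ :=
  ∫ z, gaussKernel η (x - z) ∂μ

section smooth

variable {n : ℕ} {η : ℝ} {μ : Measure (Euc n)}

theorem integrable_gaussKernel_sub [IsFiniteMeasure μ] (hη : 0 < η) (x : Euc n) :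
    Integrable (fun z => gaussKernel η (x - z)) μ :=
  (integrable_const (1 : ℝ)).mono' (by fun_prop) (Filter.Eventually.of_forall fun z => by
    rw [norm_of_nonneg (gaussKernel_pos _).le]
    exact gaussKernel_le_one hη _)

theorem smooth_pos [IsProbabilityMeasure μ] (hη : 0 < η) (x : Euc n) : 0 < smooth η μ x :=
  integral_exp_pos (integrable_gaussKernel_sub (μ := μ) hη x)

theorem smooth_le_one [IsProbabilityMeasure μ] (hη : 0 < η) (x : Euc n) : smooth η μ x ≤ 1 := by
  have := integral_mono (integrable_gaussKernel_sub (μ := μ) hη x) (integrable_const (1 : ℝ))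
    fun z => gaussKernel_le_one hη _
  simpa [smooth] using this

theorem continuous_smooth [IsFiniteMeasure μ] (hη : 0 < η) : Continuous (smooth η μ) := by
  refine continuous_of_dominated (bound := fun _ => 1) (fun x => by fun_prop)
    (fun x => Filter.Eventually.of_forall fun z => ?_) (integrable_const _)
    (Filter.Eventually.of_forall fun z => by fun_prop)
  rw [norm_of_nonneg (gaussKernel_pos _).le]
  exact gaussKernel_le_one hη _

theorem ofReal_smooth [IsFiniteMeasure μ] (hη : 0 < η) (x : Euc n) :
    ENNReal.ofReal (smooth η μ x) = ∫⁻ z, ENNReal.ofReal (gaussKernel η (x - z)) ∂μ :=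
  ofReal_integral_eq_lintegral_ofReal (integrable_gaussKernel_sub hη x)
    (Filter.Eventually.of_forall fun _ => (gaussKernel_pos _).le)

theorem smooth_rpow_mul_le [IsProbabilityMeasure μ] (hμ : IsLogConcave μ) (hη : 0 < η) {a b : ℝ}
    (ha : 0 < a) (hb : 0 < b) (hab : a + b = 1) (x y : Euc n) :
    smooth η μ x ^ a * smooth η μ y ^ b ≤ smooth η μ (a • x + b • y) := by
  have h := hμ.lintegral_exp_mul_le ha hb hab (φ := fun z => -‖x - z‖ ^ 2 / (2 * η))
    (ψ := fun z => -‖y - z‖ ^ 2 / (2 * η))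
    (χ := fun z => -‖(a • x + b • y) - z‖ ^ 2 / (2 * η)) (by fun_prop) (by fun_prop)
    (by fun_prop) fun z z' => by
      have e : (a • x + b • y) - (a • z + b • z') = a • (x - z) + b • (y - z') := by
        simp only [smul_sub]; abel
      have hc : ‖a • (x - z) + b • (y - z')‖ ^ 2 ≤ a * ‖x - z‖ ^ 2 + b * ‖y - z'‖ ^ 2 := by
        have h1 : ‖a • (x - z) + b • (y - z')‖ ≤ a * ‖x - z‖ + b * ‖y - z'‖ := by
          refine (norm_add_le _ _).trans_eq ?_
          rw [norm_smul, norm_smul, norm_of_nonneg ha.le, norm_of_nonneg hb.le]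
        have h2 : (a * ‖x - z‖ + b * ‖y - z'‖) ^ 2 ≤ a * ‖x - z‖ ^ 2 + b * ‖y - z'‖ ^ 2 := by
          obtain rfl : b = 1 - a := by linarith
          nlinarith [mul_nonneg (mul_nonneg ha.le hb.le) (sq_nonneg (‖x - z‖ - ‖y - z'‖))]
        exact (pow_le_pow_left₀ (norm_nonneg _) h1 2).trans h2
      rw [e, mul_div_assoc', mul_div_assoc', ← add_div]
      gcongr
      linarith
  change (∫⁻ z, ENNReal.ofReal (gaussKernel η (x - z)) ∂μ) ^ a *
    (∫⁻ z, ENNReal.ofReal (gaussKernel η (y - z)) ∂μ) ^ b ≤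
    ∫⁻ z, ENNReal.ofReal (gaussKernel η (a • x + b • y - z)) ∂μ at h
  rw [← ofReal_smooth hη, ← ofReal_smooth hη, ← ofReal_smooth hη,
    ENNReal.ofReal_rpow_of_pos (smooth_pos hη _), ENNReal.ofReal_rpow_of_pos (smooth_pos hη _),
    ← ENNReal.ofReal_mul (by have := smooth_pos (μ := μ) hη x; positivity)] at h
  exact (ENNReal.ofReal_le_ofReal_iff (smooth_pos hη _).le).1 h

theorem min_smooth_le [IsProbabilityMeasure μ] (hμ : IsLogConcave μ) (hη : 0 < η) {a b : ℝ}
    (ha : 0 ≤ a) (hb : 0 ≤ b) (hab : a + b = 1) (x y : Euc n) :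
    min (smooth η μ x) (smooth η μ y) ≤ smooth η μ (a • x + b • y) := by
  rcases ha.eq_or_lt with rfl | ha
  · obtain rfl : b = 1 := by linarith
    simp
  rcases hb.eq_or_lt with rfl | hb
  · obtain rfl : a = 1 := by linarith
    simp
  refine le_trans ?_ (smooth_rpow_mul_le hμ hη ha hb hab x y)
  have h0 : 0 < min (smooth η μ x) (smooth η μ y) := lt_min (smooth_pos hη _) (smooth_pos hη _)
  calc min (smooth η μ x) (smooth η μ y)
      = min (smooth η μ x) (smooth η μ y) ^ a * min (smooth η μ x) (smooth η μ y) ^ b := by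
        rw [← rpow_add h0, hab, rpow_one]
    _ ≤ smooth η μ x ^ a * smooth η μ y ^ b := by
        exact mul_le_mul (rpow_le_rpow h0.le (min_le_left _ _) ha.le)
          (rpow_le_rpow h0.le (min_le_right _ _) hb.le) (by positivity)
          (rpow_nonneg (smooth_pos hη _).le _)

theorem exp_mul_setIntegral_gaussKernel_le_smooth [IsFiniteMeasure μ] (hη : 0 < η) {s : Set (Euc n)}
    (hs : MeasurableSet s) {x : Euc n} {t κ : ℝ}
    (h : ∀ z ∈ s, κ ≤ -t * (⟪x, x - z⟫ / η) - t ^ 2 * (‖x‖ ^ 2 / η) / 2) :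
    exp κ * ∫ z in s, gaussKernel η (x - z) ∂μ ≤ smooth η μ ((1 + t) • x) := by
  rw [← integral_const_mul]
  refine le_trans (setIntegral_mono_on ((integrable_gaussKernel_sub hη x).const_mul _).integrableOn
    (integrable_gaussKernel_sub hη ((1 + t) • x)).integrableOn hs fun z hz => ?_)
    (setIntegral_le_integral (integrable_gaussKernel_sub hη _)
      (Filter.Eventually.of_forall fun z => (gaussKernel_pos _).le))
  rw [gaussKernel_one_add_smul_sub hη, mul_comm]
  have := gaussKernel_pos (η := η) (x - z)
  gcongr
  exact h z hz

theorem exists_mul_exp_le_smooth [IsProbabilityMeasure μ] (hi : Integrable (fun x => x) μ)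
    (hη : 0 < η) (x : Euc n) :
    ∃ α, ∀ t, smooth η μ x * exp (-t * α - t ^ 2 * (‖x‖ ^ 2 / η) / 2) ≤
      smooth η μ ((1 + t) • x) := by
  set f : Euc n → ℝ := fun z => -‖x - z‖ ^ 2 / (2 * η) with hf
  have hef : Integrable (fun z => exp (f z)) μ := integrable_gaussKernel_sub hη x
  have := isProbabilityMeasure_tilted hef
  have hmap : ∀ g : Euc n → ℝ, Integrable g μ → Integrable g (μ.tilted f) := by
    intro g hg
    rw [integrable_tilted_iff hef]
    refine hg.norm.mono' (by fun_prop) (Filter.Eventually.of_forall fun x => ?_)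
    rw [smul_eq_mul, norm_mul, norm_of_nonneg (exp_pos _).le]
    exact mul_le_of_le_one_left (norm_nonneg _) (gaussKernel_le_one hη _)
  have iD : Integrable (fun z => ⟪x, x - z⟫ / η) (μ.tilted f) :=
    hmap _ ((((integrable_const x).sub hi).const_inner x).div_const η)
  refine ⟨∫ z, ⟪x, x - z⟫ / η ∂(μ.tilted f), fun t => ?_⟩
  set β := t ^ 2 * (‖x‖ ^ 2 / η) / 2
  set X : Euc n → ℝ := fun z => -t * (⟪x, x - z⟫ / η) - β with hX
  have hsum : ∀ z, exp (f z) * exp (X z) = gaussKernel η ((1 + t) • x - z) := fun z => by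
    rw [gaussKernel_one_add_smul_sub hη]
    rfl
  have iX : Integrable X (μ.tilted f) := (iD.const_mul _).sub (integrable_const _)
  have ieX : Integrable (fun z => exp (X z)) (μ.tilted f) := by
    rw [integrable_tilted_iff hef]
    simp_rw [smul_eq_mul, hsum]
    exact integrable_gaussKernel_sub hη _
  have h1 : exp (∫ z, X z ∂(μ.tilted f)) ≤ ∫ z, exp (X z) ∂(μ.tilted f) :=
    convexOn_exp.map_integral_le continuous_exp.continuousOn isClosed_univ (by simp) iX ieX
  rw [integral_exp_tilted] at h1
  have e1 : ∫ z, X z ∂(μ.tilted f) = -t * ∫ z, ⟪x, x - z⟫ / η ∂(μ.tilted f) - β := by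
    rw [hX, integral_sub (iD.const_mul _) (integrable_const _), integral_const_mul]
    simp
  have e2 : ∫ z, exp ((f + X) z) ∂μ = smooth η μ ((1 + t) • x) := by
    refine integral_congr_ae (Filter.Eventually.of_forall fun z => ?_)
    simp only [Pi.add_apply]
    rw [exp_add, hsum]
  rw [e1, e2, le_div_iff₀ (integral_exp_pos hef), mul_comm] at h1
  exact h1

/-- Tonelli for the joint density of `Z + W` and `Z`, with `Z` distributed according to `μ`. -/
theorem lintegral_lintegral_sub [SFinite μ] {Φ : Euc n → Euc n → ℝ≥0∞}
    (hΦ : Measurable (Function.uncurry Φ)) :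
    ∫⁻ x, ∫⁻ z, Φ (x - z) z ∂μ = ∫⁻ z, (∫⁻ w, Φ w z) ∂μ := by
  rw [lintegral_lintegral_swap]
  · refine lintegral_congr fun z => ?_
    exact lintegral_sub_right_eq_self (fun w => Φ w z) z
  · refine Measurable.aemeasurable ?_
    exact hΦ.comp (f := fun p : Euc n × Euc n => (p.1 - p.2, p.2)) (by fun_prop)

theorem lintegral_mul_smooth [IsFiniteMeasure μ] (hη : 0 < η) {H : Euc n → ℝ≥0∞}
    (hH : Measurable H) :
    ∫⁻ x, H x * ENNReal.ofReal (smooth η μ x) =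
      ∫⁻ z, (∫⁻ w, H (z + w) * ENNReal.ofReal (gaussKernel η w)) ∂μ := by
  rw [← lintegral_lintegral_sub
    (Φ := fun w z => H (z + w) * ENNReal.ofReal (gaussKernel η w))]
  · refine lintegral_congr fun x => ?_
    rw [ofReal_smooth hη, ← lintegral_const_mul _ (by fun_prop)]
    simp
  · simp only [Function.uncurry_def]
    fun_prop

end smooth

theorem integrable_of_lintegral_ofReal_eq {Ω : Type*} [MeasurableSpace Ω] {ν : Measure Ω}
    {F : Ω → ℝ} {c : ℝ} (hF : AEStronglyMeasurable F ν) (h0 : ∀ x, 0 ≤ F x)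
    (h : ∫⁻ x, ENNReal.ofReal (F x) ∂ν = ENNReal.ofReal c) : Integrable F ν :=
  ⟨hF, by
    rw [hasFiniteIntegral_iff_ofReal (Filter.Eventually.of_forall h0), h]
    exact ENNReal.ofReal_lt_top⟩

theorem integral_eq_of_lintegral_ofReal_eq {Ω : Type*} [MeasurableSpace Ω] {ν : Measure Ω}
    {F : Ω → ℝ} {c : ℝ} (hF : AEStronglyMeasurable F ν) (h0 : ∀ x, 0 ≤ F x) (hc : 0 ≤ c)
    (h : ∫⁻ x, ENNReal.ofReal (F x) ∂ν = ENNReal.ofReal c) : ∫ x, F x ∂ν = c := by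
  rw [integral_eq_lintegral_of_nonneg_ae (Filter.Eventually.of_forall h0) hF, h,
    ENNReal.toReal_ofReal hc]

/-- The Laplace transform of `smooth η μ`. -/
def smoothLaplace {n : ℕ} (η : ℝ) (μ : Measure (Euc n)) (g : Euc n) : ℝ :=
  (∫ z, exp ⟪g, z⟫ ∂μ) * (exp (η * ‖g‖ ^ 2 / 2) * ∫ w : Euc n, gaussKernel η w)

section smoothLaplace

variable {n : ℕ} {η : ℝ} {μ : Measure (Euc n)}

theorem integral_gaussKernel_pos (hη : 0 < η) : 0 < ∫ w : Euc n, gaussKernel η w :=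
  integral_exp_pos (integrable_gaussKernel hη)

theorem smoothLaplace_pos [IsProbabilityMeasure μ] (hμ : TiltsWellDefined μ) (hη : 0 < η)
    (g : Euc n) : 0 < smoothLaplace η μ g :=
  mul_pos (integral_exp_pos (hμ g)) (mul_pos (exp_pos _) (integral_gaussKernel_pos hη))

theorem lintegral_exp_mul_smooth [IsProbabilityMeasure μ] (hμ : TiltsWellDefined μ) (hη : 0 < η)
    (g : Euc n) :
    ∫⁻ x, ENNReal.ofReal (exp ⟪g, x⟫ * smooth η μ x) = ENNReal.ofReal (smoothLaplace η μ g) := by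
  have hN := integral_gaussKernel_pos (n := n) hη
  simp_rw [ENNReal.ofReal_mul (exp_pos _).le]
  rw [lintegral_mul_smooth hη (by fun_prop)]
  have hin : ∀ z, ∫⁻ w, ENNReal.ofReal (exp ⟪g, z + w⟫) * ENNReal.ofReal (gaussKernel η w) =
      ENNReal.ofReal (exp ⟪g, z⟫) *
        ENNReal.ofReal (exp (η * ‖g‖ ^ 2 / 2) * ∫ w : Euc n, gaussKernel η w) := by
    intro z
    simp_rw [← ENNReal.ofReal_mul (exp_pos _).le, exp_inner_add_mul_gaussKernel hη]
    simp_rw [ENNReal.ofReal_mul (mul_nonneg (exp_pos _).le (exp_pos _).le)]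
    rw [lintegral_const_mul _ (by fun_prop),
      lintegral_sub_right_eq_self (fun w : Euc n => ENNReal.ofReal (gaussKernel η w)),
      ← ofReal_integral_eq_lintegral_ofReal (integrable_gaussKernel hη)
        (Filter.Eventually.of_forall fun _ => (gaussKernel_pos _).le),
      ← ENNReal.ofReal_mul (by positivity)]
    congr 1
    ring
  simp_rw [hin]
  rw [lintegral_mul_const _ (by fun_prop), ← ofReal_integral_eq_lintegral_ofReal (hμ g)
    (Filter.Eventually.of_forall fun _ => (exp_pos _).le),
    ← ENNReal.ofReal_mul (integral_exp_pos (hμ g)).le]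
  rfl

theorem integrable_exp_mul_smooth [IsProbabilityMeasure μ] (hμ : TiltsWellDefined μ) (hη : 0 < η)
    (g : Euc n) : Integrable (fun x => exp ⟪g, x⟫ * smooth η μ x) := by
  have := continuous_smooth (μ := μ) hη
  exact integrable_of_lintegral_ofReal_eq (by fun_prop)
    (fun x => mul_nonneg (exp_pos _).le (smooth_pos hη x).le) (lintegral_exp_mul_smooth hμ hη g)

theorem integral_exp_mul_smooth [IsProbabilityMeasure μ] (hμ : TiltsWellDefined μ) (hη : 0 < η)
    (g : Euc n) : ∫ x, exp ⟪g, x⟫ * smooth η μ x = smoothLaplace η μ g := by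
  have := continuous_smooth (μ := μ) hη
  exact integral_eq_of_lintegral_ofReal_eq (by fun_prop)
    (fun x => mul_nonneg (exp_pos _).le (smooth_pos hη x).le) (smoothLaplace_pos hμ hη g).le
    (lintegral_exp_mul_smooth hμ hη g)

/-- The barycenter of the tilt by `g` of the probability measure with density proportional to
`smooth η μ`. -/
def smoothBary {n : ℕ} (η : ℝ) (μ : Measure (Euc n)) (g : Euc n) : Euc n :=
  bary (tilt μ g) + η • g

theorem exp_mul_smoothLaplace_add_le (hμ : IsTiltStableLogConcave μ) (hη : 0 < η) (hη1 : η ≤ 1)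
    (g : Euc n) {u : Euc n} (hu : ‖u‖ = 1) :
    exp (-⟪u, smoothBary η μ g⟫) * smoothLaplace η μ (g + u) ≤ exp 1 * smoothLaplace η μ g := by
  have := hμ.prob
  have hN := integral_gaussKernel_pos (n := n) hη
  have hL := integral_exp_pos (hμ.tilts g)
  have h1 : ∫ x, exp ⟪u, x⟫ ∂(tilt μ g) ≤ exp (⟪u, bary (tilt μ g)⟫ + 1 / 2) := by
    have := (hμ.tilt g).integral_exp_inner_sub_bary_le u
    simp_rw [inner_sub_right, exp_sub, integral_div, hu] at this
    rw [div_le_iff₀ (exp_pos _), ← exp_add] at this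
    refine this.trans_eq ?_
    ring_nf
  rw [smoothLaplace, smoothLaplace, hμ.tilts.laplace_add]
  calc _ ≤ exp (-⟪u, smoothBary η μ g⟫) * ((∫ z, exp ⟪g, z⟫ ∂μ) *
          exp (⟪u, bary (tilt μ g)⟫ + 1 / 2) *
          (exp (η * ‖g + u‖ ^ 2 / 2) * ∫ w : Euc n, gaussKernel η w)) := by gcongr
    _ = exp (-⟪u, smoothBary η μ g⟫ + (⟪u, bary (tilt μ g)⟫ + 1 / 2) + η * ‖g + u‖ ^ 2 / 2) *
          ((∫ z, exp ⟪g, z⟫ ∂μ) * ∫ w : Euc n, gaussKernel η w) := by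
        rw [exp_add _ (η * ‖g + u‖ ^ 2 / 2), exp_add (-⟪u, smoothBary η μ g⟫)]; ring
    _ ≤ exp (1 + η * ‖g‖ ^ 2 / 2) *
          ((∫ z, exp ⟪g, z⟫ ∂μ) * ∫ w : Euc n, gaussKernel η w) := by
        refine mul_le_mul_of_nonneg_right (exp_le_exp.2 ?_) (by positivity)
        rw [smoothBary, inner_add_right, inner_smul_right, norm_add_sq_real, hu,
          real_inner_comm g u]
        linarith
    _ = _ := by rw [exp_add]; ring

theorem integrable_inner_sq_mul_exp_mul_smooth [IsProbabilityMeasure μ] (hμ : TiltsWellDefined μ)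
    (hη : 0 < η) (g a θ : Euc n) :
    Integrable (fun x => ⟪x - a, θ⟫ ^ 2 * (exp ⟪g, x⟫ * smooth η μ x)) := by
  have := continuous_smooth (μ := μ) hη
  refine (((integrable_exp_mul_smooth hμ hη (g + θ)).const_mul (exp (-⟪θ, a⟫))).add
    ((integrable_exp_mul_smooth hμ hη (g - θ)).const_mul (exp ⟪θ, a⟫))).mono' (by fun_prop)
    (Filter.Eventually.of_forall fun x => ?_)
  have hp := smooth_pos (μ := μ) hη x
  rw [norm_of_nonneg (by positivity)]
  have := two_add_sq_le_exp_add_exp_neg ⟪x - a, θ⟫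
  calc _ ≤ (exp ⟪x - a, θ⟫ + exp (-⟪x - a, θ⟫)) * (exp ⟪g, x⟫ * smooth η μ x) := by
        gcongr
        linarith
    _ = _ := by
        simp only [Pi.add_apply]
        rw [add_mul, ← mul_assoc, ← mul_assoc, ← mul_assoc, ← mul_assoc, ← exp_add, ← exp_add,
          ← exp_add, ← exp_add, inner_sub_left, inner_add_left, inner_sub_left,
          real_inner_comm x θ, real_inner_comm a θ]
        ring_nf

theorem integral_inner_sq_mul_exp_mul_smooth_le (hμ : IsTiltStableLogConcave μ) (hη : 0 < η)
    (hη1 : η ≤ 1) (g : Euc n) {θ : Euc n} (hθ : ‖θ‖ = 1) :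
    ∫ x, ⟪x - smoothBary η μ g, θ⟫ ^ 2 * (exp ⟪g, x⟫ * smooth η μ x) ≤
      2 * exp 1 * smoothLaplace η μ g := by
  have := hμ.prob
  set a := smoothBary η μ g
  have i1 := (integrable_exp_mul_smooth hμ.tilts hη (g + θ)).const_mul (exp (-⟪θ, a⟫))
  have i2 := (integrable_exp_mul_smooth hμ.tilts hη (g + -θ)).const_mul (exp (-⟪-θ, a⟫))
  have h1 := exp_mul_smoothLaplace_add_le hμ hη hη1 g hθ
  have h2 := exp_mul_smoothLaplace_add_le hμ hη hη1 g (u := -θ) (by rwa [norm_neg])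
  calc _ ≤ ∫ x, (exp (-⟪θ, a⟫) * (exp ⟪g + θ, x⟫ * smooth η μ x) +
          exp (-⟪-θ, a⟫) * (exp ⟪g + -θ, x⟫ * smooth η μ x)) := by
        refine integral_mono (integrable_inner_sq_mul_exp_mul_smooth hμ.tilts hη g a θ)
          (i1.add i2) fun x => ?_
        have hp := smooth_pos (μ := μ) hη x
        have := two_add_sq_le_exp_add_exp_neg ⟪x - a, θ⟫
        calc _ ≤ (exp ⟪x - a, θ⟫ + exp (-⟪x - a, θ⟫)) * (exp ⟪g, x⟫ * smooth η μ x) := by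
              gcongr
              linarith
          _ = _ := by
              rw [add_mul, ← mul_assoc, ← mul_assoc, ← mul_assoc, ← mul_assoc, ← exp_add,
                ← exp_add, ← exp_add, ← exp_add, inner_sub_left, inner_add_left, inner_add_left,
                inner_neg_left, inner_neg_left, real_inner_comm x θ, real_inner_comm a θ]
              ring_nf
    _ ≤ _ := by
        rw [integral_add i1 i2, integral_const_mul, integral_const_mul,
          integral_exp_mul_smooth hμ.tilts hη, integral_exp_mul_smooth hμ.tilts hη]
        linarith

/-- The part of `smooth η μ x` coming from `z` and `x - z` within distance `r` of the barycenters
of the tilts by `g` of `μ` and of the Gaussian. -/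
def smoothCore {n : ℕ} (η r : ℝ) (μ : Measure (Euc n)) (g x : Euc n) : ℝ :=
  ∫ z in {z | ‖z - bary (tilt μ g)‖ ≤ r ∧ ‖x - z - η • g‖ ≤ r}, gaussKernel η (x - z) ∂μ

theorem measurableSet_core {r : ℝ} (b c x : Euc n) :
    MeasurableSet {z : Euc n | ‖z - b‖ ≤ r ∧ ‖x - z - c‖ ≤ r} :=
  (measurableSet_le (f := fun z : Euc n => ‖z - b‖) (by fun_prop) measurable_const).inter
    (measurableSet_le (f := fun z : Euc n => ‖x - z - c‖) (by fun_prop) measurable_const)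

theorem smoothCore_nonneg (r : ℝ) (g x : Euc n) : 0 ≤ smoothCore η r μ g x :=
  integral_nonneg fun _ => (gaussKernel_pos _).le

theorem smoothCore_eq_integral (r : ℝ) (g x : Euc n) :
    smoothCore η r μ g x = ∫ z, {z | ‖z - bary (tilt μ g)‖ ≤ r}.indicator 1 z *
      ({w | ‖w - η • g‖ ≤ r}.indicator (gaussKernel η) (x - z)) ∂μ := by
  rw [smoothCore, ← integral_indicator (measurableSet_core _ _ _)]
  refine integral_congr_ae (Filter.Eventually.of_forall fun z => ?_)
  by_cases h1 : ‖z - bary (tilt μ g)‖ ≤ r <;> by_cases h2 : ‖x - z - η • g‖ ≤ r <;>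
    simp [Set.indicator, h1, h2]

theorem lintegral_exp_mul_smoothCore [IsProbabilityMeasure μ] (hμ : TiltsWellDefined μ)
    (hη : 0 < η) (r : ℝ) (g : Euc n) :
    ∫⁻ x, ENNReal.ofReal (exp ⟪g, x⟫ * smoothCore η r μ g x) =
      ENNReal.ofReal ((∫ z in {z | ‖z - bary (tilt μ g)‖ ≤ r}, exp ⟪g, z⟫ ∂μ) *
        (exp (η * ‖g‖ ^ 2 / 2) * ∫ w in {w : Euc n | ‖w‖ ≤ r}, gaussKernel η w)) := by
  set S : Set (Euc n) := {z | ‖z - bary (tilt μ g)‖ ≤ r}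
  set U : Set (Euc n) := {w | ‖w - η • g‖ ≤ r}
  set W : Set (Euc n) := {w | ‖w‖ ≤ r}
  have hS : MeasurableSet S := measurableSet_le (by fun_prop) measurable_const
  have hU : MeasurableSet U := measurableSet_le (by fun_prop) measurable_const
  have hW : MeasurableSet W := measurableSet_le (by fun_prop) measurable_const
  have hk : Measurable (gaussKernel η : Euc n → ℝ) := continuous_gaussKernel.measurable
  have m1 : Measurable (S.indicator (1 : Euc n → ℝ)) := measurable_one.indicator hS
  have m2 : Measurable (U.indicator (gaussKernel η : Euc n → ℝ)) := hk.indicator hU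
  have m3 : Measurable (W.indicator (gaussKernel η : Euc n → ℝ)) := hk.indicator hW
  have n1 : ∀ z, 0 ≤ S.indicator (1 : Euc n → ℝ) z := fun z =>
    Set.indicator_nonneg (fun _ _ => zero_le_one) z
  have n2 : ∀ w, 0 ≤ U.indicator (gaussKernel η : Euc n → ℝ) w := fun w =>
    Set.indicator_nonneg (fun _ _ => (gaussKernel_pos _).le) w
  have n3 : ∀ w, 0 ≤ W.indicator (gaussKernel η : Euc n → ℝ) w := fun w =>
    Set.indicator_nonneg (fun _ _ => (gaussKernel_pos _).le) w
  have hshift : ∀ z w, exp ⟪g, z + w⟫ * (S.indicator (1 : Euc n → ℝ) z *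
      U.indicator (gaussKernel η) w) = S.indicator (fun z => exp ⟪g, z⟫) z *
      (exp (η * ‖g‖ ^ 2 / 2) * W.indicator (gaussKernel η) (w - η • g)) := by
    intro z w
    have := exp_inner_add_mul_gaussKernel hη g z w
    by_cases h1 : ‖z - bary (tilt μ g)‖ ≤ r <;> by_cases h2 : ‖w - η • g‖ ≤ r <;>
      simp [Set.indicator, S, U, W, h1, h2]
    rw [this]
    ring
  have n4 : ∀ z, 0 ≤ S.indicator (fun z => exp ⟪g, z⟫) z := fun z =>
    Set.indicator_nonneg (fun _ _ => (exp_pos _).le) z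
  have m4 : Measurable (S.indicator (fun z => exp ⟪g, z⟫)) :=
    Measurable.indicator (by fun_prop) hS
  calc _ = ∫⁻ x, ∫⁻ z, ENNReal.ofReal (exp ⟪g, z + (x - z)⟫ * (S.indicator (1 : Euc n → ℝ) z *
          U.indicator (gaussKernel η) (x - z))) ∂μ := by
        refine lintegral_congr fun x => ?_
        simp_rw [add_sub_cancel, ENNReal.ofReal_mul (exp_pos _).le]
        rw [lintegral_const_mul _ (by fun_prop), smoothCore_eq_integral,
          ofReal_integral_eq_lintegral_ofReal _
            (Filter.Eventually.of_forall fun z => mul_nonneg (n1 _) (n2 _))]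
        refine (integrable_gaussKernel_sub hη x).mono' (by fun_prop)
          (Filter.Eventually.of_forall fun z => ?_)
        rw [norm_of_nonneg (mul_nonneg (n1 _) (n2 _))]
        refine (mul_le_of_le_one_left (n2 _) ?_).trans ?_
        · exact Set.indicator_le_self' (fun _ _ => zero_le_one) z
        · exact Set.indicator_le_self' (fun _ _ => (gaussKernel_pos _).le) _
    _ = ∫⁻ z, (∫⁻ w, ENNReal.ofReal (exp ⟪g, z + w⟫ * (S.indicator (1 : Euc n → ℝ) z *
          U.indicator (gaussKernel η) w))) ∂μ := by
        refine lintegral_lintegral_sub (Φ := fun w z => ENNReal.ofReal (exp ⟪g, z + w⟫ *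
          (S.indicator (1 : Euc n → ℝ) z * U.indicator (gaussKernel η) w))) ?_
        simp only [Function.uncurry_def]
        fun_prop
    _ = ∫⁻ z, ENNReal.ofReal (S.indicator (fun z => exp ⟪g, z⟫) z) *
          ENNReal.ofReal (exp (η * ‖g‖ ^ 2 / 2) * ∫ w in W, gaussKernel η w) ∂μ := by
        refine lintegral_congr fun z => ?_
        simp_rw [hshift, ENNReal.ofReal_mul (n4 z), ENNReal.ofReal_mul (exp_pos _).le]
        rw [lintegral_const_mul _ (by fun_prop), lintegral_const_mul _ (by fun_prop),
          lintegral_sub_right_eq_self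
            (fun w : Euc n => ENNReal.ofReal (W.indicator (gaussKernel η) w)),
          ← ofReal_integral_eq_lintegral_ofReal ((integrable_gaussKernel hη).indicator hW)
            (Filter.Eventually.of_forall n3), integral_indicator hW]
    _ = _ := by
        rw [lintegral_mul_const _ (by fun_prop), ← ofReal_integral_eq_lintegral_ofReal
          ((hμ g).indicator hS) (Filter.Eventually.of_forall n4), integral_indicator hS,
          ← ENNReal.ofReal_mul (integral_nonneg fun _ => (exp_pos _).le)]

theorem measurable_smoothCore [IsProbabilityMeasure μ] (r : ℝ) (g : Euc n) :
    Measurable (smoothCore η r μ g) := by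
  have hS : MeasurableSet {z : Euc n | ‖z - bary (tilt μ g)‖ ≤ r} :=
    measurableSet_le (by fun_prop) measurable_const
  have hU : MeasurableSet {w : Euc n | ‖w - η • g‖ ≤ r} :=
    measurableSet_le (by fun_prop) measurable_const
  have hk : Measurable (gaussKernel η : Euc n → ℝ) := continuous_gaussKernel.measurable
  have m1 := (measurable_one (α := ℝ)).indicator hS
  have m2 := hk.indicator hU
  rw [show smoothCore η r μ g = fun x => _ from funext fun x => smoothCore_eq_integral r g x]
  refine (StronglyMeasurable.integral_prod_right (f := fun x z =>
    {z : Euc n | ‖z - bary (tilt μ g)‖ ≤ r}.indicator (1 : Euc n → ℝ) z *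
      ({w | ‖w - η • g‖ ≤ r}.indicator (gaussKernel η) (x - z))) (ν := μ) ?_).measurable
  refine Measurable.stronglyMeasurable ?_
  simp only [Function.uncurry_def]
  fun_prop

theorem le_integral_exp_mul_smoothCore (hμ : IsTiltStableLogConcave μ) (hη : 0 < η) {r : ℝ}
    (hr0 : 0 < r) (hr : 4 * n ≤ r ^ 2)
    (hrN : 3 / 4 * ∫ w : Euc n, gaussKernel η w ≤ ∫ w in {w : Euc n | ‖w‖ ≤ r}, gaussKernel η w)
    (g : Euc n) :
    9 / 16 * smoothLaplace η μ g ≤ ∫ x, exp ⟪g, x⟫ * smoothCore η r μ g x := by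
  have := hμ.prob
  have hL := integral_exp_pos (hμ.tilts g)
  have hN := integral_gaussKernel_pos (n := n) hη
  have := measurable_smoothCore (η := η) (μ := μ) r g
  rw [integral_eq_of_lintegral_ofReal_eq (by fun_prop)
    (fun x => mul_nonneg (exp_pos _).le (smoothCore_nonneg r g x))
    (mul_nonneg (integral_nonneg fun _ => (exp_pos _).le)
      (mul_nonneg (exp_pos _).le (integral_nonneg fun _ => (gaussKernel_pos _).le)))
    (lintegral_exp_mul_smoothCore hμ.tilts hη r g), smoothLaplace]
  have hS : MeasurableSet {z : Euc n | ‖z - bary (tilt μ g)‖ ≤ r} :=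
    measurableSet_le (by fun_prop) measurable_const
  have h1 : 3 / 4 * ∫ z, exp ⟪g, z⟫ ∂μ ≤
      ∫ z in {z | ‖z - bary (tilt μ g)‖ ≤ r}, exp ⟪g, z⟫ ∂μ := by
    have ht := hμ.tilt g
    have := ht.prob
    have h2 := ht.integral_norm_sub_bary_sq_le
    have i1 : Integrable ({z | ‖z - bary (tilt μ g)‖ ≤ r}.indicator (1 : Euc n → ℝ)) (tilt μ g) :=
      (integrable_const (1 : ℝ)).indicator hS
    have h3 : ∫ x, (1 - {z | ‖z - bary (tilt μ g)‖ ≤ r}.indicator (1 : Euc n → ℝ) x) ∂(tilt μ g) ≤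
        ∫ x, ‖x - bary (tilt μ g)‖ ^ 2 / r ^ 2 ∂(tilt μ g) := by
      refine integral_mono ((integrable_const _).sub i1)
        ((ht.integrable_norm_sub_sq _).div_const _) fun x => ?_
      by_cases h : ‖x - bary (tilt μ g)‖ ≤ r
      · simp only [Set.indicator, Set.mem_ofPred_eq, h, if_true, Pi.one_apply, sub_self]
        positivity
      · simp only [Set.indicator, Set.mem_ofPred_eq, h, if_false, sub_zero]
        rw [le_div_iff₀ (by positivity), one_mul]
        exact pow_le_pow_left₀ hr0.le (not_le.1 h).le 2
    rw [integral_sub (integrable_const _) i1,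
      integral_div] at h3
    have h4 : (∫ x, ‖x - bary (tilt μ g)‖ ^ 2 ∂(tilt μ g)) / r ^ 2 ≤ 1 / 4 := by
      rw [div_le_iff₀ (by positivity)]
      linarith
    have h5 : ∫ x, {z | ‖z - bary (tilt μ g)‖ ≤ r}.indicator (1 : Euc n → ℝ) x ∂(tilt μ g) =
        (∫ z in {z | ‖z - bary (tilt μ g)‖ ≤ r}, exp ⟪g, z⟫ ∂μ) / ∫ z, exp ⟪g, z⟫ ∂μ := by
      generalize bary (tilt μ g) = b at hS ⊢
      rw [tilt_eq_tilted hμ.tilts, integral_tilted, ← integral_indicator hS, ← integral_div]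
      refine integral_congr_ae (Filter.Eventually.of_forall fun x => ?_)
      by_cases h : ‖x - b‖ ≤ r <;> simp [Set.indicator, h]
    rw [h5] at h3
    simp only [integral_const, probReal_univ, smul_eq_mul, mul_one] at h3
    have h6 : 3 / 4 ≤ (∫ z in {z | ‖z - bary (tilt μ g)‖ ≤ r}, exp ⟪g, z⟫ ∂μ) /
      ∫ z, exp ⟪g, z⟫ ∂μ := by linarith
    rwa [le_div_iff₀ hL] at h6
  calc _ = (3 / 4 * ∫ z, exp ⟪g, z⟫ ∂μ) *
        (exp (η * ‖g‖ ^ 2 / 2) * (3 / 4 * ∫ w : Euc n, gaussKernel η w)) := by ring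
    _ ≤ _ := by gcongr

theorem exists_radius (hη : 0 < η) : ∃ r : ℝ, 0 < r ∧ 4 * n ≤ r ^ 2 ∧
    3 / 4 * ∫ w : Euc n, gaussKernel η w ≤ ∫ w in {w : Euc n | ‖w‖ ≤ r}, gaussKernel η w := by
  have hN := integral_gaussKernel_pos (n := n) hη
  have hlim : Filter.Tendsto (fun r : ℝ => ∫ w in {w : Euc n | ‖w‖ ≤ r}, gaussKernel η w)
      Filter.atTop (nhds (∫ w : Euc n, gaussKernel η w)) := by
    have := tendsto_setIntegral_of_monotone (μ := volume) (f := (gaussKernel η : Euc n → ℝ))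
      (s := fun r : ℝ => {w : Euc n | ‖w‖ ≤ r})
      (fun r => measurableSet_le (by fun_prop) measurable_const)
      (fun r r' h x hx => le_trans hx h) (integrable_gaussKernel hη).integrableOn
    have hU : ⋃ r : ℝ, {w : Euc n | ‖w‖ ≤ r} = Set.univ := by
      ext x
      simpa using ⟨‖x‖, le_rfl⟩
    rwa [hU, setIntegral_univ] at this
  have h1 := hlim.eventually (eventually_ge_nhds (b := 3 / 4 * ∫ w : Euc n, gaussKernel η w)
    (by linarith))
  obtain ⟨r, h1, h2, h3⟩ := (h1.and ((Filter.eventually_ge_atTop (4 * n : ℝ)).and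
    (Filter.eventually_ge_atTop (1 : ℝ)))).exists
  exact ⟨r, by linarith, by nlinarith, h1⟩

end smoothLaplace

theorem sq_div_four_le_exp_sub {v : ℝ} (hv : -2 ≤ v) : v ^ 2 / 4 ≤ exp v - 1 - v := by
  have h1 := add_one_le_exp (v / 2)
  have h2 : exp v = exp (v / 2) ^ 2 := by rw [← exp_nat_mul]; congr 1; push_cast; ring
  rw [h2]
  nlinarith

theorem sub_one_sub_mul_exp_le {l M Q T D R R' C₁ C₂ t : ℝ} (hl : 8 ≤ l) (hM : 1 ≤ M) (hQ : 1 ≤ Q)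
    (hT : T = l * M * Q) (hC₁ : 16 * C₁ ≤ M) (hC₂ : 2 * C₂ ≤ M)
    (hR : R ≤ C₂ * T) (hR' : R' ^ 2 ≤ C₁ * T)
    (hD : t * (D - T) ≤ |t| * R') (hv : -2 ≤ M * (l * t)) :
    Q - 1 - Q * exp (M * (l * t)) ≤ -t * D - t ^ 2 * R / 2 := by
  have h1 := mul_le_mul_of_nonneg_left (sq_div_four_le_exp_sub hv) (by linarith : (0 : ℝ) ≤ Q)
  have e1 : t * T = Q * (M * (l * t)) := by rw [hT]; ring
  have e2 : Q * ((M * (l * t)) ^ 2 / 4) = (M * t ^ 2 * T) * (l / 4) := by rw [hT]; ring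
  have hT0 : 0 < T := by rw [hT]; positivity
  have hX : 0 ≤ M * t ^ 2 * T := by positivity
  have h2 : 2 * (M * t ^ 2 * T) ≤ Q * ((M * (l * t)) ^ 2 / 4) := by
    rw [e2]; nlinarith
  have h3 : t ^ 2 * R ≤ M * t ^ 2 * T := by
    have : t ^ 2 * R ≤ t ^ 2 * (C₂ * T) := by gcongr
    have h4 : C₂ * (t ^ 2 * T) ≤ M * (t ^ 2 * T) := by
      gcongr
      linarith
    linarith
  have h4 : |t| * R' ≤ 1 + M * t ^ 2 * T := by
    have h5 : |t| * R' ≤ 1 + t ^ 2 * R' ^ 2 := by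
      nlinarith [sq_nonneg (|t| * R' - 1), sq_abs t, sq_nonneg (t * R'), sq_nonneg (|t| * R')]
    have h6 : t ^ 2 * R' ^ 2 ≤ t ^ 2 * (C₁ * T) := by gcongr
    have h7 : C₁ * (t ^ 2 * T) ≤ M * (t ^ 2 * T) := by
      gcongr
      linarith
    linarith
  nlinarith

theorem three_halves_mul_le {l M Q T D R R' C₁ C₂ : ℝ} (hl : 8 ≤ l) (hM : 1 ≤ M) (hQ : 1 ≤ Q)
    (hT : T = l * M * Q) (hC₁ : 16 * C₁ ≤ M) (hC₂ : 2 * C₂ ≤ M)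
    (hR : R ≤ C₂ * T) (hR' : R' ^ 2 ≤ C₁ * T) (hD : |D - T| ≤ R') :
    3 / 2 * Q ≤ -(-2 / (M * l)) * D - (-2 / (M * l)) ^ 2 * R / 2 := by
  have hM0 : 0 < M := by linarith
  have hl0 : 0 < l := by linarith
  set s := 2 / (M * l) with hs
  have hs0 : 0 < s := by positivity
  have e1 : s * T = 2 * Q := by rw [hT, hs]; field_simp
  have e2 : M * (s * T) * s = 4 * Q / l := by rw [hT, hs]; field_simp; ring
  have e3 : 4 * Q / l ≤ Q / 2 := by
    rw [div_le_div_iff₀ hl0 (by norm_num)]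
    nlinarith
  have hT0 : 0 < T := by rw [hT]; positivity
  have h3 : s ^ 2 * R ≤ Q / 4 := by
    have h4 : s ^ 2 * R ≤ s ^ 2 * (C₂ * T) := by gcongr
    have h5 : C₂ * (s ^ 2 * T) ≤ M / 2 * (s ^ 2 * T) := by
      gcongr
      linarith
    nlinarith
  have h4 : s * R' ≤ 1 / 4 + Q / 32 := by
    have h5 : s * R' ≤ 1 / 4 + s ^ 2 * R' ^ 2 := by nlinarith [sq_nonneg (s * R' - 1 / 2)]
    have h6 : s ^ 2 * R' ^ 2 ≤ s ^ 2 * (C₁ * T) := by gcongr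
    have h7 : C₁ * (s ^ 2 * T) ≤ M / 16 * (s ^ 2 * T) := by
      gcongr
      linarith
    nlinarith
  have h5 : s * (T - D) ≤ s * R' := by
    gcongr
    linarith [neg_le_of_abs_le hD]
  have e4 : -2 / (M * l) = -s := by rw [hs]; ring
  rw [e4]
  nlinarith

section

variable {n : ℕ} {η : ℝ} {μ : Measure (Euc n)}

theorem one_le_laplace [IsProbabilityMeasure μ] (hμ : TiltsWellDefined μ) (hb : bary μ = 0)
    (g : Euc n) : 1 ≤ ∫ x, exp ⟪g, x⟫ ∂μ := by
  have := hμ.le_laplace g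
  rwa [hb, inner_zero_right, exp_zero] at this

theorem norm_bary_tilt_sq_le (hμ : IsTiltStableLogConcave μ) (hb : bary μ = 0) (g : Euc n) :
    ‖bary (tilt μ g)‖ ^ 2 / 2 ≤ ⟪bary (tilt μ g), g⟫ := by
  have := hμ.prob
  have := (hμ.tilt g).prob
  set b := bary (tilt μ g) with hbd
  have hL := integral_exp_pos (hμ.tilts g)
  have h1 : exp (‖b‖ ^ 2 / 2) ≤ ∫ x, exp ⟪g, x⟫ ∂μ := by
    have h2 := one_le_laplace hμ.tilts hb (g + -b)
    rw [hμ.tilts.laplace_add] at h2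
    have h3 := (hμ.tilt g).integral_exp_inner_sub_bary_le (-b)
    simp_rw [inner_sub_right, exp_sub, integral_div, ← hbd] at h3
    rw [div_le_iff₀ (exp_pos _), ← exp_add, norm_neg, inner_neg_left,
      real_inner_self_eq_norm_sq] at h3
    have h4 : 1 ≤ (∫ x, exp ⟪g, x⟫ ∂μ) * exp (-(‖b‖ ^ 2 / 2)) := by
      refine h2.trans ?_
      gcongr
      refine h3.trans_eq ?_
      ring_nf
    rwa [exp_neg, ← div_eq_mul_inv, one_le_div (exp_pos _)] at h4
  have h2 : ∫ x, exp ⟪g, x⟫ ∂μ ≤ exp ⟪b, g⟫ := by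
    have h3 := hμ.tilts.laplace_add g (-g)
    have h4 := (hμ.tilt g).tilts.le_laplace (-g)
    rw [← hbd, inner_neg_left, real_inner_comm, exp_neg] at h4
    rw [add_neg_cancel] at h3
    simp only [inner_zero_left, exp_zero, integral_const, probReal_univ, smul_eq_mul,
      mul_one] at h3
    have h5 : (∫ x, exp ⟪g, x⟫ ∂μ) * (exp ⟪b, g⟫)⁻¹ ≤ 1 := by
      rw [h3]
      gcongr
    rwa [← div_eq_mul_inv, div_le_one (exp_pos _)] at h5
  exact exp_le_exp.1 (h1.trans h2)

theorem exists_scale (hμ : IsTiltStableLogConcave μ) (hb : bary μ = 0) (hη : 0 < η) {A M : ℝ}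
    (hA : 0 < A) (hM : 0 < M) (h : Euc n) :
    ∃ l : ℝ, 8 ≤ l ∧
      ⟪smoothBary η μ (l⁻¹ • h), l⁻¹ • h⟫ ≤ l * M * (A * exp (M * l)) ∧
      (l = 8 ∨ ⟪smoothBary η μ (l⁻¹ • h), l⁻¹ • h⟫ = l * M * (A * exp (M * l))) := by
  have := hμ.prob
  set J : ℝ → ℝ := fun l => A * exp (M * l) + log (∫ x, exp ⟪l⁻¹ • h, x⟫ ∂μ) +
    η * ‖h‖ ^ 2 * (l⁻¹) ^ 2 / 2 with hJ
  have hderiv : ∀ l : ℝ, 0 < l → HasDerivAt J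
      ((l * M * (A * exp (M * l)) - ⟪smoothBary η μ (l⁻¹ • h), l⁻¹ • h⟫) / l) l := by
    intro l hl
    have d0 : HasDerivAt (fun l : ℝ => l⁻¹) (-(l ^ 2)⁻¹) l := hasDerivAt_inv hl.ne'
    have d1 : HasDerivAt (fun l => A * exp (M * l)) (A * (exp (M * l) * (M * 1))) l :=
      (((hasDerivAt_id l).const_mul M).exp).const_mul A
    have d2 : HasDerivAt (fun l' : ℝ => log (∫ x, exp ⟪l'⁻¹ • h, x⟫ ∂μ))
        (⟪h, bary (tilt μ (l⁻¹ • h))⟫ * -(l ^ 2)⁻¹) l := by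
      have d3 := HasDerivAt.comp_of_eq (x := l) (y := 0)
        (h := fun l' : ℝ => l'⁻¹ - l⁻¹)
        (hμ.tilts.hasDerivAt_log_laplace (l⁻¹ • h) h) (d0.sub_const _) (by simp)
      refine d3.congr_of_eventuallyEq (Filter.Eventually.of_forall fun l' => ?_)
      simp only [Function.comp]
      rw [← add_smul, add_sub_cancel]
    have d3 := ((d0.pow 2).const_mul (η * ‖h‖ ^ 2)).div_const 2
    refine ((d1.add d2).add d3).congr_deriv ?_
    rw [smoothBary, inner_add_left, inner_smul_right, real_inner_smul_left,
      real_inner_self_eq_norm_sq, norm_smul, norm_inv, norm_of_nonneg hl.le, real_inner_comm]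
    simp only [Nat.cast_ofNat, Nat.add_one_sub_one, pow_one]
    field_simp
    ring
  obtain ⟨Λ, hΛ8, hΛ⟩ : ∃ Λ : ℝ, 8 < Λ ∧ J 8 < A * exp (M * Λ) := by
    have ht : Filter.Tendsto (fun l : ℝ => A * exp (M * l)) Filter.atTop Filter.atTop :=
      (tendsto_exp_atTop.comp (Filter.tendsto_id.const_mul_atTop hM)).const_mul_atTop hA
    exact ((Filter.eventually_gt_atTop 8).and (ht.eventually_gt_atTop (J 8))).exists
  have hcont : ContinuousOn J (Set.Icc 8 Λ) := fun l hl =>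
    (hderiv l (by linarith [hl.1])).continuousAt.continuousWithinAt
  obtain ⟨l, hl, hmin⟩ := isCompact_Icc.exists_isMinOn ⟨8, by simp [hΛ8.le]⟩ hcont
  have hlΛ : l < Λ := by
    refine lt_of_le_of_ne hl.2 fun hc => ?_
    have h1 : J l ≤ J 8 := hmin (by simp [hΛ8.le])
    have h2 : 0 ≤ log (∫ x, exp ⟪l⁻¹ • h, x⟫ ∂μ) := log_nonneg (one_le_laplace hμ.tilts hb _)
    have h3 : 0 ≤ η * ‖h‖ ^ 2 * (l⁻¹) ^ 2 / 2 := by positivity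
    rw [← hc] at hΛ
    have : A * exp (M * l) ≤ J l := by simp only [hJ]; linarith
    linarith
  have hl0 : 0 < l := by linarith [hl.1]
  refine ⟨l, hl.1, ?_⟩
  rcases hl.1.eq_or_lt with h8 | h8
  · refine ⟨?_, Or.inl h8.symm⟩
    have d := (hderiv l hl0).hasDerivWithinAt (s := Set.Ioi l)
    rw [hasDerivWithinAt_iff_tendsto_slope' (by simp)] at d
    have h0 := ge_of_tendsto d (b := 0) ?_
    · have := (div_nonneg_iff.1 h0)
      rcases this with h | h
      · linarith [h.1]
      · linarith [h.2]
    · filter_upwards [Ioo_mem_nhdsGT hlΛ] with y hy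
      rw [slope_def_field]
      have : J l ≤ J y := hmin ⟨by linarith [hy.1], hy.2.le⟩
      exact div_nonneg (by linarith) (by linarith [hy.1])
  · have hloc : IsLocalMin J l := hmin.isLocalMin (Icc_mem_nhds h8 hlΛ)
    have := hloc.hasDerivAt_eq_zero (hderiv l hl0)
    rw [div_eq_zero_iff] at this
    have h1 : l * M * (A * exp (M * l)) - ⟪smoothBary η μ (l⁻¹ • h), l⁻¹ • h⟫ = 0 :=
      this.resolve_right hl0.ne'
    exact ⟨by linarith, Or.inr (by linarith)⟩

/-- On the core event, `⟪x, x - z⟫ / η` is close to its tilted mean and `‖x‖` is controlled. -/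
theorem abs_inner_div_sub_le (hμ : IsTiltStableLogConcave μ) (hb : bary μ = 0) (hη : 0 < η)
    (hη1 : η ≤ 1) {r T : ℝ} (hr : 0 < r) (hT : 1 ≤ T) {g x z : Euc n}
    (hS : ⟪smoothBary η μ g, g⟫ ≤ T) (hz : ‖z - bary (tilt μ g)‖ ≤ r)
    (hw : ‖x - z - η • g‖ ≤ r) :
    |⟪x, x - z⟫ / η - ⟪smoothBary η μ g, g⟫| ≤ √(24 * (r ^ 2 + r ^ 4) / η ^ 2 * T) ∧
      ‖x‖ ^ 2 / η ≤ (8 + 8 * r ^ 2) / η * T := by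
  set b := bary (tilt μ g)
  set a := smoothBary η μ g with ha
  have hab : a = b + η • g := rfl
  have hbS : ‖b‖ ^ 2 / 2 ≤ ⟪b, g⟫ := norm_bary_tilt_sq_le hμ hb g
  have hSe : ⟪a, g⟫ = ⟪b, g⟫ + η * ‖g‖ ^ 2 := by
    rw [hab, inner_add_left, real_inner_smul_left, real_inner_self_eq_norm_sq]
  have hg2 : ‖g‖ ^ 2 ≤ T / η := by
    rw [le_div_iff₀ hη]
    nlinarith [sq_nonneg ‖b‖]
  have ha2 : ‖a‖ ^ 2 ≤ 4 * T := by
    have h1 : ‖a‖ ≤ ‖b‖ + η * ‖g‖ := by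
      refine (norm_add_le _ _).trans_eq ?_
      rw [norm_smul, norm_of_nonneg hη.le]
    have h2 : ‖a‖ ^ 2 ≤ (‖b‖ + η * ‖g‖) ^ 2 := pow_le_pow_left₀ (norm_nonneg _) h1 2
    have h3 : η * (η * ‖g‖ ^ 2) ≤ 1 * (η * ‖g‖ ^ 2) := by gcongr
    nlinarith [sq_nonneg (‖b‖ - η * ‖g‖)]
  have hxa : ‖x - a‖ ≤ 2 * r := by
    have : x - a = (z - b) + (x - z - η • g) := by rw [hab]; abel
    rw [this]
    linarith [norm_add_le (z - b) (x - z - η • g)]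
  have hx : ‖x‖ ≤ ‖a‖ + 2 * r := by
    have := norm_add_le a (x - a)
    rw [add_sub_cancel] at this
    linarith
  constructor
  · refine abs_le_sqrt ?_
    have e : ⟪x, x - z⟫ / η - ⟪a, g⟫ = ⟪x - a, g⟫ + ⟪x, x - z - η • g⟫ / η := by
      rw [inner_sub_left, inner_sub_right x (x - z), inner_smul_right]
      field_simp
      ring
    have h1 : |⟪x, x - z⟫ / η - ⟪a, g⟫| ≤ 2 * r * ‖g‖ + ‖a‖ * r / η + 2 * r * r / η := by
      rw [e]
      refine (abs_add_le _ _).trans ?_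
      have h2 : |⟪x - a, g⟫| ≤ 2 * r * ‖g‖ := (abs_real_inner_le_norm _ _).trans (by gcongr)
      have h3 : |⟪x, x - z - η • g⟫ / η| ≤ (‖a‖ + 2 * r) * r / η := by
        rw [abs_div, abs_of_pos hη]
        gcongr
        exact (abs_real_inner_le_norm _ _).trans (by gcongr)
      refine (add_le_add h2 h3).trans_eq ?_
      ring
    rw [← sq_abs]
    refine (pow_le_pow_left₀ (abs_nonneg _) h1 2).trans ?_
    have h4 : (2 * r * ‖g‖ + ‖a‖ * r / η + 2 * r * r / η) ^ 2 ≤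
        3 * (4 * r ^ 2 * ‖g‖ ^ 2 + ‖a‖ ^ 2 * r ^ 2 / η ^ 2 + 4 * r ^ 4 / η ^ 2) := by
      have e1 : ‖a‖ ^ 2 * r ^ 2 / η ^ 2 = (‖a‖ * r / η) ^ 2 := by ring
      have e2 : 4 * r ^ 4 / η ^ 2 = (2 * r * r / η) ^ 2 := by ring
      rw [e1, e2]
      nlinarith [sq_nonneg (2 * r * ‖g‖ - ‖a‖ * r / η), sq_nonneg (2 * r * ‖g‖ - 2 * r * r / η),
        sq_nonneg (‖a‖ * r / η - 2 * r * r / η)]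
    refine h4.trans ?_
    have h5 : 4 * r ^ 2 * ‖g‖ ^ 2 ≤ 4 * r ^ 2 * (T / η ^ 2) := by
      gcongr
      refine hg2.trans ?_
      gcongr
      nlinarith
    have h6 : ‖a‖ ^ 2 * r ^ 2 / η ^ 2 ≤ (4 * T) * r ^ 2 / η ^ 2 := by gcongr
    have h7 : 4 * r ^ 4 / η ^ 2 ≤ 4 * r ^ 4 / η ^ 2 * T := le_mul_of_one_le_right (by positivity) hT
    calc _ ≤ 3 * (4 * r ^ 2 * (T / η ^ 2) + (4 * T) * r ^ 2 / η ^ 2 + 4 * r ^ 4 / η ^ 2 * T) := by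
          gcongr
      _ ≤ 24 * (r ^ 2 + r ^ 4) / η ^ 2 * T := by
          have : 0 ≤ r ^ 4 / η ^ 2 * T := by positivity
          linear_combination 12 * this
  · rw [div_mul_eq_mul_div]
    gcongr
    have h1 : ‖x‖ ^ 2 ≤ (‖a‖ + 2 * r) ^ 2 := pow_le_pow_left₀ (norm_nonneg _) hx 2
    nlinarith [sq_nonneg (‖a‖ - 2 * r), mul_nonneg (sq_nonneg r) (by linarith : 0 ≤ T - 1)]

end

section

variable {n : ℕ} {η : ℝ} {μ : Measure (Euc n)}

theorem exp_mul_smoothCore_le (hμ : IsTiltStableLogConcave μ) (hb : bary μ = 0) (hη : 0 < η)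
    (hη1 : η ≤ 1) {r A M l : ℝ} (hr : 0 < r) (hA : 1 ≤ A) (hM : 1 ≤ M)
    (hM₁ : 16 * (24 * (r ^ 2 + r ^ 4) / η ^ 2) ≤ M) (hM₂ : 2 * ((8 + 8 * r ^ 2) / η) ≤ M)
    (hA0 : exp (-(A / 2)) ≤ smooth η μ 0) {g : Euc n} (hl : 8 ≤ l)
    (hS : ⟪smoothBary η μ g, g⟫ ≤ l * M * (A * exp (M * l)))
    (hS' : l = 8 ∨ ⟪smoothBary η μ g, g⟫ = l * M * (A * exp (M * l))) {s : ℝ} (hs : 8 ≤ s)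
    (x : Euc n) :
    exp (A * exp (M * l) - 1) * smoothCore η r μ g x ≤
      exp (A * exp (M * s)) * smooth η μ ((s / l) • x) := by
  have := hμ.prob
  have hl0 : 0 < l := by linarith
  have hM0 : 0 < M := by linarith
  set Q := A * exp (M * l) with hQ
  set T := l * M * Q with hT
  set S := ⟪smoothBary η μ g, g⟫
  have hAQ : A ≤ Q := le_mul_of_one_le_right (by linarith) (one_le_exp (by positivity))
  have hQ1 : 1 ≤ Q := hA.trans hAQ
  have hT1 : 1 ≤ T := by
    have : 1 ≤ l * M := by nlinarith
    nlinarith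
  have hR' : √(24 * (r ^ 2 + r ^ 4) / η ^ 2 * T) ^ 2 ≤ 24 * (r ^ 2 + r ^ 4) / η ^ 2 * T :=
    (sq_sqrt (by positivity)).le
  set R' := √(24 * (r ^ 2 + r ^ 4) / η ^ 2 * T)
  have hest : ∀ z ∈ {z : Euc n | ‖z - bary (tilt μ g)‖ ≤ r ∧ ‖x - z - η • g‖ ≤ r},
      |⟪x, x - z⟫ / η - S| ≤ R' ∧ ‖x‖ ^ 2 / η ≤ (8 + 8 * r ^ 2) / η * T := fun z hz =>
    abs_inner_div_sub_le hμ hb hη hη1 hr hT1 hS hz.1 hz.2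
  by_cases hv : -2 ≤ M * (s - l)
  · set t := (s - l) / l with ht
    have hlt : l * t = s - l := by rw [ht]; field_simp
    have h1t : 1 + t = s / l := by rw [ht]; field_simp; ring
    have key := exp_mul_setIntegral_gaussKernel_le_smooth (μ := μ) hη
      (measurableSet_core (r := r) (bary (tilt μ g)) (η • g) x) (t := t)
      (κ := Q - 1 - Q * exp (M * (l * t))) fun z hz => by
        obtain ⟨h1, h2⟩ := hest z hz
        refine sub_one_sub_mul_exp_le hl hM hQ1 hT hM₁ hM₂ h2 hR' ?_ (by rwa [hlt])
        rcases hS' with h8 | h8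
        · have ht0 : 0 ≤ t := div_nonneg (by linarith) hl0.le
          rw [abs_of_nonneg ht0]
          gcongr
          linarith [le_of_abs_le h1]
        · rw [← h8]
          refine (le_abs_self _).trans ?_
          rw [abs_mul]
          gcongr
    rw [h1t, hlt] at key
    have e : A * exp (M * s) = Q * exp (M * (s - l)) := by
      rw [hQ, mul_assoc, ← exp_add]
      congr 2
      ring
    rw [e, ← div_le_iff₀' (exp_pos _), mul_div_right_comm, ← exp_sub]
    exact key
  · push Not at hv
    have hsl : s < l := by nlinarith
    have hST : S = T := hS'.resolve_left (by linarith)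
    set t := -2 / (M * l) with ht
    have key := exp_mul_setIntegral_gaussKernel_le_smooth (μ := μ) hη
      (measurableSet_core (r := r) (bary (tilt μ g)) (η • g) x) (t := t)
      (κ := 3 / 2 * Q) fun z hz => by
        obtain ⟨h1, h2⟩ := hest z hz
        exact three_halves_mul_le hl hM hQ1 hT hM₁ hM₂ h2 hR' (by rwa [← hST])
    change exp (3 / 2 * Q) * smoothCore η r μ g x ≤ _ at key
    have h0 := smoothCore_nonneg (η := η) (μ := μ) r g x
    have e1 : 1 + t = (l - 2 / M) / l := by rw [ht]; field_simp; ring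
    have hlM : s < l - 2 / M := by
      have : 2 / M < l - s := by
        rw [div_lt_iff₀ hM0]
        linarith
      linarith
    have ht0 : 0 < 1 + t := by rw [e1]; exact div_pos (by linarith) hl0
    have k1 : exp Q * smoothCore η r μ g x ≤ smooth η μ ((1 + t) • x) := by
      refine le_trans ?_ key
      gcongr
      linarith
    have k2 : exp Q * smoothCore η r μ g x ≤ smooth η μ 0 := by
      refine le_trans ?_ hA0
      have h3 : exp (3 / 2 * Q) * smoothCore η r μ g x ≤ 1 := key.trans (smooth_le_one hη _)
      have h4 : exp Q * smoothCore η r μ g x =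
          exp (-(Q / 2)) * (exp (3 / 2 * Q) * smoothCore η r μ g x) := by
        rw [← mul_assoc, ← exp_add]
        ring_nf
      rw [h4]
      calc _ ≤ exp (-(Q / 2)) * 1 := by gcongr
        _ ≤ _ := by
          rw [mul_one]
          gcongr
    set a := s / (l - 2 / M) with ha
    have ha0 : 0 ≤ a := div_nonneg (by linarith) (by linarith)
    have ha1 : a ≤ 1 := (div_le_one (by linarith)).2 hlM.le
    have k3 := min_smooth_le hμ.logConcave hη ha0 (sub_nonneg.2 ha1) (by ring) ((1 + t) • x) 0
    have e2 : a • (1 + t) • x + (1 - a) • (0 : Euc n) = (s / l) • x := by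
      rw [smul_zero, add_zero, smul_smul, e1, ha]
      congr 1
      have : l - 2 / M ≠ 0 := by linarith
      rw [div_mul_div_cancel₀ this]
    rw [e2] at k3
    calc _ ≤ exp Q * smoothCore η r μ g x := by
          gcongr
          linarith
      _ ≤ smooth η μ ((s / l) • x) := (le_min k1 k2).trans k3
      _ ≤ _ := le_mul_of_one_le_left (smooth_pos hη _).le
          (one_le_exp (by positivity))

/-- The regularization of `smooth η μ` by a fast growing cost of dilation. -/
def cutoff (η A M : ℝ) (μ : Measure (Euc n)) (y : Euc n) : ℝ :=
  ⨅ s : Set.Ici (8 : ℝ), exp (A * exp (M * s)) * smooth η μ ((s : ℝ) • y)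

variable {A M : ℝ}

theorem bddBelow_cutoff [IsProbabilityMeasure μ] (hη : 0 < η) (y : Euc n) :
    BddBelow (Set.range fun s : Set.Ici (8 : ℝ) =>
      exp (A * exp (M * s)) * smooth η μ ((s : ℝ) • y)) :=
  ⟨0, by
    rintro _ ⟨s, rfl⟩
    exact mul_nonneg (exp_pos _).le (smooth_pos hη _).le⟩

theorem cutoff_le [IsProbabilityMeasure μ] (hη : 0 < η) (y : Euc n) {s : ℝ} (hs : 8 ≤ s) :
    cutoff η A M μ y ≤ exp (A * exp (M * s)) * smooth η μ (s • y) :=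
  ciInf_le (bddBelow_cutoff hη y) (⟨s, hs⟩ : Set.Ici (8 : ℝ))

theorem le_cutoff {y : Euc n} {c : ℝ}
    (h : ∀ s, 8 ≤ s → c ≤ exp (A * exp (M * s)) * smooth η μ (s • y)) : c ≤ cutoff η A M μ y :=
  have : Nonempty (Set.Ici (8 : ℝ)) := ⟨⟨8, Set.mem_Ici.2 le_rfl⟩⟩
  le_ciInf fun s => h s s.2

theorem cutoff_nonneg [IsProbabilityMeasure μ] (hη : 0 < η) (y : Euc n) :
    0 ≤ cutoff η A M μ y :=
  le_cutoff fun _ _ => mul_nonneg (exp_pos _).le (smooth_pos hη _).le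

theorem measurable_cutoff [IsProbabilityMeasure μ] (hη : 0 < η) :
    Measurable (cutoff η A M μ) := by
  have hc := continuous_smooth (μ := μ) hη
  refine UpperSemicontinuous.measurable (upperSemicontinuous_ciInf (bddBelow_cutoff hη) fun s => ?_)
  exact Continuous.upperSemicontinuous (by fun_prop)

theorem cutoff_rpow_mul_le [IsProbabilityMeasure μ] (hμ : IsLogConcave μ) (hη : 0 < η) (x y : Euc n)
    {a b : ℝ} (ha : 0 ≤ a) (hb : 0 ≤ b) (hab : a + b = 1) :
    cutoff η A M μ x ^ a * cutoff η A M μ y ^ b ≤ cutoff η A M μ (a • x + b • y) := by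
  rcases ha.eq_or_lt with rfl | ha
  · obtain rfl : b = 1 := by linarith
    simp
  rcases hb.eq_or_lt with rfl | hb
  · obtain rfl : a = 1 := by linarith
    simp
  refine le_cutoff fun s hs => ?_
  have h1 := cutoff_le (A := A) (M := M) (μ := μ) hη x hs
  have h2 := cutoff_le (A := A) (M := M) (μ := μ) hη y hs
  have p1 := smooth_pos (μ := μ) hη (s • x)
  have p2 := smooth_pos (μ := μ) hη (s • y)
  have q1 := cutoff_nonneg (A := A) (M := M) (μ := μ) hη x
  have q2 := cutoff_nonneg (A := A) (M := M) (μ := μ) hη y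
  have e : s • (a • x + b • y) = a • s • x + b • s • y := by
    rw [smul_add, smul_comm s a, smul_comm s b]
  set c := exp (A * exp (M * s)) with hc
  have hc0 : 0 < c := exp_pos _
  calc _ ≤ (c * smooth η μ (s • x)) ^ a * (c * smooth η μ (s • y)) ^ b :=
        mul_le_mul (rpow_le_rpow q1 h1 ha.le) (rpow_le_rpow q2 h2 hb.le) (by positivity)
          (by positivity)
    _ = c * (smooth η μ (s • x) ^ a * smooth η μ (s • y) ^ b) := by
        rw [mul_rpow hc0.le p1.le, mul_rpow hc0.le p2.le]
        have : c ^ a * c ^ b = c := by rw [← rpow_add hc0, hab, rpow_one]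
        linear_combination (smooth η μ (s • x) ^ a * smooth η μ (s • y) ^ b) * this
    _ ≤ _ := by
        rw [e]
        gcongr
        exact smooth_rpow_mul_le hμ hη ha hb hab _ _

end

/-- The probability measure with density proportional to `q`. -/
def normalized {n : ℕ} (q : Euc n → ℝ) : Measure (Euc n) :=
  volume.withDensity fun y => ENNReal.ofReal (q y / ∫ x, q x)

section normalized

variable {n : ℕ} {q : Euc n → ℝ}

theorem integral_normalized (hm : Measurable q) (h0 : ∀ y, 0 ≤ q y) (F : Euc n → ℝ) :
    ∫ y, F y ∂(normalized q) = (∫ y, F y * q y) / ∫ y, q y := by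
  have hZ : 0 ≤ ∫ y, q y := integral_nonneg h0
  have := integral_withDensity_eq_integral_toReal_smul (μ := (volume : Measure (Euc n)))
    (f := fun y => ENNReal.ofReal (q y / ∫ x, q x)) (by fun_prop)
    (Filter.Eventually.of_forall fun _ => ENNReal.ofReal_lt_top) F
  rw [normalized, this, ← integral_div]
  refine integral_congr_ae (Filter.Eventually.of_forall fun y => ?_)
  simp only [smul_eq_mul]
  rw [ENNReal.toReal_ofReal (div_nonneg (h0 y) hZ)]
  ring

theorem integrable_normalized (hm : Measurable q) (h0 : ∀ y, 0 ≤ q y) {F : Euc n → ℝ}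
    (hF : Integrable fun y => F y * q y) : Integrable F (normalized q) := by
  have hZ : 0 ≤ ∫ y, q y := integral_nonneg h0
  rw [normalized, integrable_withDensity_iff_integrable_smul' (by fun_prop)
    (Filter.Eventually.of_forall fun _ => ENNReal.ofReal_lt_top)]
  refine (hF.div_const (∫ x, q x)).congr (Filter.Eventually.of_forall fun y => ?_)
  simp only [smul_eq_mul]
  rw [ENNReal.toReal_ofReal (div_nonneg (h0 y) hZ)]
  ring

theorem isProbabilityMeasure_normalized (h0 : ∀ y, 0 ≤ q y) (hi : Integrable q)
    (hZ : 0 < ∫ y, q y) : IsProbabilityMeasure (normalized q) := by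
  refine ⟨?_⟩
  rw [normalized, withDensity_apply _ MeasurableSet.univ, Measure.restrict_univ,
    ← ofReal_integral_eq_lintegral_ofReal (hi.div_const _)
    (Filter.Eventually.of_forall fun y => div_nonneg (h0 y) hZ.le), integral_div, div_self hZ.ne',
    ENNReal.ofReal_one]

theorem isLogConcave_normalized (hm : Measurable q) (h0 : ∀ y, 0 ≤ q y)
    (hq : ∀ x y : Euc n, ∀ a b : ℝ, 0 ≤ a → 0 ≤ b → a + b = 1 →
      q x ^ a * q y ^ b ≤ q (a • x + b • y)) (hZ : 0 < ∫ y, q y) :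
    IsLogConcave (normalized q) := by
  refine ⟨fun y => q y / ∫ x, q x, by fun_prop, fun y => div_nonneg (h0 y) hZ.le, ?_, rfl⟩
  intro x y a b ha hb hab
  rw [div_rpow (h0 x) hZ.le, div_rpow (h0 y) hZ.le, div_mul_div_comm, ← rpow_add hZ, hab, rpow_one]
  exact div_le_div_of_nonneg_right (hq x y a b ha hb hab) hZ.le

theorem lightTailed_normalized (hm : Measurable q) (h0 : ∀ y, 0 ≤ q y)
    (hl : ∀ s, Integrable fun y => exp (s * ‖y‖ ^ 2) * q y) : LightTailed (normalized q) :=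
  fun s => integrable_normalized hm h0 (hl s)

theorem variance_tilt_normalized_le (hm : Measurable q) (h0 : ∀ y, 0 ≤ q y) (hi : Integrable q)
    (hZ : 0 < ∫ y, q y) (ht : TiltsWellDefined (normalized q)) (h c θ : Euc n) :
    Var[fun x => ⟪x, θ⟫; tilt (normalized q) h] ≤
      (∫ y, ⟪y - c, θ⟫ ^ 2 * (exp ⟪h, y⟫ * q y)) / ∫ y, exp ⟪h, y⟫ * q y := by
  have := isProbabilityMeasure_normalized h0 hi hZ
  have := ht.isProbabilityMeasure_tilt h
  have e : (fun x : Euc n => ⟪x - c, θ⟫) = fun x => ⟪x, θ⟫ - ⟪c, θ⟫ := by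
    ext x
    rw [inner_sub_left]
  have h1 : Var[fun x => ⟪x - c, θ⟫; tilt (normalized q) h] ≤
      ∫ x, ⟪x - c, θ⟫ ^ 2 ∂(tilt (normalized q) h) :=
    variance_le_expectation_sq (by fun_prop)
  rw [e, variance_sub_const (by fun_prop)] at h1
  refine h1.trans_eq ?_
  rw [tilt_eq_tilted ht, integral_tilted, integral_normalized hm h0, integral_normalized hm h0]
  have e2 : ∀ y : Euc n, (exp ⟪h, y⟫ / ((∫ x, exp ⟪h, x⟫ * q x) / ∫ x, q x)) •
      ⟪y - c, θ⟫ ^ 2 * q y / (∫ x, q x) =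
      (⟪y - c, θ⟫ ^ 2 * (exp ⟪h, y⟫ * q y)) / ∫ x, exp ⟪h, x⟫ * q x := by
    intro y
    rw [smul_eq_mul]
    field_simp
  have h2 := integral_congr_ae (μ := volume) (Filter.Eventually.of_forall e2)
  rwa [integral_div, integral_div] at h2

end normalized

section

variable {n : ℕ} {η : ℝ} {μ : Measure (Euc n)}

theorem integrable_exp_sq_mul_smooth (hμ : IsTiltStableLogConcave μ) (hb : bary μ = 0)
    (hη : 0 < η) (hη1 : η ≤ 1) (hn : 0 < n) :
    Integrable (fun x => exp (1 / (8 * n) * ‖x‖ ^ 2) * smooth η μ x) := by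
  have := hμ.prob
  have hc := continuous_smooth (μ := μ) hη
  have hn' : (1 : ℝ) ≤ n := by exact_mod_cast hn
  have hn0 : (0 : ℝ) < n := by linarith
  refine ⟨by fun_prop, ?_⟩
  rw [hasFiniteIntegral_iff_ofReal (Filter.Eventually.of_forall fun x =>
    mul_nonneg (exp_pos _).le (smooth_pos hη x).le)]
  simp_rw [ENNReal.ofReal_mul (exp_pos _).le]
  rw [lintegral_mul_smooth hη (by fun_prop)]
  have hle : ∀ z w : Euc n, ENNReal.ofReal (exp (1 / (8 * n) * ‖z + w‖ ^ 2)) *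
      ENNReal.ofReal (gaussKernel η w) ≤ ENNReal.ofReal (exp (‖z - bary μ‖ ^ 2 / (4 * n))) *
        ENNReal.ofReal (exp (-(1 / 4) * ‖w‖ ^ 2)) := by
    intro z w
    rw [gaussKernel, ← ENNReal.ofReal_mul (exp_pos _).le, ← ENNReal.ofReal_mul (exp_pos _).le,
      ← exp_add, ← exp_add, hb, sub_zero]
    refine ENNReal.ofReal_le_ofReal (exp_le_exp.2 ?_)
    have h1 : ‖z + w‖ ^ 2 ≤ 2 * ‖z‖ ^ 2 + 2 * ‖w‖ ^ 2 := by
      have := pow_le_pow_left₀ (norm_nonneg _) (norm_add_le z w) 2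
      nlinarith [sq_nonneg (‖z‖ - ‖w‖)]
    have h2 : 1 / (8 * n) * ‖z + w‖ ^ 2 ≤ 1 / (8 * n) * (2 * ‖z‖ ^ 2 + 2 * ‖w‖ ^ 2) := by gcongr
    have h3 : 1 / (8 * n) * (2 * ‖w‖ ^ 2) ≤ 1 / 4 * ‖w‖ ^ 2 := by
      have : (1 : ℝ) / (8 * n) ≤ 1 / 8 := one_div_le_one_div_of_le (by norm_num) (by linarith)
      nlinarith [sq_nonneg ‖w‖]
    have h4 : ‖w‖ ^ 2 / 2 ≤ ‖w‖ ^ 2 / (2 * η) := by gcongr; linarith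
    have h5 : 1 / (8 * n) * (2 * ‖z‖ ^ 2) = ‖z‖ ^ 2 / (4 * n) := by field_simp; ring
    rw [neg_div]
    linarith
  refine lt_of_le_of_lt (lintegral_mono fun z => lintegral_mono fun w => hle z w) ?_
  simp_rw [lintegral_const_mul _ (show Measurable fun w : Euc n =>
    ENNReal.ofReal (exp (-(1 / 4) * ‖w‖ ^ 2)) by fun_prop)]
  rw [lintegral_mul_const _ (by fun_prop)]
  refine ENNReal.mul_lt_top ((hμ.lintegral_exp_norm_sq_le hn).trans_lt ENNReal.ofReal_lt_top) ?_
  have := (integrable_exp_neg_mul_norm_sq (n := n) (b := 1 / 4) (by norm_num)).hasFiniteIntegral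
  rwa [hasFiniteIntegral_iff_ofReal (Filter.Eventually.of_forall fun x => (exp_pos _).le)] at this

theorem integrable_exp_sq_mul_smooth_smul (hμ : IsTiltStableLogConcave μ) (hb : bary μ = 0)
    (hη : 0 < η) (hη1 : η ≤ 1) (hn : 0 < n) {s l : ℝ} (hl : 0 < l) (hs : s ≤ l ^ 2 / (8 * n)) :
    Integrable (fun y => exp (s * ‖y‖ ^ 2) * smooth η μ (l • y)) := by
  have := hμ.prob
  have hc := continuous_smooth (μ := μ) hη
  refine ((integrable_exp_sq_mul_smooth hμ hb hη hη1 hn).comp_smul hl.ne').mono' (by fun_prop)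
    (Filter.Eventually.of_forall fun y => ?_)
  have hp := smooth_pos (μ := μ) hη (l • y)
  rw [norm_of_nonneg (by positivity), norm_smul, norm_of_nonneg hl.le]
  refine mul_le_mul_of_nonneg_right (exp_le_exp.2 ?_) hp.le
  calc s * ‖y‖ ^ 2 ≤ l ^ 2 / (8 * n) * ‖y‖ ^ 2 := by gcongr
    _ = _ := by ring

variable {A M : ℝ}

theorem integrable_exp_sq_mul_cutoff (hμ : IsTiltStableLogConcave μ) (hb : bary μ = 0)
    (hη : 0 < η) (hη1 : η ≤ 1) (hn : 0 < n) (s : ℝ) :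
    Integrable (fun y => exp (s * ‖y‖ ^ 2) * cutoff η A M μ y) := by
  have := hμ.prob
  have hn0 : (0 : ℝ) < n := by exact_mod_cast hn
  have hm := measurable_cutoff (A := A) (M := M) (μ := μ) hη
  obtain ⟨l, hl8, hl⟩ : ∃ l : ℝ, 8 ≤ l ∧ s ≤ l ^ 2 / (8 * n) := by
    refine ⟨max 8 (8 * n * s), le_max_left _ _, ?_⟩
    rw [le_div_iff₀ (by positivity)]
    have h1 := le_max_left 8 (8 * n * s)
    have h2 := le_max_right 8 (8 * n * s)
    nlinarith
  refine ((integrable_exp_sq_mul_smooth_smul hμ hb hη hη1 hn (l := l) (by linarith) hl).const_mul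
    (exp (A * exp (M * l)))).mono' (by fun_prop) (Filter.Eventually.of_forall fun y => ?_)
  rw [norm_of_nonneg (mul_nonneg (exp_pos _).le (cutoff_nonneg hη y)), mul_left_comm]
  gcongr
  exact cutoff_le hη y hl8

end

section

variable {n : ℕ} {η A M : ℝ} {μ : Measure (Euc n)}

theorem integrable_exp_inner_mul_cutoff (hμ : IsTiltStableLogConcave μ) (hb : bary μ = 0)
    (hη : 0 < η) (hη1 : η ≤ 1) (hn : 0 < n) (h : Euc n) :
    Integrable (fun y => exp ⟪h, y⟫ * cutoff η A M μ y) := by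
  have := hμ.prob
  have hm := measurable_cutoff (A := A) (M := M) (μ := μ) hη
  refine ((integrable_exp_sq_mul_cutoff (A := A) (M := M) hμ hb hη hη1 hn 1).const_mul
    (exp (‖h‖ ^ 2))).mono' (by fun_prop) (Filter.Eventually.of_forall fun y => ?_)
  have h0 := cutoff_nonneg (A := A) (M := M) (μ := μ) hη y
  rw [norm_of_nonneg (by positivity), ← mul_assoc, ← exp_add]
  refine mul_le_mul_of_nonneg_right (exp_le_exp.2 ?_) h0
  have := real_inner_le_norm h y
  nlinarith [sq_nonneg (‖h‖ - ‖y‖), sq_nonneg (‖h‖), sq_nonneg (‖y‖)]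

theorem integral_cutoff_bounds (hμ : IsTiltStableLogConcave μ) (hb : bary μ = 0)
    (hη : 0 < η) (hη1 : η ≤ 1) (hn : 0 < n) {r : ℝ} (hr0 : 0 < r) (hr : 4 * n ≤ r ^ 2)
    (hrN : 3 / 4 * ∫ w : Euc n, gaussKernel η w ≤ ∫ w in {w : Euc n | ‖w‖ ≤ r}, gaussKernel η w)
    (hA : 1 ≤ A) (hM : 1 ≤ M) (hM₁ : 16 * (24 * (r ^ 2 + r ^ 4) / η ^ 2) ≤ M)
    (hM₂ : 2 * ((8 + 8 * r ^ 2) / η) ≤ M) (hA0 : exp (-(A / 2)) ≤ smooth η μ 0) (h : Euc n) :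
    (0 < ∫ y, exp ⟪h, y⟫ * cutoff η A M μ y) ∧ ∃ c : Euc n, ∀ θ : Euc n, ‖θ‖ = 1 →
      ∫ y, ⟪y - c, θ⟫ ^ 2 * (exp ⟪h, y⟫ * cutoff η A M μ y) ≤
        ∫ y, exp ⟪h, y⟫ * cutoff η A M μ y := by
  have := hμ.prob
  obtain ⟨l, hl, hS, hS'⟩ := exists_scale hμ hb hη (A := A) (M := M) (by linarith) (by linarith) h
  have hl0 : 0 < l := by linarith
  set g := l⁻¹ • h with hg
  set b := smoothBary η μ g
  set Q := A * exp (M * l)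
  have hF := smoothLaplace_pos hμ.tilts hη g
  set F := smoothLaplace η μ g
  have hgx : ∀ x : Euc n, ⟪h, l⁻¹ • x⟫ = ⟪g, x⟫ := fun x => by
    rw [hg, real_inner_smul_left, real_inner_smul_right]
  have hI := integrable_exp_inner_mul_cutoff (A := A) (M := M) hμ hb hη hη1 hn h
  set κ : ℝ := |((l⁻¹) ^ Module.finrank ℝ (Euc n))⁻¹|
  have hκ : 0 < κ := by positivity
  have hD : exp (Q - 1) * (9 / 16 * F) ≤ κ * ∫ y, exp ⟪h, y⟫ * cutoff η A M μ y := by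
    have h1 := Measure.integral_comp_smul volume
      (fun y : Euc n => exp ⟪h, y⟫ * cutoff η A M μ y) l⁻¹
    rw [smul_eq_mul] at h1
    rw [← h1]
    refine (mul_le_mul_of_nonneg_left (le_integral_exp_mul_smoothCore hμ hη hr0 hr hrN g)
      (exp_pos _).le).trans ?_
    rw [← integral_const_mul]
    refine integral_mono_of_nonneg (Filter.Eventually.of_forall fun x => ?_)
      (hI.comp_smul (inv_ne_zero hl0.ne')) (Filter.Eventually.of_forall fun x => ?_)
    · have := smoothCore_nonneg (η := η) (μ := μ) r g x
      simp only [Pi.zero_apply]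
      positivity
    · simp only [hgx]
      rw [mul_left_comm]
      refine mul_le_mul_of_nonneg_left (le_cutoff fun s hs => ?_) (exp_pos _).le
      rw [smul_smul, ← div_eq_mul_inv]
      exact exp_mul_smoothCore_le hμ hb hη hη1 hr0 hA hM hM₁ hM₂ hA0 hl hS hS' hs x
  refine ⟨pos_of_mul_pos_right (lt_of_lt_of_le (by positivity) hD) hκ.le, l⁻¹ • b, fun θ hθ => ?_⟩
  have hN : κ * ∫ y, ⟪y - l⁻¹ • b, θ⟫ ^ 2 * (exp ⟪h, y⟫ * cutoff η A M μ y) ≤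
      l⁻¹ ^ 2 * exp Q * (2 * exp 1 * F) := by
    have h1 := Measure.integral_comp_smul volume
      (fun y : Euc n => ⟪y - l⁻¹ • b, θ⟫ ^ 2 * (exp ⟪h, y⟫ * cutoff η A M μ y)) l⁻¹
    rw [smul_eq_mul] at h1
    rw [← h1]
    refine le_trans ?_ (mul_le_mul_of_nonneg_left
      (integral_inner_sq_mul_exp_mul_smooth_le hμ hη hη1 g hθ) (by positivity))
    rw [← integral_const_mul]
    refine integral_mono_of_nonneg (Filter.Eventually.of_forall fun x => ?_)
      ((integrable_inner_sq_mul_exp_mul_smooth hμ.tilts hη g _ θ).const_mul _)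
      (Filter.Eventually.of_forall fun x => ?_)
    · have := cutoff_nonneg (A := A) (M := M) (μ := μ) hη (l⁻¹ • x)
      simp only [Pi.zero_apply]
      positivity
    · have h2 := cutoff_le (A := A) (M := M) (μ := μ) hη (l⁻¹ • x) hl
      rw [smul_inv_smul₀ hl0.ne'] at h2
      simp only [hgx]
      rw [← smul_sub, real_inner_smul_left, mul_pow]
      calc _ ≤ l⁻¹ ^ 2 * ⟪x - b, θ⟫ ^ 2 * (exp ⟪g, x⟫ * (exp Q * smooth η μ x)) := by gcongr
        _ = _ := by ring
  have he : exp (1 : ℝ) < 2.7182818286 := exp_one_lt_d9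
  have he0 := exp_pos (1 : ℝ)
  have h3 : l⁻¹ ^ 2 * exp Q * (2 * exp 1 * F) ≤ exp (Q - 1) * (9 / 16 * F) := by
    have h4 : exp Q = exp (Q - 1) * exp 1 := by rw [← exp_add]; ring_nf
    have h5 : l⁻¹ ^ 2 ≤ 1 / 64 := by
      rw [inv_pow, inv_eq_one_div]
      exact one_div_le_one_div_of_le (by norm_num) (by nlinarith)
    have h6 : l⁻¹ ^ 2 * (exp 1 * (2 * exp 1)) ≤ 9 / 16 := by
      calc _ ≤ 1 / 64 * (exp 1 * (2 * exp 1)) := by gcongr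
        _ ≤ 9 / 16 := by nlinarith
    calc _ = l⁻¹ ^ 2 * (exp 1 * (2 * exp 1)) * (exp (Q - 1) * F) := by rw [h4]; ring
      _ ≤ 9 / 16 * (exp (Q - 1) * F) := by gcongr
      _ = _ := by ring
  exact le_of_mul_le_mul_left (hN.trans (h3.trans hD)) hκ

theorem exists_isTiltStableLogConcave_normalized_cutoff (hμ : IsTiltStableLogConcave μ)
    (hb : bary μ = 0) (hη : 0 < η) (hη1 : η ≤ 1) (hn : 0 < n) :
    ∃ M, 1 ≤ M ∧ ∃ A₀ : ℝ, ∀ A, A₀ ≤ A → (0 < ∫ y, cutoff η A M μ y) ∧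
      IsTiltStableLogConcave (normalized (cutoff η A M μ)) ∧
      LightTailed (normalized (cutoff η A M μ)) := by
  have := hμ.prob
  obtain ⟨r, hr0, hr, hrN⟩ := exists_radius (n := n) hη
  set M := max 1 (max (16 * (24 * (r ^ 2 + r ^ 4) / η ^ 2)) (2 * ((8 + 8 * r ^ 2) / η))) with hMd
  refine ⟨M, le_max_left _ _, max 1 (-2 * Real.log (smooth η μ 0)), fun A hA => ?_⟩
  have hA1 : 1 ≤ A := (le_max_left _ _).trans hA
  have hA0 : exp (-(A / 2)) ≤ smooth η μ 0 := by
    rw [← le_log_iff_exp_le (smooth_pos hη 0)]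
    have := (le_max_right _ _).trans hA
    linarith
  have key := integral_cutoff_bounds hμ hb hη hη1 hn hr0 hr hrN hA1 (le_max_left _ _)
    ((le_max_left _ _).trans (le_max_right _ _)) ((le_max_right _ _).trans (le_max_right _ _)) hA0
  rw [← hMd] at key
  have hZ : 0 < ∫ y, cutoff η A M μ y := by simpa using (key 0).1
  have hm := measurable_cutoff (A := A) (M := M) (μ := μ) hη
  have h0 := cutoff_nonneg (A := A) (M := M) (μ := μ) hη
  have hi : Integrable (cutoff η A M μ) := by
    simpa using integrable_exp_inner_mul_cutoff (A := A) (M := M) hμ hb hη hη1 hn 0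
  have hl := lightTailed_normalized hm h0 (integrable_exp_sq_mul_cutoff hμ hb hη hη1 hn)
  have hp := isProbabilityMeasure_normalized h0 hi hZ
  refine ⟨hZ, ⟨hp, isLogConcave_normalized hm h0 (fun x y a b ha hb hab =>
    cutoff_rpow_mul_le hμ.logConcave hη x y ha hb hab) hZ, hl.tilts, ?_⟩, hl⟩
  rw [hl.tilts.tiltStable_iff]
  intro h θ hθ
  obtain ⟨hpos, c, hc⟩ := key h
  refine (variance_tilt_normalized_le hm h0 hi hZ hl.tilts h c θ).trans ?_
  rw [div_le_iff₀ hpos, one_pow, one_mul]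
  exact hc θ hθ

end

open Filter Topology

/-- A monomial in the direction `θ`, weighted by a Gaussian factor. -/
def gaussMonomial {n : ℕ} (t : ℝ) (θ : Euc n) (i : ℕ) (x : Euc n) : ℝ :=
  ⟪x, θ⟫ ^ i * exp (-t * ‖x‖ ^ 2)

section gaussMonomial

variable {n : ℕ} {t : ℝ} {θ : Euc n} {i : ℕ}

theorem continuous_gaussMonomial : Continuous (gaussMonomial t θ i) := by
  unfold gaussMonomial; fun_prop

theorem exists_abs_gaussMonomial_le (ht : 0 < t) (hθ : ‖θ‖ = 1) (hi : i ≤ 2) :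
    ∃ C, 0 ≤ C ∧ ∀ x, |gaussMonomial t θ i x| ≤ C * exp (-(t / 2) * ‖x‖ ^ 2) := by
  refine ⟨1 + 2 / t, by positivity, fun x => ?_⟩
  have h1 : |⟪x, θ⟫| ≤ ‖x‖ := by simpa [hθ] using abs_real_inner_le_norm x θ
  have h2 : ‖x‖ ^ i ≤ 1 + ‖x‖ ^ 2 := by
    interval_cases i <;> nlinarith [sq_nonneg (‖x‖ - 1), norm_nonneg x]
  have h3 : 1 + ‖x‖ ^ 2 ≤ (1 + 2 / t) * exp (t / 2 * ‖x‖ ^ 2) := by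
    have := add_one_le_exp (t / 2 * ‖x‖ ^ 2)
    have h4 : (1 + 2 / t) * (t / 2 * ‖x‖ ^ 2 + 1) =
      1 + ‖x‖ ^ 2 + (2 / t + t / 2 * ‖x‖ ^ 2) := by field_simp; ring
    have h5 : (1 + 2 / t) * (t / 2 * ‖x‖ ^ 2 + 1) ≤ (1 + 2 / t) * exp (t / 2 * ‖x‖ ^ 2) := by
      gcongr
    have : 0 ≤ 2 / t + t / 2 * ‖x‖ ^ 2 := by positivity
    linarith
  rw [gaussMonomial, abs_mul, abs_exp, abs_pow]
  calc |⟪x, θ⟫| ^ i * exp (-t * ‖x‖ ^ 2)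
      ≤ ((1 + 2 / t) * exp (t / 2 * ‖x‖ ^ 2)) * exp (-t * ‖x‖ ^ 2) := by
        gcongr
        exact (pow_le_pow_left₀ (abs_nonneg _) h1 i).trans (h2.trans h3)
    _ = _ := by rw [mul_assoc, ← exp_add]; ring_nf

theorem exists_abs_gaussMonomial_le_const (ht : 0 < t) (hθ : ‖θ‖ = 1) (hi : i ≤ 2) :
    ∃ C, 0 ≤ C ∧ ∀ x, |gaussMonomial t θ i x| ≤ C := by
  obtain ⟨C, hC, h⟩ := exists_abs_gaussMonomial_le ht hθ hi
  refine ⟨C, hC, fun x => (h x).trans (mul_le_of_le_one_right hC ?_)⟩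
  rw [exp_le_one_iff, neg_mul, neg_nonpos]
  positivity

theorem integrable_gaussMonomial (ht : 0 < t) (hθ : ‖θ‖ = 1) (hi : i ≤ 2) :
    Integrable (gaussMonomial t θ i) := by
  obtain ⟨C, hC, h⟩ := exists_abs_gaussMonomial_le ht hθ hi
  exact ((integrable_exp_neg_mul_norm_sq (n := n) (b := t / 2) (by positivity)).const_mul C).mono'
    continuous_gaussMonomial.aestronglyMeasurable (Eventually.of_forall h)

theorem integrable_gaussMonomial_of_finite {ν : Measure (Euc n)} [IsFiniteMeasure ν]
    (ht : 0 < t) (hθ : ‖θ‖ = 1) (hi : i ≤ 2) : Integrable (gaussMonomial t θ i) ν := by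
  obtain ⟨C, hC, h⟩ := exists_abs_gaussMonomial_le_const ht hθ hi
  exact (integrable_const C).mono' continuous_gaussMonomial.aestronglyMeasurable
    (Eventually.of_forall h)

theorem integral_gaussMonomial_zero_pos {ν : Measure (Euc n)} [IsProbabilityMeasure ν]
    (ht : 0 < t) : 0 < ∫ x, gaussMonomial t θ 0 x ∂ν := by
  have := integral_exp_pos (integrable_exp_neg_mul_norm_sq_add_inner (μ := ν) ht 0)
  simpa [gaussMonomial] using this

theorem variance_gtilt_zero_le_iff {ν : Measure (Euc n)} [IsProbabilityMeasure ν]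
    (ht : 0 < t) (hθ : ‖θ‖ = 1) (V : ℝ) :
    Var[fun x => ⟪x, θ⟫; gtilt ν t 0] ≤ V ↔
      (∫ x, gaussMonomial t θ 2 x ∂ν) * (∫ x, gaussMonomial t θ 0 x ∂ν) -
        (∫ x, gaussMonomial t θ 1 x ∂ν) ^ 2 ≤ V * (∫ x, gaussMonomial t θ 0 x ∂ν) ^ 2 := by
  have hi := integrable_exp_neg_mul_norm_sq_add_inner (μ := ν) ht 0
  have hpos := integral_gaussMonomial_zero_pos (ν := ν) (θ := θ) ht
  have hp : IsProbabilityMeasure (gtilt ν t 0) := by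
    rw [gtilt_eq_tilted ht 0]; exact isProbabilityMeasure_tilted hi
  have h0 : ∫ x, exp (-t * ‖x‖ ^ 2 + ⟪(0 : Euc n), x⟫) ∂ν = ∫ x, gaussMonomial t θ 0 x ∂ν := by
    simp [gaussMonomial]
  have h_int : ∀ i, ∫ x, ⟪x, θ⟫ ^ i ∂(gtilt ν t 0) =
      (∫ x, gaussMonomial t θ i x ∂ν) / ∫ x, gaussMonomial t θ 0 x ∂ν := by
    intro i
    rw [gtilt_eq_tilted ht 0, integral_tilted, h0, ← integral_div]
    refine integral_congr_ae (Eventually.of_forall fun x => ?_)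
    simp only [gaussMonomial, inner_zero_left, add_zero, smul_eq_mul]
    ring
  have hmem : MemLp (fun x => ⟪x, θ⟫) 2 (gtilt ν t 0) := by
    rw [memLp_two_iff_integrable_sq (by fun_prop), gtilt_eq_tilted ht 0, integrable_tilted_iff]
    · refine (integrable_gaussMonomial_of_finite (ν := ν) ht hθ le_rfl).congr
        (Eventually.of_forall fun x => ?_)
      simp only [gaussMonomial, inner_zero_left, add_zero, smul_eq_mul]
      ring
    · exact hi
  rw [variance_eq_sub hmem]
  have h2 := h_int 2
  have h1 := h_int 1
  simp only [pow_one] at h1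
  simp only [Pi.pow_apply]
  rw [h2, h1]
  set m0 := ∫ x, gaussMonomial t θ 0 x ∂ν
  set m1 := ∫ x, gaussMonomial t θ 1 x ∂ν
  set m2 := ∫ x, gaussMonomial t θ 2 x ∂ν
  have : m2 / m0 - (m1 / m0) ^ 2 = (m2 * m0 - m1 ^ 2) / m0 ^ 2 := by field_simp
  rw [this, div_le_iff₀ (by positivity)]

end gaussMonomial

section limits

variable {n : ℕ} {η M : ℝ} {μ : Measure (Euc n)}

theorem eventually_exp_neg_mul_cutoff_eq [IsProbabilityMeasure μ]
    (hi : Integrable (fun x => x) μ) (hη : 0 < η) (hM : 1 ≤ M) (y : Euc n) :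
    ∀ᶠ A in atTop, exp (-(A * exp (M * 8))) * cutoff η A M μ y = smooth η μ ((8 : ℝ) • y) := by
  obtain ⟨α, hα⟩ := exists_mul_exp_le_smooth hi hη ((8 : ℝ) • y)
  set β := ‖(8 : ℝ) • y‖ ^ 2 / η
  have hβ : 0 ≤ β := by positivity
  filter_upwards [eventually_ge_atTop (|α|), eventually_ge_atTop β] with A hA1 hA2
  have hA : 0 ≤ A := (abs_nonneg _).trans hA1
  have hα' := (neg_abs_le α)
  have key : cutoff η A M μ y = exp (A * exp (M * 8)) * smooth η μ ((8 : ℝ) • y) := by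
    refine le_antisymm (cutoff_le hη y le_rfl) (le_cutoff fun s hs => ?_)
    set t := (s - 8) / 8 with ht
    have ht0 : 0 ≤ t := by rw [ht]; linarith
    have hst : s • y = (1 + t) • ((8 : ℝ) • y) := by
      rw [smul_smul, ht]; ring_nf
    have h1 := hα t
    rw [← hst] at h1
    refine le_trans ?_ (mul_le_mul_of_nonneg_left h1 (exp_pos _).le)
    have h2 : exp (A * exp (M * s)) * (smooth η μ ((8 : ℝ) • y) * exp (-t * α - t ^ 2 * β / 2)) =
        exp (A * exp (M * s) + (-t * α - t ^ 2 * β / 2)) * smooth η μ ((8 : ℝ) • y) := by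
      rw [exp_add]; ring
    rw [h2]
    refine mul_le_mul_of_nonneg_right (exp_le_exp.2 ?_) (smooth_pos hη _).le
    have h3 : exp (M * s) = exp (M * 8) * exp (8 * M * t) := by
      rw [← exp_add, ht]; ring_nf
    have h4 := quadratic_le_exp_of_nonneg (x := 8 * M * t) (by positivity)
    have h5 : 1 ≤ exp (M * 8) := one_le_exp (by positivity)
    have h6 : t + t ^ 2 ≤ 8 * M * t + (8 * M * t) ^ 2 / 2 := by
      have : t ≤ M * t := by nlinarith
      nlinarith
    have h7 : A * (t + t ^ 2) ≤ A * exp (M * s) - A * exp (M * 8) := by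
      have : t + t ^ 2 ≤ exp (M * s) - exp (M * 8) := by
        rw [h3]
        have : t + t ^ 2 ≤ exp (8 * M * t) - 1 := by linarith
        nlinarith [sq_nonneg t]
      nlinarith
    have h8 : t * α ≤ t * A := mul_le_mul_of_nonneg_left ((le_abs_self α).trans hA1) ht0
    have h9 : t ^ 2 * β ≤ t ^ 2 * A := mul_le_mul_of_nonneg_left hA2 (sq_nonneg t)
    have h10 : 0 ≤ t ^ 2 * β := by positivity
    linarith
  rw [key, ← mul_assoc, ← exp_add, neg_add_cancel, exp_zero, one_mul]

theorem tendsto_integral_mul_cutoff [IsProbabilityMeasure μ]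
    (hi : Integrable (fun x => x) μ) (hη : 0 < η) (hM : 1 ≤ M) {F : Euc n → ℝ}
    (hF : Integrable F) :
    Tendsto (fun A => exp (-(A * exp (M * 8))) * ∫ y, F y * cutoff η A M μ y) atTop
      (𝓝 (∫ y, F y * smooth η μ ((8 : ℝ) • y))) := by
  simp_rw [← integral_const_mul]
  refine tendsto_integral_filter_of_dominated_convergence (fun y => ‖F y‖)
    (Eventually.of_forall fun A => ?_) (Eventually.of_forall fun A => Eventually.of_forall fun y => ?_)
    hF.norm (Eventually.of_forall fun y => ?_)
  · exact ((hF.aestronglyMeasurable.mul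
      (measurable_cutoff hη).aestronglyMeasurable).const_mul _)
  · have h1 := cutoff_le (A := A) (M := M) (μ := μ) hη y le_rfl
    have h2 := cutoff_nonneg (A := A) (M := M) (μ := μ) hη y
    have h3 := smooth_le_one (μ := μ) hη ((8 : ℝ) • y)
    have h4 : exp (-(A * exp (M * 8))) * cutoff η A M μ y ≤ 1 := by
      calc _ ≤ exp (-(A * exp (M * 8))) * (exp (A * exp (M * 8)) * smooth η μ ((8 : ℝ) • y)) := by
            gcongr
        _ = smooth η μ ((8 : ℝ) • y) := by
          rw [← mul_assoc, ← exp_add, neg_add_cancel, exp_zero, one_mul]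
        _ ≤ 1 := h3
    rw [mul_left_comm, norm_mul, norm_of_nonneg (mul_nonneg (exp_pos _).le h2)]
    exact mul_le_of_le_one_right (norm_nonneg _) h4
  · refine tendsto_const_nhds.congr' ?_
    filter_upwards [eventually_exp_neg_mul_cutoff_eq hi hη hM y] with A hA
    rw [mul_left_comm, hA]

theorem integral_mul_smooth_sq [IsProbabilityMeasure μ] {ε : ℝ} (hε : 0 < ε) {F : Euc n → ℝ}
    (hF : Integrable F) :
    ∫ x, F x * smooth (ε ^ 2) μ x =
      ε ^ n * ∫ z, (∫ u, F (ε • u + z) * gaussKernel 1 u) ∂μ := by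
  have hε2 : 0 < ε ^ 2 := by positivity
  have hg := continuous_gaussKernel (n := n) (η := ε ^ 2)
  simp_rw [smooth, ← integral_const_mul]
  rw [integral_integral_swap]
  · refine integral_congr_ae (Eventually.of_forall fun z => ?_)
    simp only
    rw [← integral_add_right_eq_self (μ := volume) (fun x => F x * gaussKernel (ε ^ 2) (x - z)) z]
    have h1 := Measure.integral_comp_smul volume
      (fun w : Euc n => F (w + z) * gaussKernel (ε ^ 2) w) ε
    rw [finrank_euclideanSpace_fin, abs_of_nonneg (by positivity), smul_eq_mul,
      eq_inv_mul_iff_mul_eq₀ (by positivity)] at h1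
    simp only [add_sub_cancel_right]
    rw [← h1, integral_const_mul]
    congr 1
    refine integral_congr_ae (Eventually.of_forall fun u => ?_)
    simp only [gaussKernel, norm_smul, norm_of_nonneg hε.le]
    congr 2
    field_simp
  · have h1 : Integrable (fun p : Euc n × Euc n => F p.1) (volume.prod μ) := hF.comp_fst μ
    refine h1.norm.mono' (h1.aestronglyMeasurable.mul
      (hg.comp (by fun_prop)).aestronglyMeasurable) (Eventually.of_forall fun p => ?_)
    rw [Function.uncurry, norm_mul, norm_of_nonneg (gaussKernel_pos _).le]
    exact mul_le_of_le_one_right (norm_nonneg _) (gaussKernel_le_one hε2 _)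

theorem tendsto_integral_smul_add_mul_gaussKernel [IsProbabilityMeasure μ] {F : Euc n → ℝ}
    (hF : Continuous F) {C : ℝ} (hC : ∀ x, |F x| ≤ C) :
    Tendsto (fun ε : ℝ => ∫ z, (∫ u, F (ε • u + z) * gaussKernel 1 u) ∂μ) (𝓝[>] 0)
      (𝓝 ((∫ u : Euc n, gaussKernel 1 u) * ∫ z, F z ∂μ)) := by
  have hg := continuous_gaussKernel (n := n) (η := 1)
  have hgi := integrable_gaussKernel (n := n) one_pos
  have hb : ∀ (ε : ℝ) (z u : Euc n), ‖F (ε • u + z) * gaussKernel 1 u‖ ≤ C * gaussKernel 1 u := by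
    intro ε z u
    rw [norm_mul, norm_of_nonneg (gaussKernel_pos u).le]
    exact mul_le_mul_of_nonneg_right (hC _) (gaussKernel_pos u).le
  rw [← integral_const_mul]
  refine tendsto_integral_filter_of_dominated_convergence
    (fun _ => C * ∫ u : Euc n, gaussKernel 1 u)
    (Eventually.of_forall fun ε => ?_) (Eventually.of_forall fun ε => Eventually.of_forall fun z => ?_)
    (integrable_const _) (Eventually.of_forall fun z => ?_)
  · have : Continuous (fun p : Euc n × Euc n => F (ε • p.2 + p.1) * gaussKernel 1 p.2) := by
      fun_prop
    exact (this.stronglyMeasurable.integral_prod_right (ν := volume)).aestronglyMeasurable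
  · rw [← integral_const_mul]
    exact norm_integral_le_of_norm_le (hgi.const_mul C) (Eventually.of_forall (hb ε z))
  · rw [mul_comm, ← integral_const_mul]
    refine tendsto_integral_filter_of_dominated_convergence (fun u => C * gaussKernel 1 u)
      (Eventually.of_forall fun ε => ?_)
      (Eventually.of_forall fun ε => Eventually.of_forall (hb ε z))
      (hgi.const_mul C) (Eventually.of_forall fun u => ?_)
    · exact Continuous.aestronglyMeasurable (by fun_prop)
    · have : Continuous (fun ε : ℝ => F (ε • u + z) * gaussKernel 1 u) := by fun_prop
      have h := this.tendsto 0
      rw [zero_smul, zero_add] at h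
      exact h.mono_left nhdsWithin_le_nhds

end limits

section assembly

variable {n : ℕ} {μ : Measure (Euc n)}

theorem gaussMonomial_smul (t : ℝ) {s : ℝ} (hs : s ≠ 0) (θ : Euc n) (i : ℕ) (x : Euc n) :
    gaussMonomial (s ^ 2 * t) θ i x = (s ^ i)⁻¹ * gaussMonomial t θ i (s • x) := by
  simp only [gaussMonomial, real_inner_smul_left, norm_smul, mul_pow, norm_eq_abs, sq_abs]
  rw [← mul_assoc, inv_mul_cancel_left₀ (pow_ne_zero i hs)]
  ring_nf

theorem integral_gaussMonomial_mul_smooth_le (hμ : IsTiltStableLogConcave μ) (hb : bary μ = 0)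
    (hn : 0 < n) {η : ℝ} (hη : 0 < η) (hη1 : η ≤ 1) {B t : ℝ} (hB : 0 < B)
    (hB3 : B ^ 3 = n * Ktilde n ^ 2) (ht : 0 < t) {θ : Euc n} (hθ : ‖θ‖ = 1) :
    (∫ x, gaussMonomial t θ 2 x * smooth η μ x) * (∫ x, gaussMonomial t θ 0 x * smooth η μ x) -
        (∫ x, gaussMonomial t θ 1 x * smooth η μ x) ^ 2 ≤
      64 * (160 * B) * (∫ x, gaussMonomial t θ 0 x * smooth η μ x) ^ 2 := by
  have := hμ.prob
  have ht' : 0 < 8 ^ 2 * t := by positivity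
  obtain ⟨M, hM, A₀, hA⟩ := exists_isTiltStableLogConcave_normalized_cutoff hμ hb hη hη1 hn
  have key : ∀ A, A₀ ≤ A →
      (exp (-(A * exp (M * 8))) * ∫ y, gaussMonomial (8 ^ 2 * t) θ 2 y * cutoff η A M μ y) *
        (exp (-(A * exp (M * 8))) * ∫ y, gaussMonomial (8 ^ 2 * t) θ 0 y * cutoff η A M μ y) -
        (exp (-(A * exp (M * 8))) *
          ∫ y, gaussMonomial (8 ^ 2 * t) θ 1 y * cutoff η A M μ y) ^ 2 ≤
      160 * B * (exp (-(A * exp (M * 8))) *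
        ∫ y, gaussMonomial (8 ^ 2 * t) θ 0 y * cutoff η A M μ y) ^ 2 := by
    intro A hA₀
    obtain ⟨hZ, hν, hl⟩ := hA A hA₀
    have := hν.prob
    have hm := measurable_cutoff (A := A) (M := M) (μ := μ) hη
    have h0 := cutoff_nonneg (A := A) (M := M) (μ := μ) hη
    have h := (variance_gtilt_zero_le_iff ht' hθ _).1
      (hl.variance_gtilt_le hν hn hB hB3 ht' 0 hθ)
    simp only [integral_normalized hm h0] at h
    set Z := ∫ y, cutoff η A M μ y
    set I0 := ∫ y, gaussMonomial (8 ^ 2 * t) θ 0 y * cutoff η A M μ y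
    set I1 := ∫ y, gaussMonomial (8 ^ 2 * t) θ 1 y * cutoff η A M μ y
    set I2 := ∫ y, gaussMonomial (8 ^ 2 * t) θ 2 y * cutoff η A M μ y
    set e := exp (-(A * exp (M * 8)))
    have h2 := mul_le_mul_of_nonneg_left h (show 0 ≤ (e * Z) ^ 2 by positivity)
    have hZ' := hZ.ne'
    clear_value Z I0 I1 I2 e
    calc e * I2 * (e * I0) - (e * I1) ^ 2
        = (e * Z) ^ 2 * (I2 / Z * (I0 / Z) - (I1 / Z) ^ 2) := by field_simp
      _ ≤ _ := h2
      _ = _ := by field_simp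
  have hT : ∀ i, i ≤ 2 → _ := fun i hi => tendsto_integral_mul_cutoff (M := M)
    hμ.tilts.integrable_id hη hM (integrable_gaussMonomial ht' hθ hi)
  have hlim := le_of_tendsto_of_tendsto
    (((hT 2 le_rfl).mul (hT 0 (by norm_num))).sub ((hT 1 (by norm_num)).pow 2))
    (((hT 0 (by norm_num)).pow 2).const_mul (160 * B))
    ((eventually_ge_atTop A₀).mono key)
  have hK : ∀ i, ∫ y, gaussMonomial (8 ^ 2 * t) θ i y * smooth η μ ((8 : ℝ) • y) =
      ((8 : ℝ) ^ i)⁻¹ * (((8 : ℝ) ^ n)⁻¹ * ∫ x, gaussMonomial t θ i x * smooth η μ x) := by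
    intro i
    have h1 := Measure.integral_comp_smul volume
      (fun x : Euc n => gaussMonomial t θ i x * smooth η μ x) 8
    rw [finrank_euclideanSpace_fin, abs_of_nonneg (by positivity), smul_eq_mul] at h1
    rw [← h1, ← integral_const_mul]
    refine integral_congr_ae (Eventually.of_forall fun y => ?_)
    simp only
    rw [gaussMonomial_smul t (by norm_num : (8 : ℝ) ≠ 0), mul_assoc]
  simp only [hK] at hlim
  set J0 := ∫ x, gaussMonomial t θ 0 x * smooth η μ x
  set J1 := ∫ x, gaussMonomial t θ 1 x * smooth η μ x
  set J2 := ∫ x, gaussMonomial t θ 2 x * smooth η μ x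
  have h2 := mul_le_mul_of_nonneg_left hlim (show (0 : ℝ) ≤ 64 * (8 ^ n) ^ 2 by positivity)
  have h8 : ((8 : ℝ) ^ n) ≠ 0 := by positivity
  generalize (8 : ℝ) ^ n = κ at h2 h8
  clear_value J0 J1 J2
  calc J2 * J0 - J1 ^ 2 = _ := by field_simp; norm_num
    _ ≤ _ := h2
    _ = _ := by field_simp

theorem IsTiltStableLogConcave.variance_gtilt_zero_le (hμ : IsTiltStableLogConcave μ)
    (hb : bary μ = 0) (hn : 0 < n) {B t : ℝ} (hB : 0 < B) (hB3 : B ^ 3 = n * Ktilde n ^ 2)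
    (ht : 0 < t) {θ : Euc n} (hθ : ‖θ‖ = 1) :
    Var[fun x => ⟪x, θ⟫; gtilt μ t 0] ≤ 64 * (160 * B) := by
  have := hμ.prob
  rw [variance_gtilt_zero_le_iff ht hθ]
  have hT : ∀ i, i ≤ 2 → Tendsto
      (fun ε : ℝ => ∫ z, (∫ u, gaussMonomial t θ i (ε • u + z) * gaussKernel 1 u) ∂μ) (𝓝[>] 0)
      (𝓝 ((∫ u : Euc n, gaussKernel 1 u) * ∫ z, gaussMonomial t θ i z ∂μ)) := fun i hi => by
    obtain ⟨C, -, hC⟩ := exists_abs_gaussMonomial_le_const ht hθ hi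
    exact tendsto_integral_smul_add_mul_gaussKernel continuous_gaussMonomial hC
  have hlim := le_of_tendsto_of_tendsto
    (((hT 2 le_rfl).mul (hT 0 (by norm_num))).sub ((hT 1 (by norm_num)).pow 2))
    (((hT 0 (by norm_num)).pow 2).const_mul (64 * (160 * B))) (by
      filter_upwards [Ioo_mem_nhdsGT (zero_lt_one' ℝ)] with ε hε
      have hε0 : 0 < ε ^ n := pow_pos hε.1 n
      have h := integral_gaussMonomial_mul_smooth_le hμ hb hn (η := ε ^ 2) (pow_pos hε.1 2)
        (pow_le_one₀ hε.1.le hε.2.le) hB hB3 ht hθ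
      rw [integral_mul_smooth_sq hε.1 (integrable_gaussMonomial ht hθ le_rfl),
        integral_mul_smooth_sq hε.1 (integrable_gaussMonomial ht hθ (by norm_num)),
        integral_mul_smooth_sq hε.1 (integrable_gaussMonomial ht hθ (by norm_num))] at h
      refine le_of_mul_le_mul_left (a := (ε ^ n) ^ 2) ?_ (by positivity)
      generalize ε ^ n = κ at h ⊢
      linarith)
  have hN := integral_gaussKernel_pos (n := n) one_pos
  refine le_of_mul_le_mul_left (a := (∫ u : Euc n, gaussKernel 1 u) ^ 2) ?_ (by positivity)
  convert hlim using 1 <;> ring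

theorem IsTiltStableLogConcave.variance_gtilt_le (hμ : IsTiltStableLogConcave μ)
    (hn : 0 < n) {B t : ℝ} (hB : 0 < B) (hB3 : B ^ 3 = n * Ktilde n ^ 2)
    (ht : 0 < t) (h : Euc n) {θ : Euc n} (hθ : ‖θ‖ = 1) :
    Var[fun x => ⟪x, θ⟫; gtilt μ t h] ≤ 64 * (160 * B) := by
  have := hμ.prob
  obtain ⟨g, hg⟩ := hμ.tilts.exists_bary_tilt_eq ht h
  have hρ := hμ.tilt g
  have := hρ.prob
  set a := bary (_root_.tilt μ g) with ha
  have hρ' := hρ.map_sub a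
  have := hρ'.prob
  have hb : bary ((_root_.tilt μ g).map (fun x => x - a)) = 0 := by
    rw [bary, integral_map (by fun_prop) (by fun_prop),
      integral_sub hρ.tilts.integrable_id (integrable_const a)]
    simp [ha, bary]
  have h1 := hρ'.variance_gtilt_zero_le hb hn hB hB3 ht hθ
  rw [hμ.tilts.gtilt_eq_tilted_tilt ht h a, hg, sub_sub_cancel]
  rw [gtilt_eq_tilted ht 0] at h1
  have h2 := map_tilted (_root_.tilt μ g) (MeasurableEquiv.subRight a)
    (f := fun x => -t * ‖x‖ ^ 2 + ⟪(0 : Euc n), x⟫)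
  have h3 : (⇑(MeasurableEquiv.subRight a) : Euc n → Euc n) = fun x => x - a := rfl
  rw [h3] at h2
  rw [h2, variance_map (by fun_prop) (by fun_prop)] at h1
  simp only [Function.comp_def, inner_zero_left, add_zero, inner_sub_left] at h1
  have h4 : IsProbabilityMeasure ((_root_.tilt μ g).tilted fun x => -t * ‖x - a‖ ^ 2) := by
    rw [← sub_sub_cancel h g, ← hg, ← hμ.tilts.gtilt_eq_tilted_tilt ht h a, gtilt_eq_tilted ht h]
    exact isProbabilityMeasure_tilted (integrable_exp_neg_mul_norm_sq_add_inner ht h)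
  rwa [variance_sub_const (by fun_prop)] at h1

end assembly

end

/-- Every 1-tilt-stable log-concave probability measure on `ℝⁿ` is
`C ⬝ n^(1/6) ⬝ K̃ₙ^(1/3)`-strongly tilt-stable, for a universal constant `C > 0`. -/
theorem statement6 :
    ∃ C : ℝ, 0 < C ∧ ∀ (n : ℕ) (μ : Measure (Euc n)),
      IsProbabilityMeasure μ → IsLogConcave μ → TiltsWellDefined μ → TiltStable μ 1 →
      StronglyTiltStable μ (C * (n : ℝ) ^ ((1 : ℝ) / 6) * Ktilde n ^ ((1 : ℝ) / 3)) := by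
  refine ⟨102, by norm_num, fun n μ hp hlc htw hts t ht h θ hθ => ?_⟩
  have hμ : IsTiltStableLogConcave μ := ⟨hp, hlc, htw, hts⟩
  have hn : 0 < n := by
    rcases n.eq_zero_or_pos with rfl | hn
    · rw [Subsingleton.elim θ 0, norm_zero] at hθ
      norm_num at hθ
    · exact hn
  have hn0 : (0 : ℝ) < n := by exact_mod_cast hn
  have hK : 0 < Ktilde n := lt_of_lt_of_le (by positivity) (sqrt_inv_le_Ktilde hn)
  set b := (n : ℝ) ^ ((1 : ℝ) / 6) * Ktilde n ^ ((1 : ℝ) / 3) with hbd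
  have hb : 0 < b := by positivity
  have hb3 : (b ^ 2) ^ 3 = n * Ktilde n ^ 2 := by
    rw [← pow_mul, hbd, mul_pow, ← rpow_mul_natCast hn0.le, ← rpow_mul_natCast hK.le,
      show ((1 : ℝ) / 6 * ((2 * 3 : ℕ) : ℝ)) = 1 by norm_num,
      show ((1 : ℝ) / 3 * ((2 * 3 : ℕ) : ℝ)) = ((2 : ℕ) : ℝ) by norm_num, rpow_one, rpow_natCast]
  have hi : Integrable (fun x => x) (gtilt μ t h) := by
    rw [gtilt_eq_tilted ht h, integrable_tilted_iff (integrable_exp_neg_mul_norm_sq_add_inner ht h)]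
    refine htw.integrable_of_le (by fun_prop) 1 1 h fun x => ?_
    rw [norm_smul, norm_of_nonneg (exp_pos _).le, one_mul, one_mul, mul_comm, exp_add]
    have h1 : ‖x‖ ≤ exp ‖x‖ := by linarith [add_one_le_exp ‖x‖]
    have h2 : exp (-t * ‖x‖ ^ 2) ≤ 1 := by
      rw [exp_le_one_iff, neg_mul, neg_nonpos]
      positivity
    exact mul_le_mul h1 (mul_le_of_le_one_left (exp_pos _).le h2) (by positivity) (exp_pos _).le
  have hpt : IsProbabilityMeasure (gtilt μ t h) := by
    rw [gtilt_eq_tilted ht h]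
    exact isProbabilityMeasure_tilted (integrable_exp_neg_mul_norm_sq_add_inner ht h)
  rw [integral_sub_bary_sq hi]
  refine (hμ.variance_gtilt_le hn (by positivity) hb3 ht h hθ).trans ?_
  rw [mul_assoc 102, ← hbd]
  nlinarith [sq_nonneg b]

end
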